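/- Let a ≥ 1 and b ≥ 1 be integers and let F ∈ ℝ[x₀,x₁,y₀,y₁] be a nonzero bihomogeneous polynomial of bidegree (2a, 2b) (homogeneous of degree 2a in (x₀,x₁) and of degree 2b in (y₀,y₁)) that is squarefree as an element of ℂ[x₀,x₁,y₀,y₁]. If the real zero set ℝZ(F) = {([x],[y]) ∈ ℙ¹(ℝ)×ℙ¹(ℝ) : F(x,y) = 0} is finite, then |ℝZ(F)| ≤ 3ab − a − b + 1. (This is the Petrovsky-type bound for finite real curves of bidegree (2a,2b) in the quadric hyperboloid ℙ¹×ℙ¹ with its standard real structure, i.e., the ruled surface Σ₀.) -/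

import Mathlib

section
open MvPolynomial

/-- `F ∈ R[x₀,x₁,y₀,y₁]` is bihomogeneous of bidegree `(d₁, d₂)`: every monomial of `F`
has degree `d₁` in `(x₀,x₁)` and degree `d₂` in `(y₀,y₁)`. -/
def Bihomogeneous {R : Type*} [CommSemiring R]
    (F : MvPolynomial (Fin 4) R) (d₁ d₂ : ℕ) : Prop :=
  ∀ d ∈ F.support, d 0 + d 1 = d₁ ∧ d 2 + d 3 = d₂

/-- The real zero set of a bihomogeneous polynomial in `ℙ¹(ℝ) × ℙ¹(ℝ)`. -/
noncomputable def RZ2 (F : MvPolynomial (Fin 4) ℝ) :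
    Set (Projectivization ℝ (Fin 2 → ℝ) × Projectivization ℝ (Fin 2 → ℝ)) :=
  {p | MvPolynomial.eval ![p.1.rep 0, p.1.rep 1, p.2.rep 0, p.2.rep 1] F = 0}

/-- The set of singular points of the curve `{Q = 0} ⊂ ℙ¹(ℂ) × ℙ¹(ℂ)`: points at which
all four partial derivatives of `Q` vanish. -/
noncomputable def SingSet2 (Q : MvPolynomial (Fin 4) ℂ) :
    Set (Projectivization ℂ (Fin 2 → ℂ) × Projectivization ℂ (Fin 2 → ℂ)) :=
  {p | ∀ i : Fin 4,
    MvPolynomial.eval ![p.1.rep 0, p.1.rep 1, p.2.rep 0, p.2.rep 1] (pderiv i Q) = 0}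

/-- The point `p` is a node of the curve `{Q = 0} ⊂ ℙ¹(ℂ) × ℙ¹(ℂ)`: the `4×4` complex
Hessian matrix of `Q` at (representatives of) `p` has rank `2`. -/
noncomputable def IsNodeAt2 (Q : MvPolynomial (Fin 4) ℂ)
    (p : Projectivization ℂ (Fin 2 → ℂ) × Projectivization ℂ (Fin 2 → ℂ)) : Prop :=
  (Matrix.of fun i j : Fin 4 =>
    MvPolynomial.eval ![p.1.rep 0, p.1.rep 1, p.2.rep 0, p.2.rep 1]
      (pderiv i (pderiv j Q))).rank = 2

end

set_option autoImplicit false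
set_option linter.all false

namespace Petro
open Polynomial
open scoped Polynomial.Bivariate

/-- partial derivative in the inner variable -/
noncomputable def dX {R : Type*} [CommRing R] (p : R[X][Y]) : R[X][Y] :=
  Bivariate.swap (derivative (Bivariate.swap p))

section basics
variable {R : Type*} [CommRing R]

lemma swap_coeff (p : R[X][Y]) (i j : ℕ) :
    ((Bivariate.swap p).coeff j).coeff i = (p.coeff i).coeff j := by
  induction p using Polynomial.induction_on' with
  | add p q hp hq => simp [hp, hq]
  | monomial n r =>
    induction r using Polynomial.induction_on' with
    | add p q hp hq => simp only [map_add, coeff_add, hp, hq]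
    | monomial m s =>
      rw [Bivariate.swap_monomial_monomial]
      simp only [coeff_monomial]
      split_ifs <;> simp_all [coeff_monomial]

lemma biv_ext {p q : R[X][Y]} (h : ∀ i j, (p.coeff j).coeff i = (q.coeff j).coeff i) : p = q := by
  ext j i; exact h i j

lemma dX_coeff (p : R[X][Y]) (i j : ℕ) :
    ((dX p).coeff j).coeff i = (p.coeff j).coeff (i + 1) * (i + 1) := by
  rw [dX, swap_coeff, coeff_derivative]
  have : ((i : R[X]) + 1) = C ((i : R) + 1) := by simp
  rw [this, coeff_mul_C, swap_coeff]

lemma dX_coeff' (p : R[X][Y]) (j : ℕ) : (dX p).coeff j = derivative (p.coeff j) := by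
  ext i; rw [dX_coeff, coeff_derivative]

lemma dY_coeff (p : R[X][Y]) (i j : ℕ) :
    ((derivative p).coeff j).coeff i = (p.coeff (j+1)).coeff i * (j + 1) := by
  rw [coeff_derivative]
  have : ((j : R[X]) + 1) = C ((j : R) + 1) := by simp
  rw [this, coeff_mul_C]

lemma swap_dX (p : R[X][Y]) : Bivariate.swap (dX p) = derivative (Bivariate.swap p) := by
  rw [dX, Bivariate.swap_swap_apply]

lemma swap_dY (p : R[X][Y]) : Bivariate.swap (derivative p) = dX (Bivariate.swap p) := by
  rw [dX, Bivariate.swap_swap_apply]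

lemma dX_add (p q : R[X][Y]) : dX (p + q) = dX p + dX q := by simp [dX]
lemma dX_sub (p q : R[X][Y]) : dX (p - q) = dX p - dX q := by simp [dX]
lemma dX_mul (p q : R[X][Y]) : dX (p * q) = dX p * q + p * dX q := by
  simp [dX, Bivariate.swap_swap_apply]

lemma dX_dY (p : R[X][Y]) : dX (derivative p) = derivative (dX p) := by
  apply biv_ext; intro i j
  rw [dX_coeff, dY_coeff, dY_coeff, dX_coeff]; ring

lemma evalEval_swap (x y : R) (p : R[X][Y]) :
    (Bivariate.swap p).evalEval x y = p.evalEval y x := by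
  have := Bivariate.aevalAeval_swap (R := R) x y p
  rwa [coe_aevalAeval_eq_evalEval, coe_aevalAeval_eq_evalEval] at this

lemma coeff_coeff_mul (p q : R[X][Y]) (i j : ℕ) : ((p * q).coeff j).coeff i =
    ∑ u ∈ Finset.HasAntidiagonal.antidiagonal j, ∑ v ∈ Finset.HasAntidiagonal.antidiagonal i,
      (p.coeff u.1).coeff v.1 * (q.coeff u.2).coeff v.2 := by
  rw [coeff_mul, finsetSum_coeff]
  exact Finset.sum_congr rfl fun u _ => coeff_mul _ _ _

end basics

/-- polynomials of degree `< k` in `x`, `< l` in `y`. -/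
def Pol (K : Type*) [Field K] (k l : ℕ) : Submodule K K[X][Y] where
  carrier := {p | ∀ i j, (k ≤ i ∨ l ≤ j) → (p.coeff j).coeff i = 0}
  add_mem' := by
    intro p q hp hq i j h
    simp [hp i j h, hq i j h]
  zero_mem' := by intro i j _; simp
  smul_mem' := by
    intro c p hp i j h
    simp [hp i j h]

section pol
variable {K : Type*} [Field K]

lemma mem_Pol {k l : ℕ} {p : K[X][Y]} :
    p ∈ Pol K k l ↔ ∀ i j, (k ≤ i ∨ l ≤ j) → (p.coeff j).coeff i = 0 := Iff.rfl

lemma Pol_mono {k l k' l' : ℕ} (hk : k ≤ k') (hl : l ≤ l') : Pol K k l ≤ Pol K k' l' := by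
  intro p hp i j h
  exact hp i j (by omega)

lemma Pol_mul {k l m n k' l' : ℕ} {p q : K[X][Y]} (hp : p ∈ Pol K k l) (hq : q ∈ Pol K m n)
    (hk : k + m ≤ k' + 1) (hl : l + n ≤ l' + 1) : p * q ∈ Pol K k' l' := by
  intro i j h
  rw [coeff_coeff_mul]
  refine Finset.sum_eq_zero fun u hu => Finset.sum_eq_zero fun v hv => ?_
  rw [Finset.HasAntidiagonal.mem_antidiagonal] at hu hv
  by_cases h1 : k ≤ v.1 ∨ l ≤ u.1
  · rw [hp _ _ h1, zero_mul]
  · rw [hq v.2 u.2 (by omega), mul_zero]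

lemma Pol_swap {k l : ℕ} {p : K[X][Y]} : Bivariate.swap p ∈ Pol K k l ↔ p ∈ Pol K l k := by
  simp only [mem_Pol, swap_coeff]
  exact ⟨fun h i j hh => h j i hh.symm, fun h i j hh => h j i hh.symm⟩

lemma Pol_coeff_eq_zero {k l j : ℕ} {p : K[X][Y]} (hp : p ∈ Pol K k l) (h : l ≤ j) :
    p.coeff j = 0 := by ext i; simpa using hp i j (Or.inr h)

lemma Pol_coeff_degree {k l : ℕ} {p : K[X][Y]} (hp : p ∈ Pol K k l) (j : ℕ) :
    (p.coeff j).degree < k := by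
  rw [← mem_degreeLT, mem_degreeLT, degree_lt_iff_coeff_zero]
  intro m hm; exact hp m j (Or.inl hm)

lemma Pol_natDegree {k l : ℕ} {p : K[X][Y]} (hp : p ∈ Pol K k (l+1)) : p.natDegree ≤ l := by
  rw [natDegree_le_iff_coeff_eq_zero]
  intro N hN; exact Pol_coeff_eq_zero hp hN

lemma Pol_coeff_natDegree {k l : ℕ} {p : K[X][Y]} (hp : p ∈ Pol K (k+1) l) (j : ℕ) :
    (p.coeff j).natDegree ≤ k := by
  rw [natDegree_le_iff_coeff_eq_zero]
  intro N hN; exact hp N j (Or.inl hN)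

lemma Pol_of_degree {k l : ℕ} {p : K[X][Y]} (h1 : ∀ j, (p.coeff j).degree < k)
    (h2 : ∀ j, l ≤ j → p.coeff j = 0) : p ∈ Pol K k l := by
  intro i j h
  rcases h with h | h
  · exact (degree_lt_iff_coeff_zero _ _).1 (h1 j) i h
  · simp [h2 j h]

lemma exists_Pol (p : K[X][Y]) : ∃ k l, p ∈ Pol K k l := by
  refine ⟨(Bivariate.swap p).natDegree + 1, p.natDegree + 1, ?_⟩
  intro i j h
  rcases h with h | h
  · rw [← swap_coeff, coeff_eq_zero_of_natDegree_lt (p := Bivariate.swap p) (by omega)]; simp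
  · rw [coeff_eq_zero_of_natDegree_lt (p := p) (by omega)]; simp

lemma Pol_monomial {k l i j : ℕ} (hi : i < k) (hj : j < l) (c : K) :
    monomial j (monomial i c) ∈ Pol K k l := by
  intro i' j' h
  rw [coeff_monomial]
  split_ifs with h1
  · rw [coeff_monomial, if_neg (by omega)]
  · simp

noncomputable def PolEquiv (K : Type*) [Field K] (k l : ℕ) : Pol K k l ≃ₗ[K] (Fin k × Fin l → K) where
  toFun p u := ((p : K[X][Y]).coeff u.2).coeff u.1
  map_add' := by intro p q; ext u; simp
  map_smul' := by intro c p; ext u; simp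
  invFun v := ∑ u : Fin k × Fin l, v u • ⟨monomial u.2 (monomial u.1 1), Pol_monomial u.1.2 u.2.2 1⟩
  left_inv := by
    intro p
    ext j i
    simp only [Submodule.coe_sum, Submodule.coe_smul, finsetSum_coeff, coeff_smul, coeff_monomial,
      apply_ite (fun q : K[X] => q.coeff i), coeff_zero, smul_eq_mul, mul_ite, mul_one, mul_zero]
    by_cases h : i < k ∧ j < l
    · rw [Finset.sum_eq_single (⟨⟨i, h.1⟩, ⟨j, h.2⟩⟩ : Fin k × Fin l)]
      · simp
      · rintro ⟨⟨i', _⟩, ⟨j', _⟩⟩ - hne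
        by_cases h1 : j' = j
        · by_cases h2 : i' = i
          · subst h1; subst h2; simp at hne
          · simp [h1, h2]
        · simp [h1]
      · simp
    · rw [p.2 i j (by omega)]
      refine Finset.sum_eq_zero ?_
      rintro ⟨⟨i', _⟩, ⟨j', _⟩⟩ -
      by_cases h1 : j' = j
      · by_cases h2 : i' = i
        · subst h1; subst h2; exact absurd ⟨by assumption, by assumption⟩ h
        · simp [h1, h2]
      · simp [h1]
  right_inv := by
    intro v
    ext ⟨⟨i, hi⟩, ⟨j, hj⟩⟩
    simp only [Submodule.coe_sum, Submodule.coe_smul, finsetSum_coeff, coeff_smul, coeff_monomial,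
      apply_ite (fun q : K[X] => q.coeff i), coeff_zero, smul_eq_mul, mul_ite, mul_one, mul_zero]
    rw [Finset.sum_eq_single (⟨⟨i, hi⟩, ⟨j, hj⟩⟩ : Fin k × Fin l)]
    · simp
    · rintro ⟨⟨i', _⟩, ⟨j', _⟩⟩ - hne
      by_cases h1 : j' = j
      · by_cases h2 : i' = i
        · subst h1; subst h2; simp at hne
        · simp [h1, h2]
      · simp [h1]
    · simp

instance Pol_fd (k l : ℕ) : FiniteDimensional K (Pol K k l) :=
  Module.Finite.equiv (PolEquiv K k l).symm

lemma Pol_finrank (k l : ℕ) : Module.finrank K (Pol K k l) = k * l := by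
  rw [(PolEquiv K k l).finrank_eq]; simp

lemma Pol_dX {k l : ℕ} {p : K[X][Y]} (hp : p ∈ Pol K (k+1) l) : dX p ∈ Pol K k l := by
  intro i j h
  rw [dX_coeff, hp _ _ (by omega), zero_mul]

lemma Pol_dY {k l : ℕ} {p : K[X][Y]} (hp : p ∈ Pol K k (l+1)) : derivative p ∈ Pol K k l := by
  intro i j h
  rw [dY_coeff, hp _ _ (by omega), zero_mul]

end pol
end Petro

set_option autoImplicit false
set_option linter.all false

namespace Petro
open Polynomial
open scoped Polynomial.Bivariate

section dc
variable {K : Type*} [Field K]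

lemma Pol_C {k l : ℕ} {γ : K[X]} (h : γ.degree < k) (hl : 0 < l) : C γ ∈ Pol K k l := by
  refine Pol_of_degree (fun j => ?_) (fun j hj => ?_)
  · rw [coeff_C]; split_ifs
    · exact h
    · simpa using bot_lt_iff_ne_bot.2 (by simp)
  · rw [coeff_C, if_neg (by omega)]

lemma Pol_Xpow {k l j : ℕ} (hk : 0 < k) (hl : j < l) : (Y ^ j : K[X][Y]) ∈ Pol K k l := by
  intro i' j' h
  rw [coeff_X_pow]
  split_ifs with h1
  · rw [coeff_one, if_neg (by omega)]
  · simp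

lemma Pol_CXmon {k l i j : ℕ} (hi : i < k) (hj : j < l) :
    (C (X ^ i) * Y ^ j : K[X][Y]) ∈ Pol K k l := by
  have := Pol_monomial (K := K) hi hj 1
  rwa [← C_mul_X_pow_eq_monomial, ← C_mul_X_pow_eq_monomial, C_1, one_mul] at this

lemma coeff_helper (γ : K[X]) (R : K[X][Y]) {j n m : ℕ} (h : m = n + j) :
    (C γ * Y ^ j * R).coeff m = γ * R.coeff n := by
  subst h
  rw [mul_assoc, coeff_C_mul, coeff_X_pow_mul]

instance Pol_free (k l : ℕ) : Module.Free K (Pol K k l) :=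
  Module.Free.of_equiv (PolEquiv K k l).symm

lemma DC_step {P Q : K[X][Y]} {nP nQ eP eQ A B La Lb m : ℕ}
    (hP : P ∈ Pol K (eP+1) (nP+1)) (hQ : Q ∈ Pol K (eQ+1) (nQ+1))
    (hcop : IsCoprime (P.coeff nP) (Q.coeff nQ))
    (hq : (Q.coeff nQ).degree = eQ)
    (hAB : A + eP = B + eQ) (hL : La + nP = Lb + nQ) (hLa : nQ ≤ La)
    {α β : K[X][Y]} (hα : α ∈ Pol K A (La + m + 1)) (hβ : β ∈ Pol K B (Lb + m + 1))
    (hg : (α * P + β * Q).coeff (La + nP + m) = 0) :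
    ∃ α' ∈ Pol K A (La + m), ∃ β' ∈ Pol K B (Lb + m), α' * P + β' * Q = α * P + β * Q := by
  have h1 : (α * P).coeff (La + nP + m) = α.coeff (La + m) * P.coeff nP := by
    rw [show La + nP + m = La + m + nP by ring]
    exact coeff_mul_add_eq_of_natDegree_le (Pol_natDegree hα) (Pol_natDegree hP)
  have h2 : (β * Q).coeff (La + nP + m) = β.coeff (Lb + m) * Q.coeff nQ := by
    rw [show La + nP + m = Lb + m + nQ by omega]
    exact coeff_mul_add_eq_of_natDegree_le (Pol_natDegree hβ) (Pol_natDegree hQ)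
  rw [coeff_add, h1, h2] at hg
  have hdvd : Q.coeff nQ ∣ α.coeff (La + m) := by
    apply hcop.symm.dvd_of_dvd_mul_right
    exact ⟨- β.coeff (Lb + m), by linear_combination hg⟩
  obtain ⟨γ, hγ⟩ := hdvd
  have hq0 : Q.coeff nQ ≠ 0 := by intro h; simp [h] at hq
  have hβtop : β.coeff (Lb + m) = - (γ * P.coeff nP) := by
    apply mul_right_cancel₀ hq0
    rw [hγ] at hg; linear_combination hg
  have hdeg : γ = 0 ∨ γ.natDegree + eQ < A := by
    by_cases h0 : γ = 0
    · exact Or.inl h0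
    right
    have := Pol_coeff_degree hα (La + m)
    rw [hγ, degree_mul, hq, degree_eq_natDegree h0] at this
    rw [add_comm]
    exact_mod_cast this
  have hX : ∀ (k l j : ℕ) (R : K[X][Y]) (e n : ℕ), R ∈ Pol K (e+1) (n+1) →
      (γ = 0 ∨ γ.natDegree + e < k) → j + n < l →
      C γ * Y ^ j * R ∈ Pol K k l := by
    intro k l j R e n hR hk hl
    rcases hk with hk | hk
    · simp [hk]
    have h1 : C γ * Y ^ j ∈ Pol K (γ.natDegree + 1) (j + 1) := by
      refine Pol_mul (Pol_C (k := γ.natDegree + 1) (l := 1) ?_ one_pos) (Pol_Xpow one_pos (Nat.lt_succ_self j)) (by omega) (by omega)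
      exact lt_of_le_of_lt degree_le_natDegree (by exact_mod_cast Nat.lt_succ_self _)
    exact Pol_mul h1 hR (by omega) (by omega)
  refine ⟨α - C γ * Y ^ (La + m - nQ) * Q, ?_, β + C γ * Y ^ (La + m - nQ) * P, ?_, by ring⟩
  · have hmem : α - C γ * Y ^ (La + m - nQ) * Q ∈ Pol K A (La + m + 1) := by
      refine Submodule.sub_mem _ hα (hX _ _ _ _ eQ nQ hQ hdeg (by omega))
    intro i j hij
    by_cases hj : j = La + m
    · subst hj
      rw [coeff_sub, hγ]
      rw [coeff_helper γ Q (n := nQ) (by omega), mul_comm γ, sub_self, coeff_zero]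
    · exact hmem i j (by omega)
  · have hmem : β + C γ * Y ^ (La + m - nQ) * P ∈ Pol K B (Lb + m + 1) := by
      refine Submodule.add_mem _ hβ (hX _ _ _ _ eP nP hP ?_ (by omega))
      rcases hdeg with h | h
      · exact Or.inl h
      · right; omega
    intro i j hij
    by_cases hj : j = Lb + m
    · subst hj
      rw [coeff_add, hβtop]
      rw [coeff_helper γ P (n := nP) (by omega), neg_add_cancel, coeff_zero]
    · exact hmem i j (by omega)

lemma DC_aux {P Q : K[X][Y]} {nP nQ eP eQ A B La Lb : ℕ}
    (hP : P ∈ Pol K (eP+1) (nP+1)) (hQ : Q ∈ Pol K (eQ+1) (nQ+1))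
    (hcop : IsCoprime (P.coeff nP) (Q.coeff nQ))
    (hq : (Q.coeff nQ).degree = eQ)
    (hAB : A + eP = B + eQ) (hL : La + nP = Lb + nQ) (hLa : nQ ≤ La) (m : ℕ)
    {α β : K[X][Y]} (hα : α ∈ Pol K A (La + m)) (hβ : β ∈ Pol K B (Lb + m))
    (hg : ∀ j, La + nP ≤ j → (α * P + β * Q).coeff j = 0) :
    ∃ α' ∈ Pol K A La, ∃ β' ∈ Pol K B Lb, α' * P + β' * Q = α * P + β * Q := by
  induction m generalizing α β with
  | zero => exact ⟨α, hα, β, hβ, rfl⟩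
  | succ m ih =>
    obtain ⟨α', h1, β', h2, h3⟩ := DC_step hP hQ hcop hq hAB hL hLa (m := m) hα hβ (hg _ (by omega))
    obtain ⟨α'', h1', β'', h2', h3'⟩ := ih h1 h2 (by rw [h3]; exact hg)
    exact ⟨α'', h1', β'', h2', h3'.trans h3⟩

lemma Inj_aux {P Q α β : K[X][Y]} {n e : ℕ} (hP : P.natDegree = n)
    (hcop : IsCoprime (P.coeff n) (Q.leadingCoeff)) (hp0 : P ≠ 0)
    (hq : (Q.leadingCoeff).degree = e) {l : ℕ} (hα : α ∈ Pol K e l)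
    (hg : (α * P + β * Q).degree < n) : α = 0 := by
  by_contra hα0
  have hαP : α * P ≠ 0 := mul_ne_zero hα0 hp0
  have hd1 : (n : WithBot ℕ) ≤ (α * P).degree := by
    rw [degree_mul, degree_eq_natDegree hp0, hP, degree_eq_natDegree hα0]
    exact_mod_cast Nat.le_add_left _ _
  have hlead : (β * Q).leadingCoeff = - (α * P).leadingCoeff := by
    have : β * Q = (α * P + β * Q) - α * P := by ring
    rw [this, leadingCoeff_sub_of_degree_lt' (lt_of_lt_of_le hg hd1)]
  rw [leadingCoeff_mul, leadingCoeff_mul, show P.leadingCoeff = P.coeff n by rw [leadingCoeff, hP]] at hlead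
  have hdvd : Q.leadingCoeff ∣ α.leadingCoeff := by
    apply hcop.symm.dvd_of_dvd_mul_right
    exact ⟨- β.leadingCoeff, by linear_combination hlead⟩
  have := degree_le_of_dvd hdvd (leadingCoeff_ne_zero.2 hα0)
  rw [hq] at this
  exact absurd (Pol_coeff_degree hα α.natDegree) (not_lt.2 this)

end dc

/-- The standing hypotheses for the algebraic part. -/
structure Good {K : Type*} [Field K] (a b : ℕ) (f : K[X][Y]) : Prop where
  ha : 1 ≤ a
  hb : 1 ≤ b
  mem : f ∈ Pol K (2*a+1) (2*b+1)
  lead : (f.coeff (2*b)).coeff (2*a) ≠ 0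
  copC : IsCoprime (f.coeff (2*b)) (derivative (f.coeff (2*b)))
  copD : IsCoprime ((Bivariate.swap f).coeff (2*a)) (derivative ((Bivariate.swap f).coeff (2*a)))

section good
variable {K : Type*} [Field K] [CharZero K] {a b : ℕ} {f : K[X][Y]}

lemma Good.swap (h : Good a b f) : Good b a (Bivariate.swap f) where
  ha := h.hb
  hb := h.ha
  mem := Pol_swap.2 h.mem
  lead := by rw [swap_coeff]; exact h.lead
  copC := h.copD
  copD := by rw [Bivariate.swap_swap_apply]; exact h.copC

lemma Good.P_mem (h : Good a b f) : dX f ∈ Pol K (2*a) (2*b+1) := Pol_dX h.mem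
lemma Good.Q_mem (h : Good a b f) : derivative f ∈ Pol K (2*a+1) (2*b) := Pol_dY h.mem

lemma Good.degC (h : Good a b f) : (f.coeff (2*b)).degree = (2 * a : ℕ) := by
  apply le_antisymm
  · rw [degree_le_iff_coeff_zero]
    intro m hm
    exact h.mem _ _ (Or.inl (by exact_mod_cast hm))
  · exact le_degree_of_ne_zero h.lead

lemma Good.P_top (h : Good a b f) : (dX f).coeff (2*b) = derivative (f.coeff (2*b)) := dX_coeff' _ _

lemma Good.Q_top (h : Good a b f) : (derivative f).coeff (2*b-1) = C (2*b : K) * f.coeff (2*b) := by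
  have := h.hb
  rw [coeff_derivative, show 2*b-1+1 = 2*b by omega, mul_comm]
  congr 1
  rw [← Nat.cast_succ, show (2*b-1).succ = 2*b by omega]
  rw [show (2*b:K) = ((2*b : ℕ) : K) by push_cast; ring, C_eq_natCast]

lemma Good.Q_top_degree (h : Good a b f) : ((derivative f).coeff (2*b-1)).degree = (2 * a : ℕ) := by
  have hb : (2*b : K) ≠ 0 := by have := h.hb; simp; omega
  rw [h.Q_top, degree_C_mul hb, h.degC]

lemma Good.cop (h : Good a b f) : IsCoprime ((dX f).coeff (2*b)) ((derivative f).coeff (2*b-1)) := by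
  have hb : (2*b : K) ≠ 0 := by have := h.hb; simp; omega
  rw [h.P_top, h.Q_top]
  have : IsUnit (C (2*b : K)) := by rw [isUnit_C]; exact isUnit_iff_ne_zero.2 hb
  rw [isCoprime_mul_unit_left_right this]
  exact h.copC.symm

lemma Good.P_top_degree (h : Good a b f) : ((dX f).coeff (2*b)).degree = (2 * a - 1 : ℕ) := by
  rw [h.P_top]
  have hd := h.degC
  have ha := h.ha
  have h0 : (f.coeff (2*b)).natDegree = 2*a := natDegree_eq_of_degree_eq_some hd
  rw [degree_derivative_eq _ (by omega), h0]

lemma Good.dc (h : Good a b f) {α β : K[X][Y]} (hg : α * dX f + β * derivative f ∈ Pol K (4*a-1) (4*b-1)) :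
    ∃ α' ∈ Pol K (2*a) (2*b-1), ∃ β' ∈ Pol K (2*a-1) (2*b),
      α' * dX f + β' * derivative f = α * dX f + β * derivative f := by
  have ha := h.ha
  have hb := h.hb
  -- first step: control in y
  obtain ⟨k, l, hα⟩ := exists_Pol α
  obtain ⟨k', l', hβ⟩ := exists_Pol β
  have hP : dX f ∈ Pol K (2*a-1+1) (2*b+1) := by
    rw [show 2*a-1+1 = 2*a by omega]; exact h.P_mem
  have hQ : derivative f ∈ Pol K (2*a+1) (2*b-1+1) := by
    rw [show 2*b-1+1 = 2*b by omega]; exact h.Q_mem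
  obtain ⟨α1, hα1, β1, hβ1, e1⟩ := DC_aux (A := k+k'+1) (B := k+k') (La := 2*b-1) (Lb := 2*b) hP hQ h.cop
    h.Q_top_degree (by omega) (by omega) (by omega) (l + l')
    (Pol_mono (by omega) (by omega) hα) (Pol_mono (by omega) (by omega) hβ)
    (fun j hj => Pol_coeff_eq_zero hg (by omega))
  have e1' := congrArg Bivariate.swap e1
  rw [map_add, map_mul, map_mul, swap_dX, swap_dY] at e1'
  have hs := h.swap
  have hP' : dX (Bivariate.swap f) ∈ Pol K (2*b-1+1) (2*a+1) := by
    rw [show 2*b-1+1 = 2*b by omega]; exact hs.P_mem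
  have hQ' : derivative (Bivariate.swap f) ∈ Pol K (2*b+1) (2*a-1+1) := by
    rw [show 2*a-1+1 = 2*a by omega]; exact hs.Q_mem
  obtain ⟨β2, hβ2, α2, hα2, e2⟩ := DC_aux (P := dX (Bivariate.swap f)) (Q := derivative (Bivariate.swap f))
    (A := 2*b) (B := 2*b-1) (La := 2*a-1) (Lb := 2*a) hP' hQ' hs.cop
    hs.Q_top_degree (by omega) (by omega) (by omega) (k+k'+1)
    (α := Bivariate.swap β1) (β := Bivariate.swap α1)
    (Pol_mono (by omega) (by omega) (Pol_swap.2 hβ1)) (Pol_mono (by omega) (by omega) (Pol_swap.2 hα1))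
    (by
      intro j hj
      rw [add_comm, e1']
      exact Pol_coeff_eq_zero (Pol_swap.2 hg) (by omega))
  refine ⟨Bivariate.swap α2, Pol_swap.2 hα2, Bivariate.swap β2, Pol_swap.2 hβ2, ?_⟩
  have := congrArg Bivariate.swap e2
  rw [add_comm (_ * _), add_comm (_ * dX _), e1', Bivariate.swap_swap_apply, map_add, map_mul, map_mul,
    swap_dX, swap_dY, Bivariate.swap_swap_apply] at this
  exact this

lemma Good.P_ne (h : Good a b f) : dX f ≠ 0 := by
  intro h0
  have := h.P_top_degree
  rw [h0] at this; simp at this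

lemma Good.Q_ne (h : Good a b f) : derivative f ≠ 0 := by
  intro h0
  have := h.Q_top_degree
  rw [h0] at this; exact absurd this (WithBot.bot_ne_natCast (α := ℕ) (2*a))

lemma Good.P_natDegree (h : Good a b f) : (dX f).natDegree = 2*b := by
  apply le_antisymm (Pol_natDegree h.P_mem)
  apply le_natDegree_of_ne_zero
  intro h0
  have := h.P_top_degree
  rw [h0] at this; simp at this

lemma Good.Q_natDegree (h : Good a b f) : (derivative f).natDegree = 2*b-1 := by
  have := h.hb
  apply le_antisymm (Pol_natDegree (by rw [show 2*b-1+1 = 2*b by omega]; exact h.Q_mem))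
  apply le_natDegree_of_ne_zero
  intro h0
  have := h.Q_top_degree
  rw [h0] at this; exact absurd this (WithBot.bot_ne_natCast (α := ℕ) (2*a))

lemma Good.inj (h : Good a b f) {α β : K[X][Y]} {l : ℕ} (hα : α ∈ Pol K (2*a) l)
    (hg : (α * dX f + β * derivative f).degree < (2*b : ℕ)) : α = 0 := by
  have hQl : (derivative f).leadingCoeff = (derivative f).coeff (2*b-1) := by
    rw [leadingCoeff, h.Q_natDegree]
  refine Inj_aux h.P_natDegree ?_ h.P_ne (e := 2*a) ?_ hα hg
  · rw [hQl]; exact h.cop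
  · rw [hQl]; exact h.Q_top_degree

/-- (A2) modulo the Nullstellensatz part. -/
lemma Good.eq_zero_of_mem (h : Good a b f) {α β g : K[X][Y]} (hg : g ∈ Pol K a b)
    (e : α * dX f + β * derivative f = g) : g = 0 := by
  have ha := h.ha
  have hb := h.hb
  obtain ⟨α', hα', β', hβ', e'⟩ := h.dc (α := α) (β := β) (by
    rw [e]; exact Pol_mono (by omega) (by omega) hg)
  rw [e] at e'
  have hgd : g.degree < b := by
    rw [degree_lt_iff_coeff_zero]; intro m hm; exact Pol_coeff_eq_zero hg hm
  have h0 : α' = 0 := h.inj hα' (by rw [e']; exact hgd.trans_le (by exact_mod_cast (by omega)))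
  rw [h0, zero_mul, zero_add] at e'
  by_contra hne
  have hβ0 : β' ≠ 0 := by rintro rfl; apply hne; rw [← e', zero_mul]
  rw [← e', degree_mul, degree_eq_natDegree hβ0, degree_eq_natDegree h.Q_ne, h.Q_natDegree] at hgd
  have : β'.natDegree + (2*b-1) < b := by exact_mod_cast hgd
  omega

/-- the Sylvester-type map -/
noncomputable def TT (f : K[X][Y]) (k l m n : ℕ) : (Pol K k l × Pol K m n) →ₗ[K] K[X][Y] where
  toFun u := (u.1 : K[X][Y]) * dX f + (u.2 : K[X][Y]) * derivative f
  map_add' := by intro u v; simp; ring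
  map_smul' := by intro c u; simp [smul_add]

lemma Good.TT_inj (h : Good a b f) {k l m n : ℕ} (hk : k ≤ 2*a) :
    Function.Injective (TT f k l m n) := by
  rw [injective_iff_map_eq_zero]
  rintro ⟨⟨α, hα⟩, ⟨β, hβ⟩⟩ h0
  have h0' : α * dX f + β * derivative f = 0 := h0
  have h1 : α = 0 := h.inj (Pol_mono hk le_rfl hα) (β := β) (by rw [h0', degree_zero]; exact WithBot.bot_lt_natCast (2*b))
  subst h1
  have h2 : β = 0 := by simpa [h.Q_ne] using h0'
  subst h2
  rfl

lemma Good.TT_finrank (h : Good a b f) {k l m n : ℕ} (hk : k ≤ 2*a) :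
    Module.finrank K (LinearMap.range (TT f k l m n)) = k * l + m * n := by
  rw [LinearMap.finrank_range_of_inj (h.TT_inj hk), Module.finrank_prod, Pol_finrank, Pol_finrank]

/-- the ideal generated by the two partial derivatives -/
noncomputable def II (f : K[X][Y]) : Ideal K[X][Y] := Ideal.span {dX f, derivative f}

lemma mem_II {g : K[X][Y]} : g ∈ II f ↔ ∃ α β, α * dX f + β * derivative f = g := by
  rw [II, Ideal.mem_span_pair]

lemma Good.range_TT_le (h : Good a b f) :
    LinearMap.range (TT f (2*a) (2*b-1) (2*a-1) (2*b)) ≤ Pol K (4*a-1) (4*b-1) := by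
  have ha := h.ha
  have hb := h.hb
  rintro _ ⟨⟨⟨α, hα⟩, ⟨β, hβ⟩⟩, rfl⟩
  exact Submodule.add_mem _ (Pol_mul hα h.P_mem (by omega) (by omega))
    (Pol_mul hβ h.Q_mem (by omega) (by omega))

/-- existence of the residue functional -/
lemma Good.exists_L (h : Good a b f) : ∃ L : K[X][Y] →ₗ[K] K, L ≠ 0 ∧ (∀ g ∈ II f, L g = 0) ∧
    ∀ g ∈ Pol K (4*a-2) (4*b-2), L g = 0 := by
  have ha := h.ha
  have hb := h.hb
  set U := Pol K (4*a-2) (4*b-2) with hU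
  set R := LinearMap.range (TT f (2*a) (2*b-1) (2*a-1) (2*b)) with hR
  set R' := LinearMap.range (TT f (2*a-1) (2*b-2) (2*a-2) (2*b-1)) with hR'
  have hRle : R ≤ Pol K (4*a-1) (4*b-1) := h.range_TT_le
  have hR'U : R' ≤ U ⊓ R := by
    rintro _ ⟨⟨⟨α, hα⟩, ⟨β, hβ⟩⟩, rfl⟩
    constructor
    · exact Submodule.add_mem _ (Pol_mul hα h.P_mem (by omega) (by omega))
        (Pol_mul hβ h.Q_mem (by omega) (by omega))
    · exact ⟨⟨⟨α, Pol_mono (by omega) (by omega) hα⟩, ⟨β, Pol_mono (by omega) (by omega) hβ⟩⟩, rfl⟩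
  haveI : FiniteDimensional K R := by rw [hR]; infer_instance
  haveI : FiniteDimensional K U := by rw [hU]; infer_instance
  have hdim := Submodule.finrank_sup_add_finrank_inf_eq U R
  have hd2 : Module.finrank K R' ≤ Module.finrank K (U ⊓ R : Submodule K K[X][Y]) :=
    Submodule.finrank_mono hR'U
  rw [h.TT_finrank (by omega)] at hd2
  rw [h.TT_finrank (by omega), Pol_finrank] at hdim
  have hlt : U ⊔ (II f).restrictScalars K < ⊤ := by
    rw [lt_top_iff_ne_top]
    intro htop
    have hle : Pol K (4*a-1) (4*b-1) ≤ U ⊔ R := by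
      intro p hp
      have : p ∈ U ⊔ (II f).restrictScalars K := by rw [htop]; trivial
      obtain ⟨u, hu, v, hv, e⟩ := Submodule.mem_sup.1 this
      obtain ⟨α, β, hαβ⟩ := mem_II.1 (show v ∈ II f from hv)
      have hv' : v ∈ Pol K (4*a-1) (4*b-1) := by
        have : v = p - u := by rw [← e]; ring
        rw [this]
        exact Submodule.sub_mem _ hp (Pol_mono (by omega) (by omega) hu)
      rw [← hαβ] at hv'
      obtain ⟨α', hα', β', hβ', e'⟩ := h.dc hv'
      refine Submodule.mem_sup.2 ⟨u, hu, v, ⟨⟨⟨α', hα'⟩, ⟨β', hβ'⟩⟩, ?_⟩, e⟩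
      rw [← hαβ, ← e']; rfl
    have hd3 := Submodule.finrank_mono hle
    rw [Pol_finrank] at hd3
    obtain ⟨a', rfl⟩ : ∃ a', a = a' + 1 := ⟨a - 1, by omega⟩
    obtain ⟨b', rfl⟩ : ∃ b', b = b' + 1 := ⟨b - 1, by omega⟩
    rw [show 4*(a'+1)-1 = 4*a'+3 by omega, show 4*(b'+1)-1 = 4*b'+3 by omega] at hd3
    rw [show 4*(a'+1)-2 = 4*a'+2 by omega, show 4*(b'+1)-2 = 4*b'+2 by omega,
      show 2*(a'+1)-1 = 2*a'+1 by omega, show 2*(b'+1)-1 = 2*b'+1 by omega] at hdim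
    rw [show 2*(a'+1)-1 = 2*a'+1 by omega, show 2*(b'+1)-1 = 2*b'+1 by omega,
      show 2*(a'+1)-2 = 2*a' by omega, show 2*(b'+1)-2 = 2*b' by omega] at hd2
    nlinarith
  obtain ⟨L, hL0, hL⟩ := Submodule.exists_le_ker_of_lt_top _ hlt
  refine ⟨L, hL0, fun g hg => ?_, fun g hg => ?_⟩
  · exact hL (Submodule.mem_sup_right (show g ∈ (II f).restrictScalars K from hg))
  · exact hL (Submodule.mem_sup_left hg)

end good
end Petro

set_option autoImplicit false
set_option linter.all false

namespace Petro
open Polynomial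
open scoped Polynomial.Bivariate

section bez
variable {K : Type*} [Field K]

lemma divX_coeff_zero (p : K[X]) (a : K) (n : ℕ) (h : ∀ i, n + 1 ≤ i → p.coeff i = 0) :
    (p /ₘ (X - C a)).coeff n = 0 := by
  rw [coeff_divByMonic_X_sub_C]
  refine Finset.sum_eq_zero fun i hi => ?_
  rw [Finset.mem_Icc] at hi
  rw [h i hi.1, mul_zero]

lemma divX_coeff_top (p : K[X]) (a : K) (n : ℕ) (h : ∀ i, n + 2 ≤ i → p.coeff i = 0) :
    (p /ₘ (X - C a)).coeff n = p.coeff (n+1) := by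
  rw [coeff_divByMonic_X_sub_C_rec, divX_coeff_zero p a (n+1) h, mul_zero, add_zero]

lemma divX_eq (p : K[X]) (a : K) : p = (X - C a) * (p /ₘ (X - C a)) + C (p.eval a) := by
  have := modByMonic_add_div p (X - C a)
  rw [modByMonic_X_sub_C_eq_C_eval] at this
  rw [add_comm]; exact this.symm

/-- quotient in the variable `x` -/
noncomputable def q1 (P : K[X][Y]) (x' : K) : K[X][Y] :=
  ∑ j ∈ Finset.range (P.natDegree + 1), monomial j (P.coeff j /ₘ (X - C x'))

/-- quotient in the variable `y` -/
noncomputable def q2 (P : K[X][Y]) (x' y' : K) : K[X][Y] :=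
  ((P.map (evalRingHom x')) /ₘ (X - C y')).map C

lemma q1_coeff (P : K[X][Y]) (x' : K) (j : ℕ) : (q1 P x').coeff j = P.coeff j /ₘ (X - C x') := by
  rw [q1, finsetSum_coeff]
  simp only [coeff_monomial]
  rw [Finset.sum_ite_eq']
  split_ifs with h
  · rfl
  · rw [Finset.mem_range] at h
    rw [coeff_eq_zero_of_natDegree_lt (by omega), zero_divByMonic]

lemma q1_mem {P : K[X][Y]} {k l : ℕ} (hP : P ∈ Pol K (k+1) l) (x' : K) : q1 P x' ∈ Pol K k l := by
  intro i j h
  rw [q1_coeff]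
  apply divX_coeff_zero
  intro i' hi'
  exact hP _ _ (by omega)

lemma q2_mem {P : K[X][Y]} {k l : ℕ} (hP : P ∈ Pol K k (l+1)) (x' y' : K) :
    q2 P x' y' ∈ Pol K 1 l := by
  intro i j h
  rw [q2, coeff_map]
  rcases h with h | h
  · rw [coeff_C, if_neg (by omega)]
  · rw [divX_coeff_zero, C_0, coeff_zero]
    intro i' hi'
    rw [coeff_map, Pol_coeff_eq_zero hP (by omega), map_zero]

lemma q2_coeff_top {P : K[X][Y]} {k l : ℕ} (hP : P ∈ Pol K k (l+2)) (x' y' : K) :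
    (q2 P x' y').coeff l = C ((P.coeff (l+1)).eval x') := by
  rw [q2, coeff_map, divX_coeff_top, coeff_map]
  · rfl
  intro i' hi'
  rw [coeff_map, Pol_coeff_eq_zero hP (by omega), map_zero]

lemma q_eq (P : K[X][Y]) (x' y' : K) : P = C (X - C x') * q1 P x' + (Y - C (C y')) * q2 P x' y' +
    C (C (P.evalEval x' y')) := by
  have h1 : P = C (X - C x') * q1 P x' + (P.map (evalRingHom x')).map C := by
    ext1 j
    rw [coeff_add, coeff_C_mul, q1_coeff, coeff_map, coeff_map]
    exact divX_eq _ _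
  have h2 : (P.map (evalRingHom x')).map C = (Y - C (C y')) * q2 P x' y' +
    C (C (P.evalEval x' y')) := by
    conv_lhs => rw [divX_eq (P.map (evalRingHom x')) y']
    rw [Polynomial.map_add, Polynomial.map_mul, q2]
    simp [map_evalRingHom_eval]
  rw [add_assoc, ← h2]; exact h1

lemma q_eval (P : K[X][Y]) (x y x' y' : K) : P.evalEval x y = (x - x') * (q1 P x').evalEval x y
    + (y - y') * (q2 P x' y').evalEval x y + P.evalEval x' y' := by
  conv_lhs => rw [q_eq P x' y']
  simp [evalEval_C]

lemma q2_dX (P : K[X][Y]) (x' y' : K) : dX (q2 P x' y') = 0 := by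
  ext1 j
  rw [dX_coeff', q2, coeff_map, derivative_C, coeff_zero]

lemma dX_C (p : K[X]) : dX (C p) = C (derivative p) := by
  ext1 j
  rw [dX_coeff', coeff_C, coeff_C]; split_ifs <;> simp

lemma dX_Y : dX (Y : K[X][Y]) = 0 := by
  ext1 j
  rw [dX_coeff', coeff_X]; split_ifs <;> simp

lemma q1_eval_self (P : K[X][Y]) (x' y' : K) : (q1 P x').evalEval x' y' = (dX P).evalEval x' y' := by
  conv_rhs => rw [q_eq P x' y']
  simp only [dX_add, dX_mul, dX_sub, dX_C, dX_Y, q2_dX]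
  simp [evalEval_C]

lemma q2_eval_self (P : K[X][Y]) (x' y' : K) : (q2 P x' y').evalEval x' y' = (derivative P).evalEval x' y' := by
  conv_rhs => rw [q_eq P x' y']
  simp only [derivative_add, derivative_mul, derivative_sub, derivative_C, derivative_X]
  simp [evalEval_C]

/-- the Jacobian -/
noncomputable def Jac {R : Type*} [CommRing R] (P Q : R[X][Y]) : R[X][Y] :=
  dX P * derivative Q - derivative P * dX Q

/-- the Bezoutian at a point -/
noncomputable def bez (P Q : K[X][Y]) (x' y' : K) : K[X][Y] :=
  q1 P x' * q2 Q x' y' - q2 P x' y' * q1 Q x'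

lemma bez_self (P Q : K[X][Y]) (x' y' : K) :
    (bez P Q x' y').evalEval x' y' = (Jac P Q).evalEval x' y' := by
  simp only [bez, Jac, evalEval_sub, evalEval_mul, q1_eval_self, q2_eval_self]

lemma bez_off {P Q : K[X][Y]} {x y x' y' : K} (h1 : P.evalEval x y = 0) (h2 : Q.evalEval x y = 0)
    (h1' : P.evalEval x' y' = 0) (h2' : Q.evalEval x' y' = 0) (hne : (x, y) ≠ (x', y')) :
    (bez P Q x' y').evalEval x y = 0 := by
  have e1 := q_eval P x y x' y'
  have e2 := q_eval Q x y x' y'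
  rw [h1, h1', add_zero] at e1
  rw [h2, h2', add_zero] at e2
  simp only [bez, evalEval_sub, evalEval_mul]
  by_cases hx : x - x' = 0
  · have hy : y - y' ≠ 0 := by
      intro hy; apply hne; rw [sub_eq_zero.1 hx, sub_eq_zero.1 hy]
    apply mul_left_cancel₀ hy
    linear_combination (-(q1 P x').evalEval x y) * e2 + (q1 Q x').evalEval x y * e1
  · apply mul_left_cancel₀ hx
    linear_combination (-(q2 Q x' y').evalEval x y) * e1 + (q2 P x' y').evalEval x y * e2

end bez

section good
variable {K : Type*} [Field K] [CharZero K] {a b : ℕ} {f : K[X][Y]}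

/-- critical points -/
def ZZ (f : K[X][Y]) : Set (K × K) :=
  {q | (dX f).evalEval q.1 q.2 = 0 ∧ (derivative f).evalEval q.1 q.2 = 0}

noncomputable abbrev JJ (f : K[X][Y]) : K[X][Y] := Jac (dX f) (derivative f)

noncomputable abbrev bz (f : K[X][Y]) (q : K × K) : K[X][Y] := bez (dX f) (derivative f) q.1 q.2

lemma Good.bz_mem (h : Good a b f) (q : K × K) : bz f q ∈ Pol K (2*a) (4*b-1) := by
  have ha := h.ha
  have hb := h.hb
  have hP : dX f ∈ Pol K (2*a-1+1) (2*b+1) := by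
    rw [show 2*a-1+1 = 2*a by omega]; exact h.P_mem
  have hQ : derivative f ∈ Pol K (2*a+1) (2*b-1+1) := by
    rw [show 2*b-1+1 = 2*b by omega]; exact h.Q_mem
  refine Submodule.sub_mem _ (Pol_mul (q1_mem hP q.1) (q2_mem hQ q.1 q.2) (by omega) (by omega)) ?_
  exact Pol_mul (q2_mem hP q.1 q.2) (q1_mem hQ q.1) (by omega) (by omega)

lemma mem_II_eval {g : K[X][Y]} (hg : g ∈ II f) {q : K × K} (hq : q ∈ ZZ f) : g.evalEval q.1 q.2 = 0 := by
  obtain ⟨α, β, rfl⟩ := mem_II.1 hg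
  rw [evalEval_add, evalEval_mul, evalEval_mul, hq.1, hq.2]; ring

lemma Good.card_le (h : Good a b f) (hJ : ∀ q ∈ ZZ f, (JJ f).evalEval q.1 q.2 ≠ 0) (S : Finset (K × K))
    (hS : ∀ q ∈ S, q ∈ ZZ f) : S.card + 2*a+2*b ≤ 8*a*b+1 := by
  classical
  have ha := h.ha
  have hb := h.hb
  let ev : Pol K (4*a-1) (4*b-1) →ₗ[K] (S → K) :=
    { toFun := fun p q => (p : K[X][Y]).evalEval q.1.1 q.1.2
      map_add' := by intro p q; ext; simp
      map_smul' := by intro c p; ext; simp }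
  have hsurj : Function.Surjective ev := by
    intro v
    let p : Pol K (4*a-1) (4*b-1) := ∑ q : S, (v q / (JJ f).evalEval q.1.1 q.1.2) •
      ⟨bz f q.1, Pol_mono (by omega) le_rfl (h.bz_mem q.1)⟩
    refine ⟨p, ?_⟩
    ext q
    change (p : K[X][Y]).evalEval q.1.1 q.1.2 = v q
    simp only [p, Submodule.coe_sum, Submodule.coe_smul, evalEval_finsetSum, evalEval_smul]
    rw [Finset.sum_eq_single q]
    · rw [bez_self, smul_eq_mul, div_mul_cancel₀ _ (hJ _ (hS _ q.2))]
    · intro q' _ hne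
      rw [bez_off (hS _ q.2).1 (hS _ q.2).2 (hS _ q'.2).1 (hS _ q'.2).2, smul_zero]
      intro h'; apply hne; ext <;> simp_all
    · simp
  have hrn := LinearMap.finrank_range_add_finrank_ker (K := K) (V := Pol K (4*a-1) (4*b-1)) ev
  rw [LinearMap.range_eq_top.2 hsurj, finrank_top, Module.finrank_fintype_fun_eq_card, Pol_finrank, Fintype.card_coe] at hrn
  haveI : Module.Finite K (LinearMap.ker ev) :=
    FiniteDimensional.finiteDimensional_submodule (K := K) (V := Pol K (4*a-1) (4*b-1)) _
  have hk : Module.finrank K (LinearMap.range (TT f (2*a) (2*b-1) (2*a-1) (2*b))) ≤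
      Module.finrank K (LinearMap.ker ev) := by
    refine LinearMap.finrank_le_finrank_of_injective (f := LinearMap.codRestrict _ (Submodule.inclusion h.range_TT_le) ?_) ?_
    · rintro ⟨x, ⟨⟨⟨α, hα⟩, ⟨β, hβ⟩⟩, rfl⟩⟩
      rw [LinearMap.mem_ker]
      ext q
      exact mem_II_eval (f := f) (mem_II.2 ⟨α, β, rfl⟩) (hS _ q.2)
    · intro u v huv
      have := congrArg (fun z : LinearMap.ker ev => ((z : Pol K (4*a-1) (4*b-1)) : K[X][Y])) huv
      exact Subtype.ext this
  rw [h.TT_finrank le_rfl] at hk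
  generalize Module.finrank K (LinearMap.ker ev) = N at hk hrn
  clear hsurj this
  clear ev
  obtain ⟨a', rfl⟩ : ∃ a', a = a' + 1 := ⟨a - 1, by omega⟩
  obtain ⟨b', rfl⟩ : ∃ b', b = b' + 1 := ⟨b - 1, by omega⟩
  rw [show 4*(a'+1)-1 = 4*a'+3 by omega, show 4*(b'+1)-1 = 4*b'+3 by omega] at hrn
  rw [show 2*(a'+1)-1 = 2*a'+1 by omega, show 2*(b'+1)-1 = 2*b'+1 by omega] at hk
  nlinarith

lemma Good.ZZ_finite (h : Good a b f) (hJ : ∀ q ∈ ZZ f, (JJ f).evalEval q.1 q.2 ≠ 0) : (ZZ f).Finite := by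
  by_contra hinf
  obtain ⟨S, hS, hc⟩ := Set.Infinite.exists_subset_card_eq hinf (8*a*b+2)
  have := h.card_le hJ S (fun q hq => hS hq)
  omega

end good
end Petro

set_option autoImplicit false
set_option linter.all false

namespace Petro
open Polynomial
open scoped Polynomial.Bivariate

section nss
variable {K : Type} [Field K] [IsAlgClosed K]

lemma max_point (M : Ideal K[X][Y]) (hM : M.IsMaximal) :
    ∃ x y : K, ∀ g : K[X][Y], g ∈ M ↔ g.evalEval x y = 0 := by
  letI : Field (K[X][Y] ⧸ M) := Ideal.Quotient.field M
  haveI : Algebra.FiniteType K K[X][Y] := Algebra.FiniteType.trans (S := K[X]) inferInstance inferInstance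
  haveI : Algebra.FiniteType K (K[X][Y] ⧸ M) :=
    Algebra.FiniteType.of_surjective (Ideal.Quotient.mkₐ K M) Ideal.Quotient.mk_surjective
  haveI : Module.Finite K (K[X][Y] ⧸ M) := finite_of_finite_type_of_isJacobsonRing K (K[X][Y] ⧸ M)
  have hbij : Function.Bijective (algebraMap K (K[X][Y] ⧸ M)) :=
    IsAlgClosed.algebraMap_bijective_of_isIntegral
  obtain ⟨x, hx⟩ := hbij.2 (Ideal.Quotient.mk M (C X))
  obtain ⟨y, hy⟩ := hbij.2 (Ideal.Quotient.mk M Y)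
  refine ⟨x, y, fun g => ?_⟩
  have key : (Ideal.Quotient.mk M) = (algebraMap K (K[X][Y] ⧸ M)).comp (evalEvalRingHom x y) := by
    apply Polynomial.ringHom_ext'
    · apply Polynomial.ringHom_ext'
      · ext r
        simp
        rfl
      · simp [hx, evalEval_C]
    · simp [hy]
  rw [← Ideal.Quotient.eq_zero_iff_mem, key, RingHom.comp_apply, map_eq_zero_iff _ hbij.1]
  rfl

lemma derivation_formula {A : Type*} [CommRing A] [Algebra K A] {N : Type*} [AddCommGroup N] [Module A N]
    [Module K N] 
    (φ : K[X][Y] →ₐ[K] A) (D : Derivation K A N) (g : K[X][Y]) :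
    D (φ g) = φ (dX g) • D (φ (C X)) + φ (derivative g) • D (φ Y) := by
  have hmul : ∀ g h : K[X][Y], D (φ g) = φ (dX g) • D (φ (C X)) + φ (derivative g) • D (φ Y) →
     D (φ h) = φ (dX h) • D (φ (C X)) + φ (derivative h) • D (φ Y) →
     D (φ (g * h)) = φ (dX (g * h)) • D (φ (C X)) + φ (derivative (g * h)) • D (φ Y) := by
    intro g h hg hh
    rw [map_mul, Derivation.leibniz, hg, hh, dX_mul, derivative_mul]
    simp only [map_add, map_mul, smul_add, add_smul, ← mul_smul]
    rw [mul_comm (φ g) (φ (dX h)), mul_comm (φ h) (φ (dX g)), mul_comm (φ h) (φ (derivative g))]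
    simp only [mul_comm]
    abel
  have hadd : ∀ g h : K[X][Y], D (φ g) = φ (dX g) • D (φ (C X)) + φ (derivative g) • D (φ Y) →
     D (φ h) = φ (dX h) • D (φ (C X)) + φ (derivative h) • D (φ Y) →
     D (φ (g + h)) = φ (dX (g + h)) • D (φ (C X)) + φ (derivative (g + h)) • D (φ Y) := by
    intro g h hg hh
    rw [map_add, map_add, hg, hh, dX_add, derivative_add]
    simp only [map_add, add_smul]
    abel
  have hc : ∀ r : K, D (φ (C (C r))) = φ (dX (C (C r))) • D (φ (C X)) + φ (derivative (C (C r))) • D (φ Y) := by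
    intro r
    have : φ (C (C r)) = algebraMap K A r := φ.commutes r
    rw [this, dX_C]; simp
  have hx : D (φ (C X)) = φ (dX (C X)) • D (φ (C X)) + φ (derivative (C X)) • D (φ Y) := by
    rw [dX_C]; simp
  have hy : D (φ Y) = φ (dX Y) • D (φ (C X)) + φ (derivative Y) • D (φ Y) := by
    rw [dX_Y]; simp
  have hC : ∀ p : K[X], D (φ (C p)) = φ (dX (C p)) • D (φ (C X)) + φ (derivative (C p)) • D (φ Y) := by
    intro p
    induction p using Polynomial.induction_on with
    | C r => exact hc r
    | add p q hp hq => rw [C_add]; exact hadd _ _ hp hq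
    | monomial n r ih => rw [pow_succ, ← mul_assoc, C_mul]; exact hmul _ _ ih hx
  induction g using Polynomial.induction_on with
  | C r => exact hC r
  | add p q hp hq => exact hadd _ _ hp hq
  | monomial n r ih => rw [pow_succ, ← mul_assoc]; exact hmul _ _ ih hy

lemma isUnit_aux {A : Type*} [CommRing A] (z : A) (h : ∀ M : Ideal A, M.IsMaximal → z ∉ M) : IsUnit z := by
  by_contra hu
  obtain ⟨M, hM, hmem⟩ := exists_max_ideal_of_mem_nonunits (mem_nonunits_iff.2 hu)
  exact h M hM hmem

lemma II_isUnit (f : K[X][Y]) {A : Type} [CommRing A] (φ : K[X][Y] →+* A)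
    (hφ : Function.Surjective φ) (hI : ∀ g ∈ II f, φ g = 0)
    (hJ : ∀ q ∈ ZZ f, (JJ f).evalEval q.1 q.2 ≠ 0) :
    IsUnit (φ (JJ f)) := by
  apply isUnit_aux
  intro M hM hmem
  have hM' : (M.comap φ).IsMaximal :=
    Ideal.comap_isMaximal_of_surjective _ hφ
  obtain ⟨x, y, hxy⟩ := max_point _ hM'
  have hI : ∀ g ∈ II f, g.evalEval x y = 0 := by
    intro g hg
    rw [← hxy, Ideal.mem_comap, hI g hg]
    exact M.zero_mem
  refine hJ (x, y) ⟨hI _ (Ideal.subset_span (by simp)), hI _ (Ideal.subset_span (by simp))⟩ ?_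
  exact (hxy _).1 hmem

lemma unramified_aux (f : K[X][Y]) {A : Type} [CommRing A] [Algebra K A] (φ : K[X][Y] →ₐ[K] A)
    (hφ : Function.Surjective φ) (hI : ∀ g ∈ II f, φ g = 0) (hJ : ∀ q ∈ ZZ f, (JJ f).evalEval q.1 q.2 ≠ 0) :
    Algebra.FormallyUnramified K A := by
  constructor
  let D := KaehlerDifferential.D K A
  have hu : IsUnit (φ (JJ f)) := II_isUnit f (φ : K[X][Y] →+* A) hφ hI hJ
  have hP : φ (dX f) = 0 := hI _ (Ideal.subset_span (by simp))
  have hQ : φ (derivative f) = 0 := hI _ (Ideal.subset_span (by simp))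
  have eP := derivation_formula (A := A) (N := KaehlerDifferential K A) φ D (dX f)
  have eQ := derivation_formula (A := A) (N := KaehlerDifferential K A) φ D (derivative f)
  rw [hP, map_zero] at eP
  rw [hQ, map_zero] at eQ
  have hJe : φ (JJ f) = φ (dX (dX f)) * φ (derivative (derivative f)) - φ (derivative (dX f)) * φ (dX (derivative f)) := by
    rw [JJ, Jac, map_sub, map_mul, map_mul]
  have hx : D (φ (C X)) = 0 := by
    rw [← hu.smul_eq_zero (G := A), hJe]
    have e1 := congrArg (fun z => φ (derivative (derivative f)) • z) eP
    have e2 := congrArg (fun z => φ (derivative (dX f)) • z) eQ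
    simp only [smul_zero, smul_add, ← mul_smul] at e1 e2
    rw [sub_smul, mul_comm (φ (dX (dX f)))]
    rw [eq_comm, add_eq_zero_iff_eq_neg] at e1 e2
    rw [e1, e2, mul_comm (φ (derivative (derivative f))) (φ (derivative (dX f)))]
    abel
  have hy : D (φ Y) = 0 := by
    rw [← hu.smul_eq_zero (G := A), hJe]
    have e1 := congrArg (fun z => φ (dX (derivative f)) • z) eP
    have e2 := congrArg (fun z => φ (dX (dX f)) • z) eQ
    simp only [smul_zero, smul_add, ← mul_smul] at e1 e2
    rw [sub_smul, mul_comm (φ (derivative (dX f)))]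
    rw [eq_comm, add_comm, add_eq_zero_iff_eq_neg] at e1 e2
    rw [e1, e2, mul_comm (φ (dX (derivative f))) (φ (dX (dX f)))]
    abel
  have hD : ∀ z, D z = 0 := by
    intro z
    obtain ⟨g, rfl⟩ := hφ z
    have := derivation_formula (A := A) (N := KaehlerDifferential K A) φ D g
    rw [hx, hy, smul_zero, smul_zero, add_zero] at this
    exact this
  rw [← Submodule.subsingleton_iff A]
  apply subsingleton_of_bot_eq_top
  rw [← KaehlerDifferential.span_range_derivation, eq_comm, Submodule.span_eq_bot]
  rintro _ ⟨z, rfl⟩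
  exact hD z

lemma II_unramified (f : K[X][Y]) (hJ : ∀ q ∈ ZZ f, (JJ f).evalEval q.1 q.2 ≠ 0) :
    Algebra.FormallyUnramified K (K[X][Y] ⧸ II f) :=
  unramified_aux f (Ideal.Quotient.mkₐ K (II f)) Ideal.Quotient.mk_surjective
    (fun g hg => Ideal.Quotient.eq_zero_iff_mem.2 hg) hJ

lemma mem_II_of_vanish (f : K[X][Y]) (hJ : ∀ q ∈ ZZ f, (JJ f).evalEval q.1 q.2 ≠ 0)
    (g : K[X][Y]) (hg : ∀ q ∈ ZZ f, g.evalEval q.1 q.2 = 0) : g ∈ II f := by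
  haveI := II_unramified f hJ
  haveI : Algebra.FiniteType K K[X][Y] := Algebra.FiniteType.trans (S := K[X]) inferInstance inferInstance
  haveI : Algebra.FiniteType K (K[X][Y] ⧸ II f) :=
    Algebra.FiniteType.of_surjective (Ideal.Quotient.mkₐ K (II f)) Ideal.Quotient.mk_surjective
  have hred : IsReduced (K[X][Y] ⧸ II f) := Algebra.FormallyUnramified.isReduced_of_field K (K[X][Y] ⧸ II f)
  have hrad : (II f).IsRadical := (Ideal.isRadical_iff_quotient_reduced _).2 hred
  have h1 : g ∈ (II f).radical := by
    rw [Ideal.radical_eq_jacobson, Ideal.jacobson, Ideal.mem_sInf]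
    rintro M ⟨hM1, hM2⟩
    obtain ⟨x, y, hxy⟩ := max_point M hM2
    rw [hxy]
    apply hg (x, y)
    exact ⟨(hxy _).1 (hM1 (Ideal.subset_span (by simp))), (hxy _).1 (hM1 (Ideal.subset_span (by simp)))⟩
  exact hrad h1

end nss
end Petro

set_option autoImplicit false
set_option linter.all false

namespace Petro
open Polynomial
open scoped Polynomial.Bivariate

section resid
variable {K : Type} [Field K] [CharZero K] {a b : ℕ} {f : K[X][Y]}

lemma split_top {g : K[X][Y]} {k l : ℕ} (hg : g ∈ Pol K k (l+1)) :
    g - C (g.coeff l) * Y ^ l ∈ Pol K k l := by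
  intro i j hij
  rw [coeff_sub, coeff_C_mul_X_pow]
  by_cases hj : j = l
  · subst hj; simp
  · rw [if_neg hj, sub_zero]; exact hg i j (by omega)

lemma split_topX {p : K[X]} {n : ℕ} (hp : p.degree < (n+1 : ℕ)) :
    (p - C (p.coeff n) * X ^ n).degree < ((n : ℕ) : WithBot ℕ) := by
  rw [degree_lt_iff_coeff_zero]
  intro i hi
  rw [coeff_sub, coeff_C_mul_X_pow]
  by_cases hj : i = n
  · subst hj; simp
  · rw [if_neg hj, sub_zero]; exact (degree_lt_iff_coeff_zero _ _).1 hp _ (by omega)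

lemma Good.L_top {L : K[X][Y] →ₗ[K] K} (h : Good a b f)
    (hU : ∀ g ∈ Pol K (4*a-2) (4*b-2), L g = 0) {g : K[X][Y]} (hg : g ∈ Pol K (4*a-2) (4*b-1)) :
    L g = L (C (g.coeff (4*b-2)) * Y ^ (4*b-2)) := by
  have hb := h.hb
  rw [show 4*b-1 = 4*b-2+1 by omega] at hg
  have := hU _ (split_top hg)
  rw [map_sub, sub_eq_zero] at this
  exact this

lemma Good.mu_P {L : K[X][Y] →ₗ[K] K} (h : Good a b f) (hI : ∀ g ∈ II f, L g = 0)
    (hU : ∀ g ∈ Pol K (4*a-2) (4*b-2), L g = 0) {r : K[X]} (hr : r.degree < (2*a-1 : ℕ)) :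
    L (C (r * derivative (f.coeff (2*b))) * Y ^ (4*b-2)) = 0 := by
  have ha := h.ha
  have hb := h.hb
  have h1 : C r * Y ^ (2*b-2) ∈ Pol K (2*a-1) (2*b-1) :=
    Pol_mul (Pol_C hr one_pos) (Pol_Xpow (k := 1) one_pos (show 2*b-2 < 2*b-1 by omega)) (by omega) (by omega)
  have h2 : C r * Y ^ (2*b-2) * dX f ∈ Pol K (4*a-2) (4*b-1) := Pol_mul h1 h.P_mem (by omega) (by omega)
  have h3 := h.L_top hU h2
  rw [coeff_helper r _ (n := 2*b) (by omega), h.P_top] at h3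
  rw [← h3]
  exact hI _ (Ideal.mul_mem_left _ _ (Ideal.subset_span (by simp)))

lemma Good.mu_Q {L : K[X][Y] →ₗ[K] K} (h : Good a b f) (hI : ∀ g ∈ II f, L g = 0)
    (hU : ∀ g ∈ Pol K (4*a-2) (4*b-2), L g = 0) {r : K[X]} (hr : r.degree < (2*a-2 : ℕ)) :
    L (C (r * (C (2*b : K) * f.coeff (2*b))) * Y ^ (4*b-2)) = 0 := by
  have ha := h.ha
  have hb := h.hb
  have h1 : C r * Y ^ (2*b-1) ∈ Pol K (2*a-2) (2*b) :=
    Pol_mul (Pol_C hr one_pos) (Pol_Xpow (k := 1) one_pos (show 2*b-1 < 2*b by omega)) (by omega) (by omega)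
  have h2 : C r * Y ^ (2*b-1) * derivative f ∈ Pol K (4*a-2) (4*b-1) := Pol_mul h1 h.Q_mem (by omega) (by omega)
  have h3 := h.L_top hU h2
  rw [coeff_helper r _ (n := 2*b-1) (by omega), h.Q_top] at h3
  rw [← h3]
  exact hI _ (Ideal.mul_mem_left _ _ (Ideal.subset_span (by simp)))

/-- the constant `κ` -/
noncomputable def kap (a b : ℕ) (f : K[X][Y]) (L : K[X][Y] →ₗ[K] K) : K :=
  L (C (X ^ (2*a-2) * (f.coeff (2*b) - C ((2*a : K)⁻¹) * (X * derivative (f.coeff (2*b))))) * Y ^ (4*b-2))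

lemma L_smul (L : K[X][Y] →ₗ[K] K) (k : K) (p : K[X]) (n : ℕ) :
    L (C (C k * p) * Y ^ n) = k * L (C p * Y ^ n) := by
  rw [← smul_eq_mul k, ← map_smul]
  congr 1
  rw [C_mul, mul_assoc]
  ext i j
  simp
  split_ifs <;> simp

lemma Good.L_bz {L : K[X][Y] →ₗ[K] K} (h : Good a b f) (hI : ∀ g ∈ II f, L g = 0)
    (hU : ∀ g ∈ Pol K (4*a-2) (4*b-2), L g = 0) (q : K × K) :
    L (bz f q) = 4 * a * b * (f.coeff (2*b)).coeff (2*a) * kap a b f L := by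
  have ha := h.ha
  have hb := h.hb
  set c := f.coeff (2*b) with hc
  set P := dX f with hP
  set Q := derivative f with hQ
  have hPm : P ∈ Pol K (2*a-1+1) (2*b-1+2) := by
    have := h.P_mem
    rwa [show 2*a-1+1 = 2*a by omega, show 2*b-1+2 = 2*b+1 by omega]
  have hQm : Q ∈ Pol K (2*a+1) (2*b-2+2) := by
    rw [show 2*b-2+2 = 2*b by omega]; exact h.Q_mem
  have hmem := Pol_mono (show 2*a ≤ 4*a-2 by omega) le_rfl (h.bz_mem q)
  rw [h.L_top hU hmem]
  have hE : (bz f q).coeff (4*b-2) = (derivative c /ₘ (X - C q.1)) * (C (2*b:K) * c)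
      - derivative c * ((C (2*b:K) * c) /ₘ (X - C q.1)) := by
    rw [bz, bez, coeff_sub]
    have e1 : (q1 P q.1 * q2 Q q.1 q.2).coeff (4*b-2) = (derivative c /ₘ (X - C q.1)) * C ((C (2*b:K) * c).eval q.1) := by
      rw [show 4*b-2 = 2*b + (2*b-2) by omega]
      rw [coeff_mul_add_eq_of_natDegree_le (Pol_natDegree (k := 2*a-1) ?_) (Pol_natDegree (k := 1) ?_)]
      · rw [q1_coeff, h.P_top, q2_coeff_top hQm, show 2*b-2+1 = 2*b-1 by omega, h.Q_top]
      · have := q1_mem hPm q.1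
        rwa [show 2*b-1+2 = 2*b+1 by omega] at this
      · exact q2_mem hQm q.1 q.2
    have e2 : (q2 P q.1 q.2 * q1 Q q.1).coeff (4*b-2) = C ((derivative c).eval q.1) * ((C (2*b:K) * c) /ₘ (X - C q.1)) := by
      rw [show 4*b-2 = (2*b-1) + (2*b-1) by omega]
      rw [coeff_mul_add_eq_of_natDegree_le (Pol_natDegree (k := 1) ?_) (Pol_natDegree (k := 2*a) ?_)]
      · rw [q1_coeff, h.Q_top, q2_coeff_top hPm, show 2*b-1+1 = 2*b by omega, h.P_top]
      · exact q2_mem hPm q.1 q.2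
      · have := q1_mem hQm q.1
        rwa [show 2*b-2+2 = 2*b-1+1 by omega] at this
    rw [e1, e2]
    have d1 := divX_eq (derivative c) q.1
    have d2 := divX_eq (C (2*b:K) * c) q.1
    generalize (derivative c) /ₘ (X - C q.1) = p1 at *
    generalize (C (2*b:K) * c) /ₘ (X - C q.1) = p2 at *
    generalize derivative c = p at *
    generalize C (2*b:K) * c = r at *
    linear_combination (-p1) * d2 + p2 * d1
  rw [hE]
  have hcdeg := h.degC
  rw [← hc] at hcdeg
  have hc0 : ∀ i, 2*a+1 ≤ i → c.coeff i = 0 := by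
    intro i hi
    apply coeff_eq_zero_of_degree_lt
    rw [hcdeg]; exact_mod_cast hi
  have hp0 : ∀ i, 2*a ≤ i → (derivative c).coeff i = 0 := by
    intro i hi
    rw [coeff_derivative, hc0 _ (by omega), zero_mul]
  have t1 := split_topX (p := derivative c /ₘ (X - C q.1)) (n := 2*a-2) (by
    rw [degree_lt_iff_coeff_zero]
    intro i hi
    exact divX_coeff_zero _ _ _ (fun j hj => hp0 j (by omega)))
  have t2 := split_topX (p := (C (2*b:K) * c) /ₘ (X - C q.1)) (n := 2*a-1) (by
    rw [degree_lt_iff_coeff_zero]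
    intro i hi
    exact divX_coeff_zero _ _ _ (fun j hj => by rw [coeff_C_mul, hc0 j (by omega), mul_zero]))
  rw [divX_coeff_top _ _ _ (fun i hi => hp0 i (by omega))] at t1
  rw [divX_coeff_top _ _ _ (fun i hi => by rw [coeff_C_mul, hc0 i (by omega), mul_zero])] at t2
  have v1 : (derivative c).coeff (2*a-2+1) = 2*a*c.coeff (2*a) := by
    rw [coeff_derivative, show 2*a-2+1+1 = 2*a by omega, mul_comm]
    congr 1
    rw [Nat.cast_add, Nat.cast_sub (by omega)]; push_cast; ring
  have v2 : (C (2*b:K) * c).coeff (2*a-1+1) = 2*b*c.coeff (2*a) := by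
    rw [coeff_C_mul, show 2*a-1+1 = 2*a by omega]
  rw [v1] at t1
  rw [v2] at t2
  have m1 := h.mu_Q hI hU t1
  have m2 := h.mu_P hI hU t2
  rw [← hc] at m1 m2
  have hX : (X : K[X]) ^ (2*a-1) = X ^ (2*a-2) * X := by
    rw [← pow_succ]; congr 1; omega
  have e3 : C ((derivative c /ₘ (X - C q.1)) * (C (2*b:K) * c) - derivative c * ((C (2*b:K) * c) /ₘ (X - C q.1))) * Y ^ (4*b-2)
    = C ((derivative c /ₘ (X - C q.1) - C (2*a*c.coeff (2*a)) * X^(2*a-2)) * (C (2*b:K) * c)) * Y^(4*b-2)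
    - C (((C (2*b:K) * c) /ₘ (X - C q.1) - C (2*b*c.coeff (2*a)) * X^(2*a-1)) * derivative c) * Y^(4*b-2)
    + C (C (4*a*b*c.coeff (2*a)) * (X ^ (2*a-2) * (c - C ((2*a : K)⁻¹) * (X * derivative c)))) * Y^(4*b-2) := by
    rw [← sub_mul, ← add_mul, ← C_sub, ← C_add]
    congr 2
    have ha' : (2*a:K) * (2*a:K)⁻¹ = 1 := mul_inv_cancel₀ (by norm_cast; omega)
    have hCa : C (2*a:K) * C ((2*a:K)⁻¹) = 1 := by rw [← C_mul, ha', C_1]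
    rw [hX]
    have e4 : (C (4*a*b*c.coeff (2*a)) : K[X]) = C (2*a:K) * C (2*b:K) * C (c.coeff (2*a)) := by
      rw [← C_mul, ← C_mul]; congr 1; ring
    rw [e4, C_mul (a := (2*a:K)), C_mul (a := (2*b:K))]
    linear_combination (C (2*b:K) * C (c.coeff (2*a)) * X ^ (2*a-2) * X * derivative c) * hCa
  rw [e3, map_add, map_sub, m1, m2, sub_zero, zero_add, L_smul, kap]

lemma Good.corner {L : K[X][Y] →ₗ[K] K} (h : Good a b f) (hI : ∀ g ∈ II f, L g = 0)
    (hU : ∀ g ∈ Pol K (4*a-2) (4*b-2), L g = 0) (t : K) {g : K[X][Y]} (hg : g ∈ Pol K (2*a-1) (2*b-1)) :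
    L (g * (f - C (C t))) = (g.coeff (2*b-2)).coeff (2*a-2) * kap a b f L := by
  have ha := h.ha
  have hb := h.hb
  have hPI : dX f ∈ II f := Ideal.subset_span (by simp)
  have hQI : derivative f ∈ II f := Ideal.subset_span (by simp)
  set fx := f - C (C (2*a:K)⁻¹) * (C X * dX f) with hfx
  set fy := f - C (C (2*b:K)⁻¹) * (Y * derivative f) with hfy
  have hfxm : fx ∈ Pol K (2*a) (2*b+1) := by
    intro i j hij
    rw [hfx, coeff_sub, coeff_C_mul, coeff_sub, coeff_C_mul, coeff_C_mul, dX_coeff']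
    by_cases hi : i = 2*a ∧ j < 2*b+1
    · obtain ⟨rfl, hj⟩ := hi
      have e : (X * derivative (f.coeff j)).coeff (2*a) = (f.coeff j).coeff (2*a) * (2*a) := by
        conv_lhs => rw [show 2*a = 2*a-1+1 by omega]
        rw [coeff_X_mul, coeff_derivative, show 2*a-1+1 = 2*a by omega]
        congr 1
        rw [Nat.cast_sub (by omega)]; push_cast; ring
      rw [e]
      have ha' : (a:K) ≠ 0 := by norm_cast; omega
      field_simp; ring
    · have hz : (f.coeff j).coeff i = 0 := h.mem i j (by omega)
      have hz2 : (X * derivative (f.coeff j)).coeff i = 0 := by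
        rcases i with _ | i
        · simp
        · rw [coeff_X_mul, coeff_derivative, hz, zero_mul]
      rw [hz, hz2]; ring
  have hfym : fy ∈ Pol K (2*a+1) (2*b) := by
    intro i j hij
    rw [hfy, coeff_sub, coeff_C_mul, coeff_sub, coeff_C_mul]
    by_cases hi : j = 2*b
    · subst hi
      have e : (Y * derivative f).coeff (2*b) = f.coeff (2*b) * C (2*b:K) := by
        conv_lhs => rw [show 2*b = 2*b-1+1 by omega]
        rw [coeff_X_mul, h.Q_top, mul_comm]
      rw [e, coeff_mul_C]
      have hb' : (b:K) ≠ 0 := by norm_cast; omega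
      field_simp; ring
    · have hz : (f.coeff j).coeff i = 0 := h.mem i j (by omega)
      have hz2 : ((Y * derivative f).coeff j).coeff i = 0 := by
        rcases j with _ | j
        · simp
        · rw [coeff_X_mul, dY_coeff, hz]; simp
      rw [hz, hz2]; ring
  have hLx : ∀ g, L (g * f) = L (g * fx) := by
    intro g
    rw [hfx, mul_sub, map_sub, hI (g * _) (Ideal.mul_mem_left _ _ (Ideal.mul_mem_left _ _ (Ideal.mul_mem_left _ _ hPI))), sub_zero]
  have hLy : ∀ g, L (g * f) = L (g * fy) := by
    intro g
    rw [hfy, mul_sub, map_sub, hI (g * _) (Ideal.mul_mem_left _ _ (Ideal.mul_mem_left _ _ (Ideal.mul_mem_left _ _ hQI))), sub_zero]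
  have hLt : L (g * C (C t)) = 0 := by
    apply hU
    have : (C (C t) : K[X][Y]) ∈ Pol K 1 1 := by
      apply Pol_C _ one_pos
      exact lt_of_le_of_lt degree_C_le (by norm_num)
    exact Pol_mul hg this (by omega) (by omega)
  rw [mul_sub, map_sub, hLt, sub_zero]
  set s := (g.coeff (2*b-2)).coeff (2*a-2) with hs
  set gt := g.coeff (2*b-2) with hgt
  have hg' : g ∈ Pol K (2*a-1) (2*b-2+1) := by rwa [show 2*b-2+1 = 2*b-1 by omega]
  have hg2 := split_top hg'
  have hgtd := Pol_coeff_degree hg (2*b-2)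
  rw [← hgt] at hgtd hg2
  have hgt2 := split_topX (p := gt) (n := 2*a-2) (by rwa [show 2*a-2+1 = 2*a-1 by omega])
  have hg1 : C (gt - C s * X ^ (2*a-2)) * Y ^ (2*b-2) ∈ Pol K (2*a-2) (2*b-1) :=
    Pol_mul (Pol_C hgt2 one_pos) (Pol_Xpow (k := 1) one_pos (show 2*b-2 < 2*b-1 by omega)) (by omega) (by omega)
  have hsplit : g = (g - C gt * Y ^ (2*b-2)) + C (gt - C s * X ^ (2*a-2)) * Y ^ (2*b-2) + C (C s) * (C (X^(2*a-2)) * Y ^ (2*b-2)) := by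
    rw [C_sub, C_mul]; ring
  rw [hsplit, add_mul, add_mul, map_add, map_add]
  have e1 : L ((g - C gt * Y ^ (2*b-2)) * f) = 0 := by
    rw [hLx]; exact hU _ (Pol_mul hg2 hfxm (by omega) (by omega))
  have e2 : L (C (gt - C s * X ^ (2*a-2)) * Y ^ (2*b-2) * f) = 0 := by
    rw [hLy]; exact hU _ (Pol_mul hg1 hfym (by omega) (by omega))
  rw [e1, e2, hLx]
  have hm : C (C s) * (C (X^(2*a-2)) * Y ^ (2*b-2)) * fx ∈ Pol K (4*a-2) (4*b-1) := by
    have h1 : (C (C s) * (C (X^(2*a-2)) * Y ^ (2*b-2)) : K[X][Y]) ∈ Pol K (2*a-1) (2*b-1) := by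
      refine Pol_mul (Pol_C (k := 1) (lt_of_le_of_lt degree_C_le (by norm_num)) one_pos) (Pol_CXmon (show 2*a-2 < 2*a-1 by omega) (show 2*b-2 < 2*b-1 by omega)) (by omega) (by omega)
    exact Pol_mul h1 hfxm (by omega) (by omega)
  rw [h.L_top hU hm, mul_assoc, coeff_C_mul, coeff_helper _ _ (n := 2*b) (by omega), L_smul, zero_add, zero_add, kap]
  rw [hfx, coeff_sub, coeff_C_mul, coeff_C_mul, h.P_top]

variable [IsAlgClosed K]

lemma Good.eq_zero_of_vanish (h : Good a b f) (hJ : ∀ q ∈ ZZ f, (JJ f).evalEval q.1 q.2 ≠ 0)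
    {g : K[X][Y]} (hg : g ∈ Pol K a b) (hv : ∀ q ∈ ZZ f, g.evalEval q.1 q.2 = 0) : g = 0 := by
  obtain ⟨α, β, e⟩ := mem_II.1 (mem_II_of_vanish f hJ g hv)
  exact h.eq_zero_of_mem hg e

/-- Euler–Jacobi type formula -/
theorem Good.formula (h : Good a b f) (hJ : ∀ q ∈ ZZ f, (JJ f).evalEval q.1 q.2 ≠ 0)
    (S : Finset (K × K)) (hS : ∀ q, q ∈ S ↔ q ∈ ZZ f) (t : K) {g : K[X][Y]} (hg : g ∈ Pol K a b) :
    4 * a * b * (f.coeff (2*b)).coeff (2*a) * ∑ q ∈ S, (f.evalEval q.1 q.2 - t) * (g.evalEval q.1 q.2)^2 / (JJ f).evalEval q.1 q.2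
      = ((g.coeff (b-1)).coeff (a-1))^2 := by
  classical
  have ha := h.ha
  have hb := h.hb
  obtain ⟨L, hL, hI, hU⟩ := h.exists_L
  set C0 := 4 * a * b * (f.coeff (2*b)).coeff (2*a) with hC0
  have key : ∀ w : K[X][Y], L w = (∑ q ∈ S, w.evalEval q.1 q.2 / (JJ f).evalEval q.1 q.2) * (C0 * kap a b f L) := by
    intro w
    have hmem : w - ∑ q ∈ S, (w.evalEval q.1 q.2 / (JJ f).evalEval q.1 q.2) • bz f q ∈ II f := by
      apply mem_II_of_vanish f hJ
      intro p hp
      rw [evalEval_sub, evalEval_finsetSum, Finset.sum_eq_single p]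
      · rw [evalEval_smul, bez_self, smul_eq_mul, div_mul_cancel₀ _ (hJ _ hp), sub_self]
      · intro q hq hne
        have hq' := (hS q).1 hq
        rw [evalEval_smul, bez_off hp.1 hp.2 hq'.1 hq'.2, smul_zero]
        intro h'; apply hne; ext <;> simp_all
      · intro hn; exact absurd ((hS p).2 hp) hn
    have := hI _ hmem
    rw [map_sub, map_sum, sub_eq_zero] at this
    rw [this, Finset.sum_mul]
    refine Finset.sum_congr rfl fun q _ => ?_
    rw [map_smul, h.L_bz hI hU, smul_eq_mul]
  have hne : C0 * kap a b f L ≠ 0 := by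
    intro h0
    apply hL
    ext1 w
    rw [key w, h0, mul_zero]; rfl
  have hg2 : g^2 ∈ Pol K (2*a-1) (2*b-1) := by
    rw [sq]; exact Pol_mul hg hg (by omega) (by omega)
  have hcor := h.corner hI hU t hg2
  have hcf : ((g^2).coeff (2*b-2)).coeff (2*a-2) = ((g.coeff (b-1)).coeff (a-1))^2 := by
    rw [sq, sq, show 2*b-2 = (b-1)+(b-1) by omega, show 2*a-2 = (a-1)+(a-1) by omega]
    have hgb : g ∈ Pol K a (b-1+1) := by rwa [show b-1+1=b by omega]
    have hga : g ∈ Pol K (a-1+1) b := by rwa [show a-1+1=a by omega]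
    rw [coeff_mul_add_eq_of_natDegree_le (Pol_natDegree hgb) (Pol_natDegree hgb)]
    rw [coeff_mul_add_eq_of_natDegree_le (Pol_coeff_natDegree hga _) (Pol_coeff_natDegree hga _)]
  rw [hcf, key] at hcor
  have hk : kap a b f L ≠ 0 := right_ne_zero_of_mul hne
  apply mul_right_cancel₀ hk
  rw [← hcor]
  have : ∀ q ∈ S, (g ^ 2 * (f - C (C t))).evalEval q.1 q.2 / (JJ f).evalEval q.1 q.2 = (f.evalEval q.1 q.2 - t) * (g.evalEval q.1 q.2)^2 / (JJ f).evalEval q.1 q.2 := by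
    intro q _
    rw [evalEval_mul, evalEval_sub, evalEval_pow]
    simp [mul_comm, evalEval_C]
  rw [Finset.sum_congr rfl this]
  ring

end resid
end Petro

set_option autoImplicit false
set_option linter.all false

namespace Petro
open Polynomial
open scoped Polynomial.Bivariate

/-- complexification -/
noncomputable def cx (f : ℝ[X][Y]) : ℂ[X][Y] := f.map (mapRingHom Complex.ofRealHom)

lemma cx_coeff (f : ℝ[X][Y]) (i j : ℕ) : ((cx f).coeff j).coeff i = ((f.coeff j).coeff i : ℂ) := by
  simp [cx]

lemma cx_dX (f : ℝ[X][Y]) : dX (cx f) = cx (dX f) := by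
  apply biv_ext
  intro i j
  rw [dX_coeff, cx_coeff, cx_coeff, dX_coeff]; push_cast; rfl

lemma cx_dY (f : ℝ[X][Y]) : derivative (cx f) = cx (derivative f) := by
  apply biv_ext
  intro i j
  rw [dY_coeff, cx_coeff, cx_coeff, dY_coeff]; push_cast; rfl

lemma cx_mul (f g : ℝ[X][Y]) : cx (f * g) = cx f * cx g := by simp [cx]
lemma cx_sub (f g : ℝ[X][Y]) : cx (f - g) = cx f - cx g := by simp [cx]
lemma cx_JJ (f : ℝ[X][Y]) : JJ (cx f) = cx (JJ f) := by
  simp only [JJ, Jac, cx_dX, cx_dY, cx_mul, cx_sub]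

lemma cx_eval (f : ℝ[X][Y]) (x y : ℝ) : (cx f).evalEval (x : ℂ) (y : ℂ) = ((f.evalEval x y : ℝ) : ℂ) :=
  map_mapRingHom_evalEval Complex.ofRealHom f x y

lemma cx_conj (f : ℝ[X][Y]) (x y : ℂ) : (cx f).evalEval ((starRingEnd ℂ) x) ((starRingEnd ℂ) y)
    = (starRingEnd ℂ) ((cx f).evalEval x y) := by
  rw [← map_mapRingHom_evalEval (starRingEnd ℂ) (cx f) x y]
  congr 1
  apply biv_ext
  intro i j
  simp [cx]

lemma cx_mem {f : ℝ[X][Y]} {k l : ℕ} (h : f ∈ Pol ℝ k l) : cx f ∈ Pol ℂ k l := by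
  intro i j hij
  rw [cx_coeff, h i j hij]; simp

lemma cx_inj {f : ℝ[X][Y]} (h : cx f = 0) : f = 0 := by
  apply biv_ext
  intro i j
  have := cx_coeff f i j
  rw [h] at this
  simpa using this.symm

/-- upper half -/
def upper (q : ℂ × ℂ) : Prop := 0 < q.1.im ∨ (q.1.im = 0 ∧ 0 < q.2.im)

theorem sign_count {a b : ℕ} {f : ℝ[X][Y]} (h : Good a b (cx f))
    (hJ : ∀ q ∈ ZZ (cx f), (JJ (cx f)).evalEval q.1 q.2 ≠ 0)
    (hl : 0 < (f.coeff (2*b)).coeff (2*a)) (t : ℝ)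
    (ht : ∀ q ∈ ZZ (cx f), (cx f).evalEval q.1 q.2 ≠ t)
    (S : Finset (ℝ × ℝ)) (hS : ∀ q, q ∈ S ↔ q ∈ ZZ f) :
    2*(a*b) + S.card + 2*a + 2*b ≤
      2 * (S.filter (fun q => 0 < (f.evalEval q.1 q.2 - t) / (JJ f).evalEval q.1 q.2)).card + 8*(a*b) + 1 := by
  classical
  have ha := h.ha
  have hb := h.hb
  have hfin := h.ZZ_finite hJ
  set Z := hfin.toFinset with hZ
  have hmZ : ∀ q, q ∈ Z ↔ q ∈ ZZ (cx f) := fun q => hfin.mem_toFinset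
  let cj : ℂ × ℂ → ℂ × ℂ := fun q => ((starRingEnd ℂ) q.1, (starRingEnd ℂ) q.2)
  let emb : ℝ × ℝ → ℂ × ℂ := fun q => ((q.1 : ℂ), (q.2 : ℂ))
  have hcj : ∀ q ∈ ZZ (cx f), cj q ∈ ZZ (cx f) := by
    rintro q ⟨h1, h2⟩
    rw [cx_dX] at h1
    rw [cx_dY] at h2
    refine ⟨?_, ?_⟩
    · rw [cx_dX, cx_conj, h1, map_zero]
    · rw [cx_dY, cx_conj, h2, map_zero]
  have hcjcj : ∀ q, cj (cj q) = q := by intro q; simp [cj]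
  have hemb : ∀ q, emb q ∈ ZZ (cx f) ↔ q ∈ ZZ f := by
    intro q
    simp only [ZZ, Set.mem_setOf_eq, emb, cx_dX, cx_dY, cx_eval, Complex.ofReal_eq_zero]
  set Rep := Z.filter upper with hRep
  set Pos := S.filter (fun q => 0 < (f.evalEval q.1 q.2 - t) / (JJ f).evalEval q.1 q.2) with hPos
  have hcard : S.card + 2 * Rep.card + 2*a+2*b ≤ 8*a*b+1 := by
    have hd1 : Disjoint (S.image emb) (Rep ∪ Rep.image cj) := by
      rw [Finset.disjoint_left]
      intro q hq hq'
      obtain ⟨r, _, rfl⟩ := Finset.mem_image.1 hq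
      rcases Finset.mem_union.1 hq' with hq' | hq'
      · have := (Finset.mem_filter.1 hq').2
        simp [upper, emb] at this
      · obtain ⟨s, hs, hs'⟩ := Finset.mem_image.1 hq'
        have h1 := (Finset.mem_filter.1 hs).2
        have e1 : s.1.im = 0 := by
          have := congrArg (fun z : ℂ × ℂ => z.1.im) hs'; simpa [cj, emb] using this
        have e2 : s.2.im = 0 := by
          have := congrArg (fun z : ℂ × ℂ => z.2.im) hs'; simpa [cj, emb] using this
        simp [upper, e1, e2] at h1
    have hd2 : Disjoint Rep (Rep.image cj) := by
      rw [Finset.disjoint_left]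
      intro q hq hq'
      obtain ⟨s, hs, rfl⟩ := Finset.mem_image.1 hq'
      have h1 := (Finset.mem_filter.1 hs).2
      have h2 := (Finset.mem_filter.1 hq).2
      simp only [upper, cj, Complex.conj_im] at h1 h2
      rcases h1 with h1 | h1 <;> rcases h2 with h2 | h2
      · linarith
      · linarith [h2.1]
      · linarith [h1.1]
      · linarith [h1.2, h2.2]
    have hc := h.card_le hJ (S.image emb ∪ (Rep ∪ Rep.image cj)) (by
      intro q hq
      rcases Finset.mem_union.1 hq with hq | hq
      · obtain ⟨r, hr, rfl⟩ := Finset.mem_image.1 hq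
        exact (hemb r).2 ((hS r).1 hr)
      rcases Finset.mem_union.1 hq with hq | hq
      · exact (hmZ q).1 (Finset.mem_filter.1 hq).1
      · obtain ⟨s, hs, rfl⟩ := Finset.mem_image.1 hq
        exact hcj _ ((hmZ s).1 (Finset.mem_filter.1 hs).1))
    rw [Finset.card_union_of_disjoint hd1, Finset.card_union_of_disjoint hd2,
      Finset.card_image_of_injective, Finset.card_image_of_injective] at hc
    · omega
    · intro u v huv
      have := congrArg cj huv
      simpa [hcjcj] using this
    · intro u v huv
      have e1 := congrArg (fun z : ℂ × ℂ => z.1.re) huv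
      have e2 := congrArg (fun z : ℂ × ℂ => z.2.re) huv
      ext
      · simpa [emb] using e1
      · simpa [emb] using e2
  suffices hmain : a * b ≤ Pos.card + Rep.card by nlinarith
  by_contra hlt
  push Not at hlt
  have hτ : ∀ q : ℂ × ℂ, ∃ τ : ℂ, τ ^ 2 = - (((cx f).evalEval q.1 q.2 - t) / (JJ (cx f)).evalEval q.1 q.2) := by
    intro q
    exact IsAlgClosed.exists_pow_nat_eq _ two_pos
  choose τ hτ using hτ
  let Φ : Pol ℝ a b →ₗ[ℝ] ((Pos → ℝ) × (Rep → ℝ)) :=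
    { toFun := fun p => (fun q => (p : ℝ[X][Y]).evalEval q.1.1 q.1.2, fun q => (τ q.1 * (cx (p : ℝ[X][Y])).evalEval q.1.1 q.1.2).im)
      map_add' := by
        intro p q
        ext r
        · simp
        · simp [cx, mul_add]
      map_smul' := by
        intro c p
        ext r
        · simp
        · have : cx ((c • p : Pol ℝ a b) : ℝ[X][Y]) = (c : ℂ) • cx (p : ℝ[X][Y]) := by
            apply biv_ext
            intro i j
            simp [cx]
          simp only [this, evalEval_smul]
          simp only [smul_eq_mul, RingHom.id_apply, Prod.smul_mk, Pi.smul_apply]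
          rw [mul_left_comm, Complex.im_ofReal_mul] }
  have hker : LinearMap.ker Φ ≠ ⊥ := by
    apply LinearMap.ker_ne_bot_of_finrank_lt (K := ℝ) (V := Pol ℝ a b)
    rw [Pol_finrank, Module.finrank_prod, Module.finrank_fintype_fun_eq_card, Module.finrank_fintype_fun_eq_card, Fintype.card_coe, Fintype.card_coe]
    exact hlt
  obtain ⟨p, hp, hp0⟩ := Submodule.exists_mem_ne_zero_of_ne_bot hker
  rw [LinearMap.mem_ker] at hp
  set g : ℝ[X][Y] := p.1 with hg
  have hgm : g ∈ Pol ℝ a b := p.2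
  have h1 : ∀ q ∈ Pos, g.evalEval q.1 q.2 = 0 := by
    intro q hq
    exact congrFun (congrArg Prod.fst hp) ⟨q, hq⟩
  have h2 : ∀ q ∈ Rep, (τ q * (cx g).evalEval q.1 q.2).im = 0 := by
    intro q hq
    exact congrFun (congrArg Prod.snd hp) ⟨q, hq⟩
  set T : ℂ × ℂ → ℂ := fun q => ((cx f).evalEval q.1 q.2 - t) * ((cx g).evalEval q.1 q.2)^2 / (JJ (cx f)).evalEval q.1 q.2 with hT
  have hTτ : ∀ q, T q = - (τ q * (cx g).evalEval q.1 q.2)^2 := by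
    intro q
    rw [mul_pow, hτ q]; simp only [hT]; ring
  have hTcj : ∀ q, T (cj q) = (starRingEnd ℂ) (T q) := by
    intro q
    simp only [hT, cj, cx_JJ, cx_conj, map_div₀, map_mul, map_sub, map_pow, Complex.conj_ofReal]
  have hTrep : ∀ q ∈ Rep, (T q).re ≤ 0 ∧ ((T q).re = 0 → (cx g).evalEval q.1 q.2 = 0) := by
    intro q hq
    have him := h2 q hq
    rw [hTτ]
    set z := τ q * (cx g).evalEval q.1 q.2 with hz
    have hre : (-z^2).re = -(z.re)^2 := by
      rw [sq, Complex.neg_re, Complex.mul_re, him]; ring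
    rw [hre]
    refine ⟨by nlinarith [sq_nonneg z.re], fun h0 => ?_⟩
    have hz0 : z = 0 := by
      apply Complex.ext
      · simpa using h0
      · simpa using him
    have hqZ := (hmZ q).1 (Finset.mem_filter.1 hq).1
    have hτ0 : τ q ≠ 0 := by
      intro h0
      have := hτ q
      rw [h0] at this
      have h3 : ((cx f).evalEval q.1 q.2 - t) / (JJ (cx f)).evalEval q.1 q.2 ≠ 0 :=
        div_ne_zero (sub_ne_zero.2 (ht q hqZ)) (hJ q hqZ)
      apply h3
      simpa using this.symm
    exact (mul_eq_zero.1 hz0).resolve_left hτ0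
  have hTall : ∀ q ∈ Z, (T q).re ≤ 0 ∧ ((T q).re = 0 → (cx g).evalEval q.1 q.2 = 0) := by
    intro q hq
    by_cases hu : upper q
    · exact hTrep q (Finset.mem_filter.2 ⟨hq, hu⟩)
    by_cases hu' : upper (cj q)
    · have h3 := hTrep (cj q) (Finset.mem_filter.2 ⟨(hmZ _).2 (hcj q ((hmZ q).1 hq)), hu'⟩)
      rw [hTcj, Complex.conj_re] at h3
      refine ⟨h3.1, fun h0 => ?_⟩
      have h4 := h3.2 h0
      simp only [cj, cx_conj] at h4
      simpa using h4
    · have e1 : q.1.im = 0 := by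
        by_contra hne
        rcases lt_or_gt_of_ne hne with h' | h'
        · exact hu' (Or.inl (by simpa [cj] using h'))
        · exact hu (Or.inl h')
      have e2 : q.2.im = 0 := by
        by_contra hne
        rcases lt_or_gt_of_ne hne with h' | h'
        · exact hu' (Or.inr ⟨by simpa [cj] using e1, by simpa [cj] using h'⟩)
        · exact hu (Or.inr ⟨e1, h'⟩)
      obtain ⟨r, rfl⟩ : ∃ r, emb r = q := ⟨(q.1.re, q.2.re), by
        ext <;> simp [emb, Complex.ext_iff, e1, e2]⟩
      have hr : r ∈ S := (hS r).2 ((hemb r).1 ((hmZ _).1 hq))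
      have hTr : T (emb r) = (((f.evalEval r.1 r.2 - t) / (JJ f).evalEval r.1 r.2 * (g.evalEval r.1 r.2)^2 : ℝ) : ℂ) := by
        simp only [hT, emb, cx_JJ, cx_eval]; push_cast; ring
      have hv : (f.evalEval r.1 r.2 - t) / (JJ f).evalEval r.1 r.2 ≠ 0 := by
        have k1 := ht _ ((hmZ _).1 hq)
        have k2 := hJ _ ((hmZ _).1 hq)
        simp only [emb, cx_JJ, cx_eval] at k1 k2
        refine div_ne_zero (sub_ne_zero.2 ?_) ?_
        · exact_mod_cast k1
        · exact_mod_cast k2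
      rw [hTr, Complex.ofReal_re]
      simp only [emb, cx_eval, Complex.ofReal_eq_zero]
      by_cases hpos : 0 < (f.evalEval r.1 r.2 - t) / (JJ f).evalEval r.1 r.2
      · have := h1 r (Finset.mem_filter.2 ⟨hr, hpos⟩)
        rw [this]; simp
      · have hneg : (f.evalEval r.1 r.2 - t) / (JJ f).evalEval r.1 r.2 < 0 := lt_of_le_of_ne (not_lt.1 hpos) hv
        refine ⟨mul_nonpos_of_nonpos_of_nonneg hneg.le (sq_nonneg _), fun h0 => ?_⟩
        have := (mul_eq_zero.1 h0).resolve_left hv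
        exact pow_eq_zero_iff (two_ne_zero) |>.1 this
  have hform := h.formula hJ Z hmZ (t : ℂ) (cx_mem hgm)
  rw [cx_coeff, cx_coeff] at hform
  have hsum : 0 ≤ (∑ q ∈ Z, T q).re := by
    have e : (((4 * a * b * (f.coeff (2*b)).coeff (2*a) : ℝ)) : ℂ) * ∑ q ∈ Z, T q = ((((g.coeff (b-1)).coeff (a-1))^2 : ℝ) : ℂ) := by
      push_cast; exact hform
    have e2 := congrArg Complex.re e
    rw [Complex.re_ofReal_mul, Complex.ofReal_re] at e2
    have hpos : 0 < 4 * a * b * (f.coeff (2*b)).coeff (2*a) := by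
      have : (0:ℝ) < a := by exact_mod_cast ha
      have : (0:ℝ) < b := by exact_mod_cast hb
      positivity
    by_contra hneg
    push Not at hneg
    have := mul_neg_of_pos_of_neg hpos hneg
    nlinarith [sq_nonneg ((g.coeff (b-1)).coeff (a-1))]
  rw [Complex.re_sum] at hsum
  have hzero : ∀ q ∈ Z, (T q).re = 0 := by
    apply (Finset.sum_eq_zero_iff_of_nonpos (fun q hq => (hTall q hq).1)).1
    exact le_antisymm (Finset.sum_nonpos (fun q hq => (hTall q hq).1)) hsum
  have hgz : cx g = 0 := h.eq_zero_of_vanish hJ (cx_mem hgm) (fun q hq => (hTall q ((hmZ q).2 hq)).2 (hzero q ((hmZ q).2 hq)))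
  exact hp0 (Subtype.ext (cx_inj hgz))

end Petro

set_option autoImplicit false
set_option linter.all false

namespace Petro
open Polynomial
open scoped Polynomial.Bivariate

lemma hasFD (g : ℝ[X][Y]) (p : ℝ × ℝ) : HasStrictFDerivAt (fun p : ℝ × ℝ => g.evalEval p.1 p.2)
    ((dX g).evalEval p.1 p.2 • ContinuousLinearMap.fst ℝ ℝ ℝ + (derivative g).evalEval p.1 p.2 • ContinuousLinearMap.snd ℝ ℝ ℝ) p := by
  have hmul : ∀ g h : ℝ[X][Y], HasStrictFDerivAt (fun p : ℝ × ℝ => g.evalEval p.1 p.2)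
    ((dX g).evalEval p.1 p.2 • ContinuousLinearMap.fst ℝ ℝ ℝ + (derivative g).evalEval p.1 p.2 • ContinuousLinearMap.snd ℝ ℝ ℝ) p →
      HasStrictFDerivAt (fun p : ℝ × ℝ => h.evalEval p.1 p.2)
    ((dX h).evalEval p.1 p.2 • ContinuousLinearMap.fst ℝ ℝ ℝ + (derivative h).evalEval p.1 p.2 • ContinuousLinearMap.snd ℝ ℝ ℝ) p →
      HasStrictFDerivAt (fun p : ℝ × ℝ => (g*h).evalEval p.1 p.2)
    ((dX (g*h)).evalEval p.1 p.2 • ContinuousLinearMap.fst ℝ ℝ ℝ + (derivative (g*h)).evalEval p.1 p.2 • ContinuousLinearMap.snd ℝ ℝ ℝ) p := by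
    intro g h hg hh
    have := hg.fun_mul hh
    simp only [evalEval_mul]
    refine this.congr_fderiv ?_
    ext <;> simp [dX_mul, derivative_mul] <;> ring
  have hadd : ∀ g h : ℝ[X][Y], HasStrictFDerivAt (fun p : ℝ × ℝ => g.evalEval p.1 p.2)
    ((dX g).evalEval p.1 p.2 • ContinuousLinearMap.fst ℝ ℝ ℝ + (derivative g).evalEval p.1 p.2 • ContinuousLinearMap.snd ℝ ℝ ℝ) p →
      HasStrictFDerivAt (fun p : ℝ × ℝ => h.evalEval p.1 p.2)
    ((dX h).evalEval p.1 p.2 • ContinuousLinearMap.fst ℝ ℝ ℝ + (derivative h).evalEval p.1 p.2 • ContinuousLinearMap.snd ℝ ℝ ℝ) p →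
      HasStrictFDerivAt (fun p : ℝ × ℝ => (g+h).evalEval p.1 p.2)
    ((dX (g+h)).evalEval p.1 p.2 • ContinuousLinearMap.fst ℝ ℝ ℝ + (derivative (g+h)).evalEval p.1 p.2 • ContinuousLinearMap.snd ℝ ℝ ℝ) p := by
    intro g h hg hh
    have := hg.fun_add hh
    simp only [evalEval_add]
    refine this.congr_fderiv ?_
    ext <;> simp [dX_add, derivative_add] <;> ring
  have hc : ∀ r : ℝ, HasStrictFDerivAt (fun p : ℝ × ℝ => (C (C r) : ℝ[X][Y]).evalEval p.1 p.2)
    ((dX (C (C r) : ℝ[X][Y])).evalEval p.1 p.2 • ContinuousLinearMap.fst ℝ ℝ ℝ + (derivative (C (C r) : ℝ[X][Y])).evalEval p.1 p.2 • ContinuousLinearMap.snd ℝ ℝ ℝ) p := by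
    intro r
    simp only [evalEval_C, eval_C]
    refine (hasStrictFDerivAt_const r p).congr_fderiv ?_
    ext <;> simp [dX_C]
  have hx : HasStrictFDerivAt (fun p : ℝ × ℝ => (C X : ℝ[X][Y]).evalEval p.1 p.2)
    ((dX (C X : ℝ[X][Y])).evalEval p.1 p.2 • ContinuousLinearMap.fst ℝ ℝ ℝ + (derivative (C X : ℝ[X][Y])).evalEval p.1 p.2 • ContinuousLinearMap.snd ℝ ℝ ℝ) p := by
    simp only [evalEval_C, eval_X]
    refine (hasStrictFDerivAt_fst).congr_fderiv ?_
    ext <;> simp [dX_C]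
  have hy : HasStrictFDerivAt (fun p : ℝ × ℝ => (Y : ℝ[X][Y]).evalEval p.1 p.2)
    ((dX (Y : ℝ[X][Y])).evalEval p.1 p.2 • ContinuousLinearMap.fst ℝ ℝ ℝ + (derivative (Y : ℝ[X][Y])).evalEval p.1 p.2 • ContinuousLinearMap.snd ℝ ℝ ℝ) p := by
    simp only [evalEval_X]
    refine (hasStrictFDerivAt_snd).congr_fderiv ?_
    ext <;> simp [dX_Y]
  have hC : ∀ q : ℝ[X], HasStrictFDerivAt (fun p : ℝ × ℝ => (C q : ℝ[X][Y]).evalEval p.1 p.2)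
    ((dX (C q : ℝ[X][Y])).evalEval p.1 p.2 • ContinuousLinearMap.fst ℝ ℝ ℝ + (derivative (C q : ℝ[X][Y])).evalEval p.1 p.2 • ContinuousLinearMap.snd ℝ ℝ ℝ) p := by
    intro q
    induction q using Polynomial.induction_on with
    | C r => exact hc r
    | add p q hp hq => rw [C_add]; exact hadd _ _ hp hq
    | monomial n r ih => rw [pow_succ, ← mul_assoc, C_mul]; exact hmul _ _ ih hx
  induction g using Polynomial.induction_on with
  | C r => exact hC r
  | add p q hp hq => exact hadd _ _ hp hq
  | monomial n r ih => rw [pow_succ, ← mul_assoc]; exact hmul _ _ ih hy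

lemma ev_cont (g : ℝ[X][Y]) : Continuous (fun p : ℝ × ℝ => g.evalEval p.1 p.2) :=
  continuous_iff_continuousAt.2 fun p => (hasFD g p).hasFDerivAt.continuousAt

lemma ev_hasDerivX (g : ℝ[X][Y]) (x y : ℝ) : HasDerivAt (fun s => g.evalEval s y) ((dX g).evalEval x y) x := by
  have h := (hasFD g (x, y)).hasFDerivAt.comp_hasDerivAt x ((hasDerivAt_id x).prodMk (hasDerivAt_const x y))
  have e : (fun s => g.evalEval s y) = (fun p : ℝ × ℝ => g.evalEval p.1 p.2) ∘ fun s => (s, y) := rfl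
  rw [e]
  simpa using h

lemma ev_hasDerivY (g : ℝ[X][Y]) (x y : ℝ) : HasDerivAt (fun s => g.evalEval x s) ((derivative g).evalEval x y) y := by
  have h := (hasFD g (x, y)).hasFDerivAt.comp_hasDerivAt y ((hasDerivAt_const y x).prodMk (hasDerivAt_id y))
  have e : (fun s => g.evalEval x s) = (fun p : ℝ × ℝ => g.evalEval p.1 p.2) ∘ fun s => (x, s) := rfl
  rw [e]
  simpa using h

lemma exists_pos_le {α : Type*} [TopologicalSpace α] {K : Set α} (hK : IsCompact K) {g : α → ℝ}
    (hg : ContinuousOn g K) (h : ∀ x ∈ K, 0 < g x) : ∃ ε > 0, ∀ x ∈ K, ε ≤ g x := by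
  rcases K.eq_empty_or_nonempty with rfl | hne
  · exact ⟨1, one_pos, by simp⟩
  · obtain ⟨x, hx, hm⟩ := hK.exists_isMinOn hne hg
    exact ⟨g x, h x hx, fun y hy => hm hy⟩

lemma exists_bump {ε : ℝ} (hε : 0 < ε) : ∃ B b b' : ℝ → ℝ, (∀ u, HasDerivAt B (b u) u) ∧ (∀ u, HasDerivAt b (b' u) u) ∧
    Continuous b' ∧ (∀ u ≤ -ε, B u = 0) ∧ (∀ u ≥ ε, B u = 1) ∧ (∀ u, ε ≤ |u| → b u = 0) := by
  set B : ℝ → ℝ := fun u => Real.smoothTransition ((u + ε) / (2 * ε)) with hB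
  have hcd : ContDiff ℝ 2 B := by
    have h1 : ContDiff ℝ ((2:ℕ∞):WithTop ℕ∞) Real.smoothTransition := Real.smoothTransition.contDiff
    exact h1.comp ((contDiff_id.add contDiff_const).div_const _)
  have h2 : ContDiff ℝ 1 (deriv B) := by
    have := (contDiff_succ_iff_deriv (n := 1) (f := B)).1 (by simpa [one_add_one_eq_two] using hcd)
    exact this.2.2
  have h3 : Continuous (deriv (deriv B)) := h2.continuous_deriv le_rfl
  have hB0 : ∀ u ≤ -ε, B u = 0 := by
    intro u hu
    apply Real.smoothTransition.zero_of_nonpos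
    apply div_nonpos_of_nonpos_of_nonneg <;> linarith
  have hB1 : ∀ u ≥ ε, B u = 1 := by
    intro u hu
    apply Real.smoothTransition.one_of_one_le
    rw [le_div_iff₀ (by linarith)]; linarith
  have hlt : ∀ u, ε < |u| → deriv B u = 0 := by
    intro u hu
    rcases lt_abs.1 hu with h | h
    · have : B =ᶠ[nhds u] fun _ => 1 := by
        filter_upwards [lt_mem_nhds h] with v hv using hB1 v hv.le
      rw [this.deriv_eq]; simp
    · have : B =ᶠ[nhds u] fun _ => 0 := by
        filter_upwards [gt_mem_nhds (show u < -ε by linarith)] with v hv using hB0 v hv.le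
      rw [this.deriv_eq]; simp
  refine ⟨B, deriv B, deriv (deriv B), fun u => ((hcd.differentiable (by norm_num)) u).hasDerivAt,
    fun u => ((h2.differentiable (by norm_num)) u).hasDerivAt, h3, hB0, hB1, fun u hu => ?_⟩
  have hcl : IsClosed {u | deriv B u = 0} := isClosed_eq h2.continuous continuous_const
  have hsub : closure {u : ℝ | ε < |u|} ⊆ {u | deriv B u = 0} := hcl.closure_subset_iff.2 hlt
  apply hsub
  rw [Metric.mem_closure_iff]
  intro δ hδ
  rcases le_abs.1 hu with h | h
  · exact ⟨u + δ/2, by rw [Set.mem_setOf_eq, lt_abs]; left; linarith, by rw [Real.dist_eq, abs_lt]; constructor <;> linarith⟩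
  · exact ⟨u - δ/2, by rw [Set.mem_setOf_eq, lt_abs]; right; linarith, by rw [Real.dist_eq, abs_lt]; constructor <;> linarith⟩

end Petro

set_option autoImplicit false
set_option linter.all false

namespace Petro
open Polynomial MeasureTheory Set
open scoped Polynomial.Bivariate

/-- derivative of `(P,Q)` -/
noncomputable def dPQ (P Q : ℝ[X][Y]) (p : ℝ × ℝ) : ℝ × ℝ →L[ℝ] ℝ × ℝ :=
  ((dX P).evalEval p.1 p.2 • ContinuousLinearMap.fst ℝ ℝ ℝ + (derivative P).evalEval p.1 p.2 • ContinuousLinearMap.snd ℝ ℝ ℝ).prod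
  ((dX Q).evalEval p.1 p.2 • ContinuousLinearMap.fst ℝ ℝ ℝ + (derivative Q).evalEval p.1 p.2 • ContinuousLinearMap.snd ℝ ℝ ℝ)

lemma hasFD_PQ (P Q : ℝ[X][Y]) (p : ℝ × ℝ) :
    HasStrictFDerivAt (fun p : ℝ × ℝ => (P.evalEval p.1 p.2, Q.evalEval p.1 p.2)) (dPQ P Q p) p :=
  (hasFD P p).prodMk (hasFD Q p)

lemma dPQ_det (P Q : ℝ[X][Y]) (p : ℝ × ℝ) : (dPQ P Q p).det = (Jac P Q).evalEval p.1 p.2 := by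
  rw [ContinuousLinearMap.det, ← LinearMap.det_toMatrix (Module.Basis.finTwoProd ℝ), Matrix.det_fin_two]
  simp [LinearMap.toMatrix_apply, dPQ, Jac]

lemma local_int (P Q : ℝ[X][Y]) (q : ℝ × ℝ) (hP : P.evalEval q.1 q.2 = 0) (hQ : Q.evalEval q.1 q.2 = 0)
    (hJ : (Jac P Q).evalEval q.1 q.2 ≠ 0) (W : Set (ℝ × ℝ)) (hW : IsOpen W) (hq : q ∈ W) :
    ∃ U ⊆ W, IsOpen U ∧ q ∈ U ∧ ∃ ε > 0, ∀ b : ℝ → ℝ, (∀ u, ε ≤ |u| → b u = 0) →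
      ∫ p in U, b (P.evalEval p.1 p.2) * b (Q.evalEval p.1 p.2) * (Jac P Q).evalEval p.1 p.2
        = (if 0 < (Jac P Q).evalEval q.1 q.2 then (1:ℝ) else -1) * (∫ u, b u)^2 := by
  set φ : ℝ × ℝ → ℝ × ℝ := fun p => (P.evalEval p.1 p.2, Q.evalEval p.1 p.2) with hφ
  have hdet : (dPQ P Q q).det ≠ 0 := by rw [dPQ_det]; exact hJ
  have hstrict : HasStrictFDerivAt φ (((dPQ P Q q).toContinuousLinearEquivOfDetNeZero hdet : (ℝ × ℝ) ≃L[ℝ] (ℝ × ℝ)) : ℝ × ℝ →L[ℝ] ℝ × ℝ) q := by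
    rw [ContinuousLinearMap.coe_toContinuousLinearEquivOfDetNeZero]
    exact hasFD_PQ P Q q
  set e := hstrict.toOpenPartialHomeomorph φ with he
  have hecoe : (e : ℝ × ℝ → ℝ × ℝ) = φ := hstrict.toOpenPartialHomeomorph_coe
  set s : ℝ := if 0 < (Jac P Q).evalEval q.1 q.2 then (1:ℝ) else -1 with hs
  have hsq : 0 < s * (Jac P Q).evalEval q.1 q.2 := by
    rw [hs]; split_ifs with h
    · linarith
    · have := lt_of_le_of_ne (not_lt.1 h) hJ; linarith
  have hs1 : s * s = 1 := by rw [hs]; split_ifs <;> norm_num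
  set V : Set (ℝ × ℝ) := {p | 0 < s * (Jac P Q).evalEval p.1 p.2} with hV
  have hVo : IsOpen V := isOpen_lt continuous_const (continuous_const.mul (ev_cont _))
  set U := e.source ∩ (W ∩ V) with hU
  have hUo : IsOpen U := e.open_source.inter (hW.inter hVo)
  have hqU : q ∈ U := ⟨hstrict.mem_toOpenPartialHomeomorph_source, hq, hsq⟩
  have himo : IsOpen (φ '' U) := by
    rw [← hecoe]
    exact e.isOpen_image_of_subset_source hUo inter_subset_left
  have h0 : (0, 0) ∈ φ '' U := ⟨q, hqU, by simp [hφ, hP, hQ]⟩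
  obtain ⟨ε, hε, hball⟩ := Metric.isOpen_iff.1 himo _ h0
  refine ⟨U, fun p hp => hp.2.1, hUo, hqU, ε, hε, fun b hb => ?_⟩
  have hinj : InjOn φ U := by
    rw [← hecoe]
    exact e.injOn.mono inter_subset_left
  have hcv := integral_image_eq_integral_abs_det_fderiv_smul volume hUo.measurableSet
    (fun p hp => (hasFD_PQ P Q p).hasFDerivAt.hasFDerivWithinAt (s := U)) hinj (fun z : ℝ × ℝ => b z.1 * b z.2)
  have hlhs : ∫ z in φ '' U, b z.1 * b z.2 = (∫ u, b u)^2 := by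
    rw [setIntegral_eq_integral_of_forall_compl_eq_zero]
    · rw [Measure.volume_eq_prod, integral_prod_mul, sq]
    · intro z hz
      have : z ∉ Metric.ball ((0:ℝ),(0:ℝ)) ε := fun h => hz (hball h)
      rw [Metric.mem_ball, Prod.dist_eq, not_lt, le_max_iff] at this
      rcases this with h | h
      · rw [hb z.1 (by simpa [Real.dist_eq] using h), zero_mul]
      · rw [hb z.2 (by simpa [Real.dist_eq] using h), mul_zero]
  rw [← hlhs, hcv, ← integral_const_mul]
  refine setIntegral_congr_fun hUo.measurableSet fun p hp => ?_
  have hp2 : 0 < s * (Jac P Q).evalEval p.1 p.2 := hp.2.2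
  have habs : |(Jac P Q).evalEval p.1 p.2| = s * (Jac P Q).evalEval p.1 p.2 := by
    have : |s * (Jac P Q).evalEval p.1 p.2| = s * (Jac P Q).evalEval p.1 p.2 := abs_of_pos hp2
    rw [abs_mul] at this
    have hsa : |s| = 1 := by rw [hs]; split_ifs <;> norm_num
    rwa [hsa, one_mul] at this
  simp only [dPQ_det, habs, smul_eq_mul]
  linear_combination (-(b (P.evalEval p.1 p.2) * b (Q.evalEval p.1 p.2) * (Jac P Q).evalEval p.1 p.2)) * hs1

lemma bdry_int (P Q : ℝ[X][Y]) {x1 x2 y1 y2 ε : ℝ} (hx : x1 < x2) (hy : y1 < y2)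
    (htop : ∀ x ∈ Icc x1 x2, ε ≤ Q.evalEval x y2) (hbot : ∀ x ∈ Icc x1 x2, Q.evalEval x y1 ≤ -ε)
    (hr : ∀ y ∈ Icc y1 y2, |Q.evalEval x2 y| < ε → ε ≤ P.evalEval x2 y)
    (hl : ∀ y ∈ Icc y1 y2, |Q.evalEval x1 y| < ε → P.evalEval x1 y ≤ -ε) (hε : 0 < ε)
    {B b b' : ℝ → ℝ} (hB : ∀ u, HasDerivAt B (b u) u) (hb : ∀ u, HasDerivAt b (b' u) u)
    (hb' : Continuous b') (hB0 : ∀ u ≤ -ε, B u = 0) (hB1 : ∀ u ≥ ε, B u = 1) (hb0 : ∀ u, ε ≤ |u| → b u = 0) :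
    ∫ p in Icc x1 x2 ×ˢ Icc y1 y2, b (P.evalEval p.1 p.2) * b (Q.evalEval p.1 p.2) * (Jac P Q).evalEval p.1 p.2 = 1 := by
  have hBc : Continuous B := continuous_iff_continuousAt.2 fun u => (hB u).continuousAt
  have hbc : Continuous b := continuous_iff_continuousAt.2 fun u => (hb u).continuousAt
  have hPc := ev_cont P
  have hQc := ev_cont Q
  have hQyc := ev_cont (derivative Q)
  have hQxc := ev_cont (dX Q)
  have hJc := ev_cont (Jac P Q)
  set G1 : ℝ × ℝ → ℝ := fun p => B (P.evalEval p.1 p.2) * b (Q.evalEval p.1 p.2) * (derivative Q).evalEval p.1 p.2 with hG1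
  set G2 : ℝ × ℝ → ℝ := fun p => B (P.evalEval p.1 p.2) * b (Q.evalEval p.1 p.2) * (-(dX Q).evalEval p.1 p.2) with hG2
  have d1 : ∀ p : ℝ × ℝ, ∃ D : ℝ × ℝ →L[ℝ] ℝ, HasFDerivAt G1 D p ∧ D (1,0) =
      b (P.evalEval p.1 p.2) * (dX P).evalEval p.1 p.2 * b (Q.evalEval p.1 p.2) * (derivative Q).evalEval p.1 p.2
      + B (P.evalEval p.1 p.2) * (b' (Q.evalEval p.1 p.2) * (dX Q).evalEval p.1 p.2) * (derivative Q).evalEval p.1 p.2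
      + B (P.evalEval p.1 p.2) * b (Q.evalEval p.1 p.2) * (dX (derivative Q)).evalEval p.1 p.2 := by
    intro p
    have e1 := (hB (P.evalEval p.1 p.2)).comp_hasFDerivAt p (hasFD P p).hasFDerivAt
    have e2 := (hb (Q.evalEval p.1 p.2)).comp_hasFDerivAt p (hasFD Q p).hasFDerivAt
    have e3 := (e1.mul e2).mul (hasFD (derivative Q) p).hasFDerivAt
    refine ⟨_, e3, ?_⟩
    simp
    ring
  have d2 : ∀ p : ℝ × ℝ, ∃ D : ℝ × ℝ →L[ℝ] ℝ, HasFDerivAt G2 D p ∧ D (0,1) =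
      -(b (P.evalEval p.1 p.2) * (derivative P).evalEval p.1 p.2 * b (Q.evalEval p.1 p.2) * (dX Q).evalEval p.1 p.2
      + B (P.evalEval p.1 p.2) * (b' (Q.evalEval p.1 p.2) * (derivative Q).evalEval p.1 p.2) * (dX Q).evalEval p.1 p.2
      + B (P.evalEval p.1 p.2) * b (Q.evalEval p.1 p.2) * (dX (derivative Q)).evalEval p.1 p.2) := by
    intro p
    have e1 := (hB (P.evalEval p.1 p.2)).comp_hasFDerivAt p (hasFD P p).hasFDerivAt
    have e2 := (hb (Q.evalEval p.1 p.2)).comp_hasFDerivAt p (hasFD Q p).hasFDerivAt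
    have e3 := (e1.mul e2).mul (hasFD (dX Q) p).hasFDerivAt.neg
    refine ⟨_, e3, ?_⟩
    simp [dX_dY]
    ring
  choose D1 hD1 hD1v using d1
  choose D2 hD2 hD2v using d2
  have hdiv : ∀ p : ℝ × ℝ, D1 p (1,0) + D2 p (0,1) = b (P.evalEval p.1 p.2) * b (Q.evalEval p.1 p.2) * (Jac P Q).evalEval p.1 p.2 := by
    intro p
    rw [hD1v, hD2v, Jac, evalEval_sub, evalEval_mul, evalEval_mul]; ring
  have hG1c : Continuous G1 := ((hBc.comp hPc).mul (hbc.comp hQc)).mul hQyc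
  have hG2c : Continuous G2 := ((hBc.comp hPc).mul (hbc.comp hQc)).mul hQxc.neg
  have hgc : Continuous fun p : ℝ × ℝ => b (P.evalEval p.1 p.2) * b (Q.evalEval p.1 p.2) * (Jac P Q).evalEval p.1 p.2 :=
    ((hbc.comp hPc).mul (hbc.comp hQc)).mul hJc
  have hmain := integral_divergence_prod_Icc_of_hasFDerivAt_of_le G1 G2 D1 D2 (x1, y1) (x2, y2)
    ⟨hx.le, hy.le⟩ hG1c.continuousOn hG2c.continuousOn (fun p _ => hD1 p) (fun p _ => hD2 p)
    (by simp only [hdiv]; exact hgc.continuousOn.integrableOn_compact isCompact_Icc)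
  simp only [hdiv] at hmain
  rw [Icc_prod_Icc, hmain]
  have t1 : ∫ x in x1..x2, G2 (x, y2) = 0 := by
    rw [intervalIntegral.integral_congr (g := fun _ => 0)]
    · simp
    · intro x hx'
      rw [uIcc_of_le hx.le] at hx'
      simp only [hG2]
      rw [hb0 (Q.evalEval x y2) (le_trans (htop x hx') (le_abs_self _))]; ring
  have t2 : ∫ x in x1..x2, G2 (x, y1) = 0 := by
    rw [intervalIntegral.integral_congr (g := fun _ => 0)]
    · simp
    · intro x hx'
      rw [uIcc_of_le hx.le] at hx'
      simp only [hG2]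
      rw [hb0 (Q.evalEval x y1) (by rw [le_abs]; right; linarith [hbot x hx'])]; ring
  have t4 : ∫ y in y1..y2, G1 (x1, y) = 0 := by
    rw [intervalIntegral.integral_congr (g := fun _ => 0)]
    · simp
    · intro y hy'
      rw [uIcc_of_le hy.le] at hy'
      simp only [hG1]
      by_cases h : |Q.evalEval x1 y| < ε
      · rw [hB0 _ (hl y hy' h)]; ring
      · rw [hb0 _ (not_lt.1 h)]; ring
  have t3 : ∫ y in y1..y2, G1 (x2, y) = 1 := by
    rw [intervalIntegral.integral_congr (g := fun y => b (Q.evalEval x2 y) * (derivative Q).evalEval x2 y)]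
    · have hder : ∀ y ∈ uIcc y1 y2, HasDerivAt (fun y => B (Q.evalEval x2 y)) (b (Q.evalEval x2 y) * (derivative Q).evalEval x2 y) y := by
        intro y _
        exact (hB (Q.evalEval x2 y)).comp y (ev_hasDerivY Q x2 y)
      rw [intervalIntegral.integral_eq_sub_of_hasDerivAt hder]
      · rw [hB1 _ (htop x2 ⟨hx.le, le_rfl⟩), hB0 _ (hbot x2 ⟨hx.le, le_rfl⟩), sub_zero]
      · apply Continuous.intervalIntegrable
        exact (hbc.comp (hQc.comp (Continuous.prodMk_right x2))).mul (hQyc.comp (Continuous.prodMk_right x2))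
    · intro y hy'
      rw [uIcc_of_le hy.le] at hy'
      simp only [hG1]
      by_cases h : |Q.evalEval x2 y| < ε
      · rw [hB1 _ (hr y hy' h), one_mul]
      · rw [hb0 _ (not_lt.1 h)]; ring
  simp only [t1, t2, t3, t4]; norm_num

lemma bump_int {ε : ℝ} (hε : 0 < ε) {B b b' : ℝ → ℝ} (hB : ∀ u, HasDerivAt B (b u) u) (hb : ∀ u, HasDerivAt b (b' u) u)
    (hB0 : ∀ u ≤ -ε, B u = 0) (hB1 : ∀ u ≥ ε, B u = 1) (hb0 : ∀ u, ε ≤ |u| → b u = 0) : ∫ u, b u = 1 := by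
  have hbc : Continuous b := continuous_iff_continuousAt.2 fun u => (hb u).continuousAt
  have h1 : ∫ u in (-ε)..ε, b u = 1 := by
    rw [intervalIntegral.integral_eq_sub_of_hasDerivAt (fun u _ => hB u) (hbc.intervalIntegrable _ _), hB1 ε le_rfl, hB0 _ le_rfl, sub_zero]
  rw [intervalIntegral.integral_of_le (by linarith)] at h1
  rw [← h1, setIntegral_eq_integral_of_forall_compl_eq_zero]
  intro u hu
  apply hb0
  by_contra hlt
  rw [not_le, abs_lt] at hlt
  exact hu ⟨hlt.1, hlt.2.le⟩

theorem box_degree (P Q : ℝ[X][Y]) {x1 x2 y1 y2 : ℝ} (hx : x1 < x2) (hy : y1 < y2)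
    (htop : ∀ x ∈ Icc x1 x2, 0 < Q.evalEval x y2) (hbot : ∀ x ∈ Icc x1 x2, Q.evalEval x y1 < 0)
    (hr : ∀ y ∈ Icc y1 y2, Q.evalEval x2 y = 0 → 0 < P.evalEval x2 y)
    (hl : ∀ y ∈ Icc y1 y2, Q.evalEval x1 y = 0 → P.evalEval x1 y < 0)
    (S : Finset (ℝ × ℝ)) (hS : ∀ q, q ∈ S ↔ q ∈ Icc x1 x2 ×ˢ Icc y1 y2 ∧ P.evalEval q.1 q.2 = 0 ∧ Q.evalEval q.1 q.2 = 0)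
    (hJ : ∀ q ∈ S, (Jac P Q).evalEval q.1 q.2 ≠ 0) :
    ∑ q ∈ S, (if 0 < (Jac P Q).evalEval q.1 q.2 then (1:ℝ) else -1) = 1 := by
  classical
  have hPc := ev_cont P
  have hQc := ev_cont Q
  have hinIoo : ∀ q ∈ S, q ∈ Ioo x1 x2 ×ˢ Ioo y1 y2 := by
    intro q hq
    obtain ⟨⟨⟨a1, a2⟩, ⟨a3, a4⟩⟩, h1, h2⟩ := (hS q).1 hq
    refine ⟨⟨lt_of_le_of_ne a1 ?_, lt_of_le_of_ne a2 ?_⟩, ⟨lt_of_le_of_ne a3 ?_, lt_of_le_of_ne a4 ?_⟩⟩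
    · intro h; have := hl q.2 ⟨a3, a4⟩ (by rw [h]; exact h2); rw [h] at this; linarith
    · intro h; have := hr q.2 ⟨a3, a4⟩ (by rw [← h]; exact h2); rw [← h] at this; linarith
    · intro h; have := hbot q.1 ⟨a1, a2⟩; rw [h] at this; linarith
    · intro h; have := htop q.1 ⟨a1, a2⟩; rw [← h] at this; linarith
  obtain ⟨W, hWm, hWd⟩ := S.finite_toSet.t2_separation
  have hloc : ∀ q : ℝ × ℝ, ∃ U : Set (ℝ × ℝ), ∃ ε : ℝ, q ∈ S → U ⊆ W q ∩ Ioo x1 x2 ×ˢ Ioo y1 y2 ∧ IsOpen U ∧ q ∈ U ∧ ε > 0 ∧ ∀ b : ℝ → ℝ, (∀ u, ε ≤ |u| → b u = 0) →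
      ∫ p in U, b (P.evalEval p.1 p.2) * b (Q.evalEval p.1 p.2) * (Jac P Q).evalEval p.1 p.2
        = (if 0 < (Jac P Q).evalEval q.1 q.2 then (1:ℝ) else -1) * (∫ u, b u)^2 := by
    intro q
    by_cases hq : q ∈ S
    · obtain ⟨_, h1, h2⟩ := (hS q).1 hq
      obtain ⟨U, k1, k2, k3, ε, k4, k5⟩ := local_int P Q q h1 h2 (hJ q hq) (W q ∩ Ioo x1 x2 ×ˢ Ioo y1 y2)
        ((hWm q).2.inter (isOpen_Ioo.prod isOpen_Ioo)) ⟨(hWm q).1, hinIoo q hq⟩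
      exact ⟨U, ε, fun _ => ⟨k1, k2, k3, k4, k5⟩⟩
    · exact ⟨∅, 0, fun h => absurd h hq⟩
  choose U εU hU using hloc
  -- the choice of epsilon
  obtain ⟨ε1, hε1, h1⟩ := exists_pos_le (isCompact_Icc (a := x1) (b := x2)) (g := fun x => Q.evalEval x y2)
    (hQc.comp (Continuous.prodMk_left y2)).continuousOn htop
  obtain ⟨ε2, hε2, h2⟩ := exists_pos_le (isCompact_Icc (a := x1) (b := x2)) (g := fun x => -Q.evalEval x y1)
    (hQc.comp (Continuous.prodMk_left y1)).neg.continuousOn (fun x hx => by linarith [hbot x hx])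
  obtain ⟨ε3, hε3, h3⟩ := exists_pos_le (isCompact_Icc (a := y1) (b := y2)) (g := fun y => max |Q.evalEval x2 y| (P.evalEval x2 y))
    (((hQc.comp (Continuous.prodMk_right x2)).abs).max (hPc.comp (Continuous.prodMk_right x2))).continuousOn
    (fun y hy => by
      rw [lt_max_iff]
      by_cases h : Q.evalEval x2 y = 0
      · exact Or.inr (hr y hy h)
      · exact Or.inl (abs_pos.2 h))
  obtain ⟨ε4, hε4, h4⟩ := exists_pos_le (isCompact_Icc (a := y1) (b := y2)) (g := fun y => max |Q.evalEval x1 y| (-P.evalEval x1 y))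
    (((hQc.comp (Continuous.prodMk_right x1)).abs).max (hPc.comp (Continuous.prodMk_right x1)).neg).continuousOn
    (fun y hy => by
      rw [lt_max_iff]
      by_cases h : Q.evalEval x1 y = 0
      · exact Or.inr (by linarith [hl y hy h])
      · exact Or.inl (abs_pos.2 h))
  have hcomp : IsCompact ((Icc x1 x2 ×ˢ Icc y1 y2) \ ⋃ q ∈ S, U q) :=
    (isCompact_Icc.prod isCompact_Icc).diff (isOpen_biUnion fun q hq => (hU q hq).2.1)
  obtain ⟨ε5, hε5, h5⟩ := exists_pos_le hcomp (g := fun p => max |P.evalEval p.1 p.2| |Q.evalEval p.1 p.2|)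
    ((hPc.abs).max hQc.abs).continuousOn (fun p hp => by
      by_contra hneg
      rw [not_lt, max_le_iff] at hneg
      have e1 := abs_nonpos_iff.1 hneg.1
      have e2 := abs_nonpos_iff.1 hneg.2
      have hpS := (hS p).2 ⟨hp.1, e1, e2⟩
      exact hp.2 (mem_biUnion hpS (hU p hpS).2.2.1))
  obtain ⟨ε6, hε6, h6⟩ : ∃ ε > 0, ∀ q ∈ S, ε ≤ εU q := by
    have := exists_pos_le (α := S) (K := Set.univ) (Set.finite_univ.isCompact) (g := fun q => εU q.1)
      (continuous_of_discreteTopology.continuousOn) (fun q _ => (hU q.1 q.2).2.2.2.1)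
    obtain ⟨ε, hε, h⟩ := this
    exact ⟨ε, hε, fun q hq => h ⟨q, hq⟩ trivial⟩
  set ε := min (min (min ε1 ε2) (min ε3 ε4)) (min ε5 ε6) with hεdef
  have hε : 0 < ε := by simp only [hεdef, lt_min_iff]; exact ⟨⟨⟨hε1, hε2⟩, hε3, hε4⟩, hε5, hε6⟩
  have l1 : ε ≤ ε1 := le_trans (min_le_left _ _) (le_trans (min_le_left _ _) (min_le_left _ _))
  have l2 : ε ≤ ε2 := le_trans (min_le_left _ _) (le_trans (min_le_left _ _) (min_le_right _ _))
  have l3 : ε ≤ ε3 := le_trans (min_le_left _ _) (le_trans (min_le_right _ _) (min_le_left _ _))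
  have l4 : ε ≤ ε4 := le_trans (min_le_left _ _) (le_trans (min_le_right _ _) (min_le_right _ _))
  have l5 : ε ≤ ε5 := le_trans (min_le_right _ _) (min_le_left _ _)
  have l6 : ε ≤ ε6 := le_trans (min_le_right _ _) (min_le_right _ _)
  obtain ⟨B, b, b', hB, hb, hb', hB0, hB1, hb0⟩ := exists_bump hε
  have hone := bdry_int P Q hx hy (fun x hx => l1.trans (h1 x hx)) (fun x hx => by have := h2 x hx; linarith)
    (fun y hy h => by
      rcases le_max_iff.1 (h3 y hy) with h' | h'
      · linarith
      · linarith)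
    (fun y hy h => by
      rcases le_max_iff.1 (h4 y hy) with h' | h'
      · linarith
      · linarith) hε hB hb hb' hB0 hB1 hb0
  have hbc : Continuous b := continuous_iff_continuousAt.2 fun u => (hb u).continuousAt
  have hgc : Continuous fun p : ℝ × ℝ => b (P.evalEval p.1 p.2) * b (Q.evalEval p.1 p.2) * (Jac P Q).evalEval p.1 p.2 :=
    ((hbc.comp hPc).mul (hbc.comp hQc)).mul (ev_cont _)
  have hsubB : ∀ q ∈ S, U q ⊆ Icc x1 x2 ×ˢ Icc y1 y2 := fun q hq p hp =>
    ⟨Ioo_subset_Icc_self ((hU q hq).1 hp).2.1, Ioo_subset_Icc_self ((hU q hq).1 hp).2.2⟩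
  have hsub : (⋃ q ∈ S, U q) ⊆ Icc x1 x2 ×ˢ Icc y1 y2 := iUnion₂_subset hsubB
  have hio : IntegrableOn (fun p : ℝ × ℝ => b (P.evalEval p.1 p.2) * b (Q.evalEval p.1 p.2) * (Jac P Q).evalEval p.1 p.2)
      (Icc x1 x2 ×ˢ Icc y1 y2) := hgc.continuousOn.integrableOn_compact (isCompact_Icc.prod isCompact_Icc)
  rw [setIntegral_eq_of_subset_of_forall_sdiff_eq_zero (measurableSet_Icc.prod measurableSet_Icc) hsub, integral_biUnion_finset] at hone
  · refine Eq.trans ?_ hone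
    refine Finset.sum_congr rfl fun q hq => ?_
    rw [(hU q hq).2.2.2.2 b (fun u hu => hb0 u (l6.trans ((h6 q hq).trans hu))), bump_int hε hB hb hB0 hB1 hb0]
    ring
  · exact fun q hq => (hU q hq).2.1.measurableSet
  · intro q hq q' hq' hne
    exact (hWd hq hq' hne).mono (fun p hp => ((hU q hq).1 hp).1) (fun p hp => ((hU q' hq').1 hp).1)
  · exact fun q hq => hio.mono_set (hsubB q hq)
  · intro p hp
    rcases le_max_iff.1 (l5.trans (h5 p hp)) with h | h
    · rw [hb0 _ h]; ring
    · rw [hb0 _ h]; ring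

end Petro

set_option autoImplicit false
set_option linter.all false

namespace Petro
open Polynomial
open scoped Polynomial.Bivariate

lemma bezout_elim {K : Type*} [Field K] {p g : K[X][Y]} (hp : Irreducible p) (hd : p.natDegree ≠ 0) (hg : ¬ p ∣ g) :
    ∃ (u w : K[X][Y]) (D : K[X]), D ≠ 0 ∧ u * p + w * g = C D := by
  classical
  have hprim : p.IsPrimitive := hp.isPrimitive hd
  let F := FractionRing K[X]
  have hirr : Irreducible (p.map (algebraMap K[X] F)) :=
    (hprim.irreducible_iff_irreducible_map_fraction_map (K := F)).1 hp
  have hnd : ¬ p.map (algebraMap K[X] F) ∣ g.map (algebraMap K[X] F) := by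
    intro h
    by_cases hg0 : g = 0
    · exact hg (hg0 ▸ dvd_zero _)
    have h2 : p.map (algebraMap K[X] F) ∣ (g.primPart).map (algebraMap K[X] F) := by
      rw [g.eq_C_content_mul_primPart, Polynomial.map_mul, map_C] at h
      have hu : IsUnit (C ((algebraMap K[X] F) g.content)) := by
        rw [isUnit_C, isUnit_iff_ne_zero]
        simpa [content_eq_zero_iff] using hg0
      exact (hu.dvd_mul_left).1 h
    have h3 := (hprim.dvd_iff_fraction_map_dvd_fraction_map F).2 h2
    exact hg (h3.trans g.primPart_dvd)
  obtain ⟨u, w, huw⟩ := (hirr.coprime_iff_not_dvd).2 hnd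
  obtain ⟨d, hd⟩ := IsLocalization.integerNormalization_map_to_map (nonZeroDivisors K[X]) u
  obtain ⟨e, he⟩ := IsLocalization.integerNormalization_map_to_map (nonZeroDivisors K[X]) w
  refine ⟨C (e : K[X]) * IsLocalization.integerNormalization (nonZeroDivisors K[X]) u,
    C (d : K[X]) * IsLocalization.integerNormalization (nonZeroDivisors K[X]) w, e * d, ?_, ?_⟩
  · exact mul_ne_zero (nonZeroDivisors.ne_zero e.2) (nonZeroDivisors.ne_zero d.2)
  · apply Polynomial.map_injective _ (IsFractionRing.injective K[X] F)
    have hsm : ∀ (m : K[X]) (q : F[X]), m • q = C (algebraMap K[X] F m) * q := by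
      intro m q
      ext n
      simp [Algebra.smul_def]
    rw [hsm] at hd he
    simp only [Polynomial.map_add, Polynomial.map_mul, hd, he, map_C, map_mul]
    linear_combination (C ((algebraMap K[X] F) e) * C ((algebraMap K[X] F) d)) * huw

lemma bad_set (g : ℝ[X][Y]) : ∀ h : ℝ[X][Y], h ≠ 0 → ∃ B : Set ℝ, B.Finite ∧ ∀ x, x ∉ B → ∀ y, h.evalEval x y = 0 →
    ∃ s, s ∣ h ∧ s.evalEval x y = 0 ∧ (derivative s).evalEval x y ≠ 0 ∧ (g.evalEval x y ≠ 0 ∨ s ∣ g) := by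
  classical
  intro h
  induction h using UniqueFactorizationMonoid.induction_on_prime with
  | h₁ => exact fun h => absurd rfl h
  | h₂ u hu =>
    intro _
    refine ⟨∅, Set.finite_empty, fun x _ y h0 => ?_⟩
    have := hu.map (evalEvalRingHom x y)
    rw [isUnit_iff_ne_zero] at this
    exact absurd h0 this
  | h₃ a p ha hp ih =>
    intro _
    obtain ⟨B, hB, hBs⟩ := ih ha
    have key : ∃ B : Set ℝ, B.Finite ∧ ∀ x, x ∉ B → ∀ y, p.evalEval x y = 0 →
      (derivative p).evalEval x y ≠ 0 ∧ (g.evalEval x y ≠ 0 ∨ p ∣ g) := by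
      by_cases hd : p.natDegree = 0
      · rw [natDegree_eq_zero] at hd
        obtain ⟨q, rfl⟩ := hd
        have hq : q ≠ 0 := by rintro rfl; simpa using hp.ne_zero
        refine ⟨{x | q.eval x = 0}, ?_, fun x hx y h0 => ?_⟩
        · exact (q.roots.toFinset.finite_toSet).subset (fun x hx => by simpa [hq] using hx)
        · exact absurd (by simpa [evalEval_C] using h0) hx
      · have aux : ∀ r : ℝ[X][Y], ¬ p ∣ r → ∃ B : Set ℝ, B.Finite ∧ ∀ x, x ∉ B → ∀ y, p.evalEval x y = 0 →
            r.evalEval x y ≠ 0 := by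
          intro r hr
          obtain ⟨u, w, D, hD, h⟩ := bezout_elim hp.irreducible hd hr
          refine ⟨{x | D.eval x = 0}, (D.roots.toFinset.finite_toSet).subset (fun x hx => by simpa [hD] using hx), fun x hx y h0 h1 => hx ?_⟩
          have := congrArg (evalEval x y) h
          simpa [h0, h1, evalEval_C] using this.symm
        have hpd : ¬ p ∣ derivative p := by
          intro h
          have h1 : derivative p ≠ 0 := by
            intro h0
            exact hd (natDegree_eq_zero_of_derivative_eq_zero h0)
          have := natDegree_le_of_dvd h h1
          have := natDegree_derivative_lt hd
          omega
        obtain ⟨B1, hB1, h1⟩ := aux _ hpd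
        by_cases hg : p ∣ g
        · exact ⟨B1, hB1, fun x hx y h0 => ⟨h1 x hx y h0, Or.inr hg⟩⟩
        · obtain ⟨B2, hB2, h2⟩ := aux _ hg
          exact ⟨B1 ∪ B2, hB1.union hB2, fun x hx y h0 => ⟨h1 x (fun h => hx (Or.inl h)) y h0, Or.inl (h2 x (fun h => hx (Or.inr h)) y h0)⟩⟩
    obtain ⟨B', hB', hB's⟩ := key
    refine ⟨B ∪ B', hB.union hB', fun x hx y h0 => ?_⟩
    rw [evalEval_mul, mul_eq_zero] at h0
    rcases h0 with h0 | h0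
    · obtain ⟨h1, h2⟩ := hB's x (fun h => hx (Or.inr h)) y h0
      exact ⟨p, dvd_mul_right _ _, h0, h1, h2⟩
    · obtain ⟨s, hs, h1⟩ := hBs x (fun h => hx (Or.inl h)) y h0
      exact ⟨s, hs.trans (dvd_mul_left _ _), h1⟩

end Petro

set_option autoImplicit false
set_option linter.all false

namespace Petro
open Polynomial Filter Topology Set
open scoped Polynomial.Bivariate

lemma local_branch (s f : ℝ[X][Y]) (x' y' : ℝ) (hs : s.evalEval x' y' = 0) (hsy : (derivative s).evalEval x' y' ≠ 0)
    (hd : s ∣ derivative f) (hx : (dX f).evalEval x' y' < 0 ∨ s ∣ dX f) (ε : ℝ) (hε : 0 < ε) :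
    ∀ᶠ x in 𝓝[<] x', ∃ y, |y - y'| < ε ∧ (derivative f).evalEval x y = 0 ∧ (dX f).evalEval x y ≤ 0 ∧
      f.evalEval x' y' ≤ f.evalEval x y := by
  have dfu := hasFD s (x', y')
  have hinv : (((dX s).evalEval x' y' • ContinuousLinearMap.fst ℝ ℝ ℝ + (derivative s).evalEval x' y' • ContinuousLinearMap.snd ℝ ℝ ℝ) ∘L
      .inr ℝ ℝ ℝ).IsInvertible := by
    refine ⟨ContinuousLinearEquiv.unitsEquivAut ℝ (Units.mk0 _ hsy), ?_⟩
    ext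
    simp
  set ψ := dfu.implicitFunctionOfProdDomain hinv with hψ
  have hev : ∀ᶠ x in 𝓝 x', s.evalEval x (ψ x) = 0 := by
    have := dfu.eventually_apply_implicitFunctionOfProdDomain hinv
    filter_upwards [this] with x hx
    rw [← hs]; exact hx
  have hψ0 : ψ x' = y' := (dfu.eventually_apply_eq_iff_implicitFunctionOfProdDomain hinv).self_of_nhds.mp rfl
  have hψt : Tendsto ψ (𝓝 x') (𝓝 y') := dfu.tendsto_implicitFunctionOfProdDomain hinv
  have hψd := dfu.hasStrictFDerivAt_implicitFunctionOfProdDomain hinv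
  have hdvd : ∀ g : ℝ[X][Y], s ∣ g → ∀ x y, s.evalEval x y = 0 → g.evalEval x y = 0 := by
    rintro g ⟨c, rfl⟩ x y h
    rw [evalEval_mul, h, zero_mul]
  have hclose : ∀ᶠ x in 𝓝 x', |ψ x - y'| < ε := by
    have := hψt.eventually (Metric.ball_mem_nhds y' hε)
    simpa [Real.dist_eq] using this
  have hγt : Tendsto (fun x => (x, ψ x)) (𝓝 x') (𝓝 (x', y')) := tendsto_id.prodMk_nhds hψt
  rcases hx with hx | hx
  · have hc : ∀ᶠ x in 𝓝 x', (dX f).evalEval x (ψ x) < 0 :=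
      (((ev_cont (dX f)).tendsto (x', y')).comp hγt).eventually (gt_mem_nhds hx)
    have hφ : HasDerivAt (fun x => f.evalEval x (ψ x)) ((dX f).evalEval x' y') x' := by
      have h1 : HasDerivAt (fun x => (x, ψ x)) (1, _) x' := (hasDerivAt_id x').prodMk hψd.hasFDerivAt.hasDerivAt
      have h2 := (hasFD f (x', ψ x')).hasFDerivAt.comp_hasDerivAt x' h1
      have h3 : (derivative f).evalEval x' y' = 0 := hdvd _ hd _ _ hs
      refine HasDerivAt.congr_deriv (f := fun x => f.evalEval x (ψ x)) h2 ?_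
      simp [h3, hψ0]
    have hsl := (hasDerivAt_iff_tendsto_slope.1 hφ).eventually (gt_mem_nhds hx)
    have hsl' := hsl.filter_mono (nhdsWithin_mono x' (fun x (hx : x < x') => ne_of_lt hx))
    filter_upwards [hsl', self_mem_nhdsWithin, nhdsWithin_le_nhds hev, nhdsWithin_le_nhds hc, nhdsWithin_le_nhds hclose] with x h1 h2 h3 h4 h5
    refine ⟨ψ x, h5, hdvd _ hd _ _ h3, h4.le, ?_⟩
    rw [slope_def_field, div_neg_iff] at h1
    rw [hψ0] at h1
    have h2' : x - x' < 0 := sub_neg.2 h2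
    rcases h1 with h1 | h1
    · linarith
    · linarith
  · obtain ⟨K, t, ht, hK⟩ := hψd.exists_lipschitzOnWith
    obtain ⟨r, hr, hball⟩ := Metric.mem_nhds_iff.1 (Filter.inter_mem ht hev)
    have hderiv : ∀ u ∈ Metric.ball x' r, HasDerivAt (fun x => f.evalEval x (ψ x)) 0 u := by
      intro u hu
      have hF := (hasFD f (u, ψ u)).hasFDerivAt.isLittleO
      have hsu : s.evalEval u (ψ u) = 0 := (hball hu).2
      have hz1 := hdvd _ hd _ _ hsu
      have hz2 := hdvd _ hx _ _ hsu
      have hO : (fun x => (x, ψ x) - (u, ψ u)) =O[𝓝 u] (fun x => x - u) := by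
        refine Asymptotics.IsBigO.prod_left (Asymptotics.isBigO_refl _ _) ?_
        refine Asymptotics.IsBigO.of_bound K ?_
        filter_upwards [Metric.isOpen_ball.mem_nhds hu] with v hv
        have := hK.dist_le_mul v (hball hv).1 u (hball hu).1
        simpa [dist_eq_norm] using this
      have hcont : Tendsto (fun x => (x, ψ x)) (𝓝 u) (𝓝 (u, ψ u)) := by
        have : Tendsto (fun x : ℝ => x - u) (𝓝 u) (𝓝 0) := by
          have : Continuous (fun x : ℝ => x - u) := by fun_prop
          simpa using this.tendsto u
        have := hO.trans_tendsto this
        simpa using this.add_const (u, ψ u)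
      have h := (hF.comp_tendsto hcont).trans_isBigO hO
      rw [hasDerivAt_iff_isLittleO]
      refine h.congr_left fun x => ?_
      simp [hz1, hz2]
    have hmem : Ioo (x' - r) x' ∈ 𝓝[<] x' := Ioo_mem_nhdsLT (by linarith)
    filter_upwards [hmem, nhdsWithin_le_nhds hclose] with x hx1 h5
    have hsub : Icc x x' ⊆ Metric.ball x' r := by
      intro z hz
      rw [Metric.mem_ball, Real.dist_eq, abs_lt]
      constructor <;> linarith [hz.1, hz.2, hx1.1]
    have hsx : s.evalEval x (ψ x) = 0 := (hball (hsub ⟨le_rfl, hx1.2.le⟩)).2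
    have hconst := constant_of_has_deriv_right_zero (f := fun x => f.evalEval x (ψ x)) (a := x) (b := x')
      (fun z hz => (hderiv z (hsub hz)).continuousAt.continuousWithinAt)
      (fun z hz => (hderiv z (hsub ⟨hz.1, hz.2.le⟩)).hasDerivWithinAt) x' ⟨hx1.2.le, le_rfl⟩
    refine ⟨ψ x, h5, hdvd _ hd _ _ hsx, (hdvd _ hx _ _ hsx).le, ?_⟩
    simp only [hψ0] at hconst
    exact hconst.le

lemma right_side (f : ℝ[X][Y]) (hfy : derivative f ≠ 0) (x0 x3 y1 y2 : ℝ) (hx : x0 < x3)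
    (h0 : ∀ y ∈ Icc y1 y2, (derivative f).evalEval x0 y = 0 → f.evalEval x0 y ≤ 0)
    (h1 : ∀ x ∈ Icc x0 x3, (derivative f).evalEval x y1 ≠ 0 ∧ (derivative f).evalEval x y2 ≠ 0)
    (h2 : ∀ x ∈ Ioc x0 x3, ∀ y ∈ Icc y1 y2, 0 < f.evalEval x y) :
    ∃ δ > 0, ∀ x, x0 < x → x ≤ x0 + δ → ∀ y ∈ Icc y1 y2, (derivative f).evalEval x y = 0 → 0 < (dX f).evalEval x y := by
  obtain ⟨B, hB, hBs⟩ := bad_set (dX f) (derivative f) hfy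
  have hev : ∀ᶠ x in 𝓝[>] x0, x ∉ B := by
    have : (B \ {x0})ᶜ ∈ 𝓝 x0 := (hB.diff).isClosed.isOpen_compl.mem_nhds (by simp)
    filter_upwards [nhdsWithin_le_nhds this, self_mem_nhdsWithin] with x hx hx' hxB
    exact hx ⟨hxB, ne_of_gt hx'⟩
  obtain ⟨u, hu, hus⟩ := mem_nhdsGT_iff_exists_Ioo_subset.1 hev
  have hu' : x0 < u := hu
  refine ⟨min (x3 - x0) ((u - x0) / 2), lt_min (by linarith) (by linarith), ?_⟩
  intro xa hxa hxa2 ya hya hya0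
  by_contra hneg
  rw [not_lt] at hneg
  have hxa3 : xa ≤ x3 := by linarith [min_le_left (x3 - x0) ((u - x0) / 2)]
  have hxau : xa < u := by linarith [min_le_right (x3 - x0) ((u - x0) / 2)]
  set m0 := f.evalEval xa ya with hm0
  have hm0p : 0 < m0 := h2 xa ⟨hxa, hxa3⟩ ya hya
  set T : Set (ℝ × ℝ) := (Icc x0 xa ×ˢ Icc y1 y2) ∩ {p | (derivative f).evalEval p.1 p.2 = 0 ∧ (dX f).evalEval p.1 p.2 ≤ 0 ∧ m0 ≤ f.evalEval p.1 p.2} with hT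
  have hTc : IsCompact T := by
    refine (isCompact_Icc.prod isCompact_Icc).inter_right ?_
    exact (isClosed_eq (ev_cont _) continuous_const).inter
      ((isClosed_le (ev_cont _) continuous_const).inter (isClosed_le continuous_const (ev_cont _)))
  have hTne : T.Nonempty := ⟨(xa, ya), ⟨⟨hxa.le, le_rfl⟩, hya⟩, hya0, hneg, le_rfl⟩
  obtain ⟨p, hpT, hpmin⟩ := hTc.exists_isMinOn hTne continuous_fst.continuousOn
  obtain ⟨⟨hp1, hp2⟩, hpd, hpx, hpm⟩ := hpT
  obtain ⟨x', y'⟩ := p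
  simp only at hp1 hp2 hpd hpx hpm
  rcases eq_or_lt_of_le hp1.1 with heq | hlt
  · subst heq
    have := h0 y' hp2 hpd
    linarith
  · have hx'3 : x' ≤ x3 := hp1.2.trans hxa3
    have hyo : y' ∈ Ioo y1 y2 := by
      have hb := h1 x' ⟨hp1.1, hx'3⟩
      refine ⟨lt_of_le_of_ne hp2.1 ?_, lt_of_le_of_ne hp2.2 ?_⟩
      · rintro rfl; exact hb.1 hpd
      · rintro rfl; exact hb.2 hpd
    obtain ⟨s, hs1, hs2, hs3, hs4⟩ := hBs x' (hus ⟨hlt, lt_of_le_of_lt hp1.2 hxau⟩) y' hpd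
    have hor : (dX f).evalEval x' y' < 0 ∨ s ∣ dX f := by
      rcases hs4 with h | h
      · exact Or.inl (lt_of_le_of_ne hpx h)
      · exact Or.inr h
    have hb := local_branch s f x' y' hs2 hs3 hs1 hor (min (y' - y1) (y2 - y')) (lt_min (by linarith [hyo.1]) (by linarith [hyo.2]))
    obtain ⟨x, ⟨y, hy1, hy2, hy3, hy4⟩, hxI⟩ := (hb.and (Ioo_mem_nhdsLT hlt)).exists
    rw [lt_min_iff, abs_lt, abs_lt] at hy1
    have : (x, y) ∈ T := ⟨⟨⟨hxI.1.le, by linarith [hxI.2, hp1.2]⟩, ⟨by linarith [hy1.1.1], by linarith [hy1.2.2]⟩⟩, hy2, hy3, hpm.trans hy4⟩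
    have := hpmin this
    simp only [mem_setOf_eq] at this
    linarith [hxI.2]

end Petro

set_option autoImplicit false
set_option linter.all false

namespace Petro
open Polynomial Filter Topology Set
open scoped Polynomial.Bivariate

/-- reflection `x ↦ -x` -/
noncomputable def refl (f : ℝ[X][Y]) : ℝ[X][Y] := f.map (compRingHom (-X))

lemma refl_eval (f : ℝ[X][Y]) (x y : ℝ) : (refl f).evalEval x y = f.evalEval (-x) y := by
  have h : (evalEvalRingHom x y).comp (mapRingHom (compRingHom (-X : ℝ[X]))) = evalEvalRingHom (-x) y := by
    apply Polynomial.ringHom_ext'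
    · apply Polynomial.ringHom_ext
      · intro r
        simp [evalEval_C]
      · simp [evalEval_C]
    · simp
  exact congrArg (fun φ => φ f) h

lemma refl_dY (f : ℝ[X][Y]) : derivative (refl f) = refl (derivative f) := by
  simp only [refl]; exact derivative_map f _

lemma refl_dX (f : ℝ[X][Y]) : dX (refl f) = - refl (dX f) := by
  ext1 j
  simp only [dX_coeff', refl, coeff_map, coeff_neg, coe_compRingHom_apply, derivative_comp]
  simp

lemma local_box (f : ℝ[X][Y]) (hf : ∀ x y, 0 ≤ f.evalEval x y) (hz : {q : ℝ × ℝ | f.evalEval q.1 q.2 = 0}.Finite)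
    (x0 y0 : ℝ) (h0 : f.evalEval x0 y0 = 0) (ε : ℝ) (hε : 0 < ε) :
    ∃ δ η, 0 < δ ∧ δ < ε ∧ 0 < η ∧ η < ε ∧
      (∀ x ∈ Icc (x0 - δ) (x0 + δ), 0 < (derivative f).evalEval x (y0 + η)) ∧
      (∀ x ∈ Icc (x0 - δ) (x0 + δ), (derivative f).evalEval x (y0 - η) < 0) ∧
      (∀ y ∈ Icc (y0 - η) (y0 + η), (derivative f).evalEval (x0 + δ) y = 0 → 0 < (dX f).evalEval (x0 + δ) y) ∧
      (∀ y ∈ Icc (y0 - η) (y0 + η), (derivative f).evalEval (x0 - δ) y = 0 → (dX f).evalEval (x0 - δ) y < 0) ∧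
      (∀ x ∈ Icc (x0 - δ) (x0 + δ), ∀ y ∈ Icc (y0 - η) (y0 + η), (dX f).evalEval x y = 0 → (derivative f).evalEval x y = 0 →
        f.evalEval x y = 0) := by
  classical
  -- only zero nearby
  obtain ⟨ε1, hε1, hone⟩ : ∃ ε1 > 0, ∀ x y, |x - x0| < ε1 → |y - y0| < ε1 → f.evalEval x y = 0 → x = x0 ∧ y = y0 := by
    have hop : ({q : ℝ × ℝ | f.evalEval q.1 q.2 = 0} \ {(x0, y0)})ᶜ ∈ 𝓝 (x0, y0) :=
      (hz.diff).isClosed.isOpen_compl.mem_nhds (by simp)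
    obtain ⟨r, hr, hb⟩ := Metric.mem_nhds_iff.1 hop
    refine ⟨r, hr, fun x y hx hy h => ?_⟩
    have hm : (x, y) ∈ Metric.ball (x0, y0) r := by
      rw [Metric.mem_ball, Prod.dist_eq, max_lt_iff]; exact ⟨hx, hy⟩
    by_contra hne
    exact hb hm ⟨h, by simpa using hne⟩
  -- restriction to vertical line
  set g : ℝ[X] := (derivative f).map (evalRingHom x0) with hg
  have hge : ∀ y, g.eval y = (derivative f).evalEval x0 y := by
    intro y
    rw [hg, map_evalRingHom_eval]
  have hdy : ∀ y, HasDerivAt (fun y => f.evalEval x0 y) ((derivative f).evalEval x0 y) y := fun y => ev_hasDerivY f x0 y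
  have hg0 : g ≠ 0 := by
    intro h
    have hder : ∀ y, (derivative f).evalEval x0 y = 0 := fun y => by rw [← hge, h]; simp
    have hconst : ∀ y, f.evalEval x0 y = 0 := by
      intro y
      rw [← h0]
      exact is_const_of_deriv_eq_zero (f := fun y => f.evalEval x0 y) (fun y => (hdy y).differentiableAt)
        (fun y => by rw [(hdy y).deriv, hder]) y y0
    have := (hone x0 (y0 + ε1 / 2) (by simpa using hε1) (by rw [add_sub_cancel_left, abs_of_pos] <;> linarith) (hconst _)).2
    linarith
  have hfy : derivative f ≠ 0 := by intro h; apply hg0; rw [hg, h]; simp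
  obtain ⟨ε2, hε2, hroot⟩ : ∃ ε2 > 0, ∀ y, |y - y0| < ε2 → (derivative f).evalEval x0 y = 0 → y = y0 := by
    have hop : ((g.roots.toFinset : Set ℝ) \ {y0})ᶜ ∈ 𝓝 y0 :=
      (g.roots.toFinset.finite_toSet.diff).isClosed.isOpen_compl.mem_nhds (by simp)
    obtain ⟨r, hr, hb⟩ := Metric.mem_nhds_iff.1 hop
    refine ⟨r, hr, fun y hy h => ?_⟩
    by_contra hne
    refine hb (show y ∈ Metric.ball y0 r from hy) ⟨?_, hne⟩
    simp [hg0, hge, h]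
  obtain ⟨η, hη, hη1⟩ : ∃ η > 0, η < min ε (min ε1 ε2) := exists_between (lt_min hε (lt_min hε1 hε2))
  simp only [lt_min_iff] at hη1
  obtain ⟨hηε, hη1, hη2⟩ := hη1
  have hcy : Continuous fun y => (derivative f).evalEval x0 y := (ev_cont (derivative f)).comp (Continuous.prodMk_right x0)
  have hne : ∀ y, y ≠ y0 → |y - y0| ≤ η → (derivative f).evalEval x0 y ≠ 0 := fun y hy h h' => hy (hroot y (by linarith) h')
  have hfpos : ∀ y, y ≠ y0 → |y - y0| ≤ η → 0 < f.evalEval x0 y := by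
    intro y hy h
    refine lt_of_le_of_ne (hf _ _) (fun h' => hy ?_)
    exact (hone x0 y (by simpa using hε1) (by linarith) h'.symm).2
  have htop0 : 0 < (derivative f).evalEval x0 (y0 + η) := by
    obtain ⟨ξ, hξ, he⟩ := exists_hasDerivAt_eq_slope (fun y => f.evalEval x0 y) (fun y => (derivative f).evalEval x0 y)
      (show y0 < y0 + η by linarith) (fun y _ => (hdy y).continuousAt.continuousWithinAt) (fun y _ => hdy y)
    have hp := hfpos (y0 + η) (by linarith) (by rw [add_sub_cancel_left, abs_of_pos hη])
    have hξ1 : 0 < (derivative f).evalEval x0 ξ := by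
      rw [he]; apply div_pos <;> linarith
    by_contra hn
    obtain ⟨c, hc, hc0⟩ := intermediate_value_Icc' (f := fun y => (derivative f).evalEval x0 y) hξ.2.le hcy.continuousOn
      (show (0:ℝ) ∈ _ from ⟨not_lt.1 hn, hξ1.le⟩)
    exact hne c (by linarith [hc.1, hξ.1]) (by rw [abs_le]; constructor <;> linarith [hc.1, hc.2, hξ.1]) hc0
  have hbot0 : (derivative f).evalEval x0 (y0 - η) < 0 := by
    obtain ⟨ξ, hξ, he⟩ := exists_hasDerivAt_eq_slope (fun y => f.evalEval x0 y) (fun y => (derivative f).evalEval x0 y)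
      (show y0 - η < y0 by linarith) (fun y _ => (hdy y).continuousAt.continuousWithinAt) (fun y _ => hdy y)
    have hp := hfpos (y0 - η) (by linarith) (by rw [abs_le]; constructor <;> linarith)
    have hξ1 : (derivative f).evalEval x0 ξ < 0 := by
      rw [he]; apply div_neg_of_neg_of_pos <;> linarith
    by_contra hn
    obtain ⟨c, hc, hc0⟩ := intermediate_value_Icc' (f := fun y => (derivative f).evalEval x0 y) hξ.1.le hcy.continuousOn
      (show (0:ℝ) ∈ _ from ⟨hξ1.le, not_lt.1 hn⟩)
    exact hne c (by linarith [hc.2, hξ.2]) (by rw [abs_le]; constructor <;> linarith [hc.1, hc.2, hξ.2]) hc0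
  have hcx : ∀ y, Continuous fun x => (derivative f).evalEval x y := fun y => (ev_cont (derivative f)).comp (Continuous.prodMk_left y)
  obtain ⟨r, hr, hrb⟩ := Metric.mem_nhds_iff.1 (Filter.inter_mem
    (((hcx (y0 + η)).tendsto x0).eventually (lt_mem_nhds htop0)) (((hcx (y0 - η)).tendsto x0).eventually (gt_mem_nhds hbot0)))
  obtain ⟨ρ, hρ, hρ1⟩ : ∃ ρ > 0, ρ < min ε (min ε1 r) := exists_between (lt_min hε (lt_min hε1 hr))
  simp only [lt_min_iff] at hρ1
  obtain ⟨hρε, hρ1, hρr⟩ := hρ1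
  have htb : ∀ x, |x - x0| ≤ ρ → 0 < (derivative f).evalEval x (y0 + η) ∧ (derivative f).evalEval x (y0 - η) < 0 :=
    fun x hx => hrb (show dist x x0 < r by rw [Real.dist_eq]; linarith)
  have hpos : ∀ x, x ≠ x0 → |x - x0| ≤ ρ → ∀ y ∈ Icc (y0 - η) (y0 + η), 0 < f.evalEval x y := by
    intro x hx h y hy
    refine lt_of_le_of_ne (hf _ _) (fun h' => hx ?_)
    refine (hone x y (by linarith) ?_ h'.symm).1
    rw [abs_lt]; constructor <;> linarith [hy.1, hy.2]
  have hcen : ∀ y ∈ Icc (y0 - η) (y0 + η), (derivative f).evalEval x0 y = 0 → f.evalEval x0 y ≤ 0 := by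
    intro y hy h
    have : y = y0 := hroot y (by rw [abs_lt]; constructor <;> linarith [hy.1, hy.2]) h
    rw [this, h0]
  obtain ⟨δ1, hδ1, hR⟩ := right_side f hfy x0 (x0 + ρ) (y0 - η) (y0 + η) (by linarith) hcen
    (fun x hx => by
      have := htb x (by rw [abs_le]; constructor <;> linarith [hx.1, hx.2])
      exact ⟨this.2.ne, this.1.ne'⟩)
    (fun x hx => hpos x (by linarith [hx.1]) (by rw [abs_le]; constructor <;> linarith [hx.1, hx.2]))
  have hfy' : derivative (refl f) ≠ 0 := by
    intro h
    apply hg0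
    apply Polynomial.funext
    intro y
    have h1 := congrArg (evalEval (-x0) y) h
    rw [refl_dY, refl_eval, neg_neg] at h1
    rw [hge, h1]; simp
  obtain ⟨δ2, hδ2, hL⟩ := right_side (refl f) hfy' (-x0) (-x0 + ρ) (y0 - η) (y0 + η) (by linarith)
    (fun y hy => by
      rw [refl_dY, refl_eval, refl_eval, neg_neg]; exact hcen y hy)
    (fun x hx => by
      rw [refl_dY, refl_eval, refl_eval]
      have := htb (-x) (by rw [abs_le]; constructor <;> linarith [hx.1, hx.2])
      exact ⟨this.2.ne, this.1.ne'⟩)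
    (fun x hx y hy => by
      rw [refl_eval]
      exact hpos (-x) (by linarith [hx.1]) (by rw [abs_le]; constructor <;> linarith [hx.1, hx.2]) y hy)
  obtain ⟨δ, hδ, hδ'⟩ : ∃ δ > 0, δ < min ρ (min δ1 δ2) := exists_between (lt_min hρ (lt_min hδ1 hδ2))
  simp only [lt_min_iff] at hδ'
  obtain ⟨hδρ, hδ1', hδ2'⟩ := hδ'
  refine ⟨δ, η, hδ, by linarith, hη, hηε, fun x hx => (htb x ?_).1, fun x hx => (htb x ?_).2, ?_, ?_, ?_⟩
  · rw [abs_le]; constructor <;> linarith [hx.1, hx.2]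
  · rw [abs_le]; constructor <;> linarith [hx.1, hx.2]
  · intro y hy h
    exact hR _ (by linarith) (by linarith) y hy h
  · intro y hy h
    have := hL (-x0 + δ) (by linarith) (by linarith) y hy (by
      rw [refl_dY, refl_eval, neg_add, neg_neg, ← sub_eq_add_neg]; exact h)
    rw [refl_dX, evalEval_neg, refl_eval, neg_add, neg_neg, ← sub_eq_add_neg] at this
    linarith
  · intro x hx y hy h1 h2
    rcases lt_trichotomy x x0 with h | h | h
    · have := hL (-x) (by linarith) (by linarith [hx.1]) y hy (by
        rw [refl_dY, refl_eval, neg_neg]; exact h2)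
      rw [refl_dX, evalEval_neg, refl_eval, neg_neg] at this
      linarith
    · subst h
      have : y = y0 := hroot y (by rw [abs_lt]; constructor <;> linarith [hy.1, hy.2]) h2
      rw [this, h0]
    · have := hR x h (by linarith [hx.2]) y hy h2
      linarith

end Petro

set_option autoImplicit false
set_option linter.all false

namespace Petro
open Polynomial Filter Topology Set
open scoped Polynomial.Bivariate

lemma x_fin {K : Type*} [Field K] {s g : K[X][Y]} (hs : Irreducible s) (hg : ¬ s ∣ g) :
    {x : K | ∃ y, s.evalEval x y = 0 ∧ g.evalEval x y = 0}.Finite := by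
  classical
  have aux : ∃ (u w : K[X][Y]) (D : K[X]), D ≠ 0 ∧ u * s + w * g = C D := by
    by_cases hd : s.natDegree = 0
    · rw [natDegree_eq_zero] at hd
      obtain ⟨q, rfl⟩ := hd
      refine ⟨1, 0, q, ?_, by simp⟩
      rintro rfl; exact hs.ne_zero (by simp)
    · exact bezout_elim hs hd hg
  obtain ⟨u, w, D, hD, h⟩ := aux
  refine (D.roots.toFinset.finite_toSet).subset ?_
  rintro x ⟨y, h0, h1⟩
  have := congrArg (evalEval x y) h
  simp only [evalEval_add, evalEval_mul, h0, h1, mul_zero, add_zero, evalEval_C] at this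
  simpa [hD] using this.symm

lemma common_fin {K : Type*} [Field K] {s g : K[X][Y]} (hs : Irreducible s) (hg : ¬ s ∣ g) :
    {q : K × K | s.evalEval q.1 q.2 = 0 ∧ g.evalEval q.1 q.2 = 0}.Finite := by
  have h1 := x_fin hs hg
  have hs' : Irreducible (Bivariate.swap s) := (MulEquiv.irreducible_iff (Bivariate.swap (R := K)).toMulEquiv).2 hs
  have hg' : ¬ Bivariate.swap s ∣ Bivariate.swap g := by
    intro h
    apply hg
    have := map_dvd (Bivariate.swap (R := K)) h
    rwa [Bivariate.swap_swap_apply, Bivariate.swap_swap_apply] at this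
  have h2 := x_fin hs' hg'
  refine (h1.prod h2).subset ?_
  rintro ⟨x, y⟩ ⟨e1, e2⟩
  refine ⟨⟨y, e1, e2⟩, ⟨x, ?_, ?_⟩⟩
  · rw [evalEval_swap]; exact e1
  · rw [evalEval_swap]; exact e2

lemma generic_ab {K : Type*} [Field K] (P Q : K[X][Y]) : ∀ J : K[X][Y], J ≠ 0 →
    ∃ A : Set K, A.Finite ∧ ∀ α, α ∉ A → ∃ B : Set K, B.Finite ∧ ∀ β, β ∉ B →
      ∀ q : K × K, J.evalEval q.1 q.2 = 0 → P.evalEval q.1 q.2 + α = 0 → Q.evalEval q.1 q.2 + β ≠ 0 := by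
  classical
  intro J
  induction J using UniqueFactorizationMonoid.induction_on_prime with
  | h₁ => exact fun h => absurd rfl h
  | h₂ u hu =>
    intro _
    refine ⟨∅, Set.finite_empty, fun _ _ => ⟨∅, Set.finite_empty, fun _ _ q h0 => ?_⟩⟩
    have := hu.map (evalEvalRingHom q.1 q.2)
    rw [isUnit_iff_ne_zero] at this
    exact absurd h0 this
  | h₃ a p ha hp ih =>
    intro _
    obtain ⟨A, hA, hAs⟩ := ih ha
    have hsub : {α : K | p ∣ P + C (C α)}.Subsingleton := by
      intro α h1 β h2
      by_contra hne
      have h3 : p ∣ C (C (α - β)) := by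
        have := dvd_sub h1 h2
        rwa [add_sub_add_left_eq_sub, ← C_sub, ← C_sub] at this
      refine hp.not_unit (isUnit_of_dvd_unit h3 ?_)
      rw [isUnit_C, isUnit_C, isUnit_iff_ne_zero]
      exact sub_ne_zero.2 hne
    refine ⟨A ∪ {α : K | p ∣ P + C (C α)}, hA.union hsub.finite, fun α hα => ?_⟩
    obtain ⟨B, hB, hBs⟩ := hAs α (fun h => hα (Or.inl h))
    have hf := common_fin hp.irreducible (fun h => hα (Or.inr h) : ¬ p ∣ P + C (C α))
    refine ⟨B ∪ (fun q : K × K => - Q.evalEval q.1 q.2) '' {q : K × K | p.evalEval q.1 q.2 = 0 ∧ (P + C (C α)).evalEval q.1 q.2 = 0},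
      hB.union (hf.image _), fun β hβ q h0 h1 h2 => ?_⟩
    rw [evalEval_mul, mul_eq_zero] at h0
    rcases h0 with h0 | h0
    · refine hβ (Or.inr ⟨q, ⟨h0, ?_⟩, ?_⟩)
      · simpa [evalEval_C] using h1
      · exact (eq_neg_of_add_eq_zero_right h2).symm
    · exact hBs β (fun h => hβ (Or.inl h)) q h0 h1 h2

lemma top_coeff {K : Type*} [Field K] {p q : K[X][Y]} {k l m n : ℕ} (hp : p ∈ Pol K (k+1) (l+1)) (hq : q ∈ Pol K (m+1) (n+1)) :
    ((p * q).coeff (l + n)).coeff (k + m) = (p.coeff l).coeff k * (q.coeff n).coeff m := by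
  rw [coeff_mul_add_eq_of_natDegree_le (Pol_natDegree hp) (Pol_natDegree hq),
    coeff_mul_add_eq_of_natDegree_le (Pol_coeff_natDegree hp _) (Pol_coeff_natDegree hq _)]

lemma JJ_ne_zero {a b : ℕ} (ha : 1 ≤ a) (hb : 1 ≤ b) {f : ℝ[X][Y]} (hf : f ∈ Pol ℝ (2*a+1) (2*b+1))
    (hl : (f.coeff (2*b)).coeff (2*a) ≠ 0) : JJ f ≠ 0 := by
  obtain ⟨a, rfl⟩ := Nat.exists_eq_add_of_le' ha
  obtain ⟨b, rfl⟩ := Nat.exists_eq_add_of_le' hb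
  set l := (f.coeff (2*(b+1))).coeff (2*(a+1)) with hldef
  intro h
  have h1 : dX (dX f) ∈ Pol ℝ (2*a+1) (2*b+2+1) := Pol_dX (Pol_dX hf)
  have h2 : derivative (derivative f) ∈ Pol ℝ (2*a+2+1) (2*b+1) := Pol_dY (Pol_dY hf)
  have h3 : derivative (dX f) ∈ Pol ℝ (2*a+1+1) (2*b+1+1) := Pol_dY (Pol_dX hf)
  have e1 := top_coeff h1 h2
  have e2 := top_coeff h3 h3
  have hc : ((JJ f).coeff (2*b+2+2*b)).coeff (2*a+(2*a+2)) = 0 := by rw [h]; simp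
  have i1 : 2*b+2+2*b = 2*b+1+(2*b+1) := by ring
  have i2 : 2*a+(2*a+2) = 2*a+1+(2*a+1) := by ring
  rw [JJ, Jac, dX_dY, coeff_sub, coeff_sub, e1, i1, i2, e2] at hc
  simp only [dX_coeff, dY_coeff] at hc
  have j1 : 2*b+2 = 2*(b+1) := by ring
  have j2 : 2*a+2 = 2*(a+1) := by ring
  have j3 : 2*b+1+1 = 2*(b+1) := by ring
  have j4 : 2*a+1+1 = 2*(a+1) := by ring
  simp only [j1, j2, j3, j4, ← hldef] at hc
  push_cast at hc
  have : l^2 * (4*(a+1)*(b+1)*(2*a+2*b+3)) = 0 := by linear_combination -hc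
  have hp : (0:ℝ) < 4*(a+1)*(b+1)*(2*a+2*b+3) := by positivity
  rcases mul_eq_zero.1 this with h | h
  · exact hl (pow_eq_zero_iff (two_ne_zero) |>.1 h)
  · exact hp.ne' h

lemma generic_s (c : ℂ[X]) (hc : derivative c ≠ 0) : ∃ A : Set ℂ, A.Finite ∧ ∀ s, s ∉ A →
    IsCoprime (c + C s) (derivative (c + C s)) := by
  classical
  refine ⟨(fun z => - c.eval z) '' ((derivative c).roots.toFinset : Set ℂ), (Finset.finite_toSet _).image _, fun s hs => ?_⟩
  rw [isCoprime_iff_aeval_ne_zero_of_isAlgClosed ℂ ℂ]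
  intro z
  by_contra h
  push Not at h
  apply hs
  simp only [derivative_add, derivative_C, add_zero, coe_aeval_eq_eval, eval_add, eval_C] at h
  refine ⟨z, ?_, ?_⟩
  · simp [hc, h.2]
  · exact (eq_neg_of_add_eq_zero_right h.1).symm

end Petro

set_option autoImplicit false
set_option linter.all false

namespace Petro
open Polynomial Filter Topology Set
open scoped Polynomial.Bivariate

lemma lead_ge (p : ℝ[X]) (n : ℕ) (hn : n ≠ 0) (hp : p.natDegree ≤ n) (κ : ℝ)
    (h : ∀ᶠ y in atTop, κ * y ^ n ≤ p.eval y) : κ ≤ p.coeff n := by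
  by_contra hlt
  push Not at hlt
  set g : ℝ[X] := p - C κ * X ^ n with hg
  have hgc : g.coeff n < 0 := by simp [hg]; linarith
  have hdn : g.natDegree ≤ n := by
    refine (natDegree_sub_le_of_le hp (natDegree_C_mul_X_pow_le _ _)).trans (by simp)
  have hnd : g.natDegree = n := le_antisymm hdn (le_natDegree_of_ne_zero hgc.ne)
  have ht := g.tendsto_atBot_of_leadingCoeff_nonpos (by
    apply natDegree_pos_iff_degree_pos.1; omega) (by rw [leadingCoeff, hnd]; exact hgc.le)
  obtain ⟨y, h1, h2⟩ := (h.and (ht.eventually (eventually_lt_atBot 0))).exists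
  simp [hg] at h2
  linarith

lemma poly_bound (p : ℝ[X]) (a : ℕ) (hp : p.natDegree ≤ 2*a) : ∃ M ≥ 0, ∀ x, |p.eval x| ≤ M * (1 + x^2)^a := by
  refine ⟨∑ i ∈ Finset.range (2*a+1), |p.coeff i|, Finset.sum_nonneg fun _ _ => abs_nonneg _, fun x => ?_⟩
  rw [eval_eq_sum_range' (show p.natDegree < 2*a+1 by omega), Finset.sum_mul]
  refine (Finset.abs_sum_le_sum_abs _ _).trans (Finset.sum_le_sum fun i hi => ?_)
  rw [abs_mul]
  refine mul_le_mul_of_nonneg_left ?_ (abs_nonneg _)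
  rw [Finset.mem_range] at hi
  have h1 : (|x|)^i ≤ (max 1 |x|)^(2*a) :=
    (pow_le_pow_left₀ (abs_nonneg _) (le_max_right _ _) i).trans (pow_le_pow_right₀ (le_max_left _ _) (by omega))
  rw [abs_pow]
  refine h1.trans ?_
  rw [pow_mul]
  refine pow_le_pow_left₀ (by positivity) ?_ a
  rcases max_choice 1 |x| with h | h <;> rw [h]
  · nlinarith [sq_nonneg x]
  · rw [sq_abs]; linarith

lemma evalEval_sum (p : ℝ[X][Y]) (n : ℕ) (hp : p.natDegree < n) (x y : ℝ) :
    p.evalEval x y = ∑ j ∈ Finset.range n, (p.coeff j).eval x * y ^ j := by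
  rw [evalEval, eval_eq_sum_range' hp, eval_finset_sum]
  simp

lemma growth_Y {a b : ℕ} (hb : 1 ≤ b) {f : ℝ[X][Y]} (hf : f ∈ Pol ℝ (2*a+1) (2*b+1)) {κ : ℝ} (hκ : 0 < κ)
    (hc : ∀ x, κ * (1 + x^2)^a ≤ (f.coeff (2*b)).eval x) :
    ∃ Y0 > 0, ∀ x y, Y0 ≤ |y| → 0 < y * (derivative f).evalEval x y := by
  choose M hM0 hM using fun j => poly_bound (f.coeff j) a (Pol_coeff_natDegree hf j)
  set S := ∑ j ∈ Finset.range (2*b), M j * j with hS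
  have hS0 : 0 ≤ S := Finset.sum_nonneg fun j _ => mul_nonneg (hM0 j) (by positivity)
  refine ⟨max 1 (S / κ + 1), by positivity, fun x y hy => ?_⟩
  have hy1 : 1 ≤ |y| := (le_max_left _ _).trans hy
  have hy2 : S < κ * |y| := by
    have : S / κ < |y| := by linarith [(le_max_right (1:ℝ) (S / κ + 1)).trans hy]
    rwa [div_lt_iff₀ hκ, mul_comm] at this
  have e : y * (derivative f).evalEval x y = (Y * derivative f).evalEval x y := by simp [evalEval_mul]
  have hco : ∀ j, (Y * derivative f).coeff j = f.coeff j * C (j : ℝ) := by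
    intro j
    cases j with
    | zero => simp
    | succ j => rw [coeff_X_mul, coeff_derivative]; simp
  have hdeg : (Y * derivative f).natDegree < 2*b+1 := by
    rw [Nat.lt_succ_iff, natDegree_le_iff_coeff_eq_zero]
    intro N hN
    rw [hco, Pol_coeff_eq_zero hf hN, zero_mul]
  rw [e, evalEval_sum _ _ hdeg, Finset.sum_range_succ]
  have hA : 0 < (1 + x^2)^a := by positivity
  set A := (1 + x^2)^a
  have hlow : -(A * S * |y|^(2*b-1)) ≤ ∑ j ∈ Finset.range (2*b), ((Y * derivative f).coeff j).eval x * y ^ j := by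
    refine (abs_le.1 ((Finset.abs_sum_le_sum_abs _ _).trans ?_)).1
    rw [hS, Finset.mul_sum, Finset.sum_mul]
    refine Finset.sum_le_sum fun j hj => ?_
    rw [Finset.mem_range] at hj
    rw [hco, eval_mul, eval_C, abs_mul, abs_mul, abs_pow, Nat.abs_cast]
    have h1 := hM j x
    have h2 : |y|^j ≤ |y|^(2*b-1) := pow_le_pow_right₀ hy1 (by omega)
    calc |(f.coeff j).eval x| * j * |y|^j ≤ (M j * A) * j * |y|^(2*b-1) := by
          have := hM0 j
          gcongr
      _ = _ := by ring
  have htop : κ * A * |y|^(2*b) ≤ ((Y * derivative f).coeff (2*b)).eval x * y^(2*b) := by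
    rw [hco, eval_mul, eval_C, (even_two_mul b).pow_abs y]
    have h1 := hc x
    have h2 : (1:ℝ) ≤ ((2*b : ℕ) : ℝ) := by exact_mod_cast (by omega : 1 ≤ 2*b)
    have h3 : 0 ≤ y^(2*b) := (even_two_mul b).pow_nonneg y
    have h4 : κ * A ≤ (f.coeff (2*b)).eval x * ((2*b : ℕ) : ℝ) := by
      have : 0 < κ * A := by positivity
      nlinarith
    exact mul_le_mul_of_nonneg_right h4 h3
  have hpow : |y|^(2*b) = |y|^(2*b-1) * |y| := by rw [← pow_succ]; congr 1; omega
  have hpp : 0 < |y|^(2*b-1) := by positivity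
  have : 0 < A * |y|^(2*b-1) * (κ * |y| - S) := by
    have : 0 < κ * |y| - S := by linarith
    positivity
  rw [hpow] at htop
  nlinarith

/-- a bivariate monomial -/
noncomputable def mon {K : Type*} [Field K] (i j : ℕ) (c : K) : K[X][Y] := monomial j (monomial i c)

section mon
variable {K : Type*} [Field K]

lemma mon_coeff (i j : ℕ) (c : K) (i' j' : ℕ) : ((mon i j c).coeff j').coeff i' = if j = j' ∧ i = i' then c else 0 := by
  rw [mon, coeff_monomial]
  split_ifs with h1 h2 h2
  · simp [coeff_monomial, h2.2]
  · rw [coeff_monomial, if_neg]; tauto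
  · tauto
  · simp

lemma mon_swap (i j : ℕ) (c : K) : Bivariate.swap (mon i j c) = mon j i c := by
  apply biv_ext
  intro i' j'
  rw [swap_coeff, mon_coeff, mon_coeff]
  congr 1
  simp [and_comm]

lemma mon_eval (i j : ℕ) (c x y : K) : (mon i j c).evalEval x y = c * x^i * y^j := by
  simp [mon, evalEval]

lemma mon_dY (i j : ℕ) (c : K) : derivative (mon i j c) = mon i (j-1) (c * j) := by
  rw [mon, derivative_monomial, mon]
  congr 1
  ext n; simp [coeff_monomial]

lemma mon_dX (i j : ℕ) (c : K) : dX (mon i j c) = mon (i-1) j (c * i) := by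
  rw [dX, mon_swap, mon_dY, mon_swap]

end mon

/-- The perturbed polynomial -/
noncomputable def pert (a b : ℕ) (f : ℝ[X][Y]) (s α β : ℝ) : ℝ[X][Y] :=
  f + mon (2*a) 0 s + mon 0 (2*b) s + mon 1 0 α + mon 0 1 β

lemma pert_eval (a b : ℕ) (f : ℝ[X][Y]) (s α β x y : ℝ) :
    (pert a b f s α β).evalEval x y = f.evalEval x y + s * x^(2*a) + s * y^(2*b) + α * x + β * y := by
  simp [pert, mon_eval]

lemma pert_swap (a b : ℕ) (f : ℝ[X][Y]) (s α β : ℝ) :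
    Bivariate.swap (pert a b f s α β) = pert b a (Bivariate.swap f) s β α := by
  simp only [pert, map_add, mon_swap]; ring

lemma pert_dY (a b : ℕ) (f : ℝ[X][Y]) (s α β : ℝ) :
    derivative (pert a b f s α β) = derivative f + mon 0 (2*b-1) (s * (2*b : ℕ)) + mon 0 0 β := by
  simp only [pert, derivative_add, mon_dY]
  have : ∀ i j, mon i j (0:ℝ) = 0 := by intro i j; simp [mon]
  simp [this]

lemma pert_dX (a b : ℕ) (f : ℝ[X][Y]) (s α β : ℝ) :
    dX (pert a b f s α β) = dX f + mon (2*a-1) 0 (s * (2*a : ℕ)) + mon 0 0 α := by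
  simp only [pert, dX_add, mon_dX]
  have : ∀ i j, mon i j (0:ℝ) = 0 := by intro i j; simp [mon]
  simp [this]

lemma pert_JJ (a b : ℕ) (f : ℝ[X][Y]) (s α β : ℝ) : JJ (pert a b f s α β) = JJ (pert a b f s 0 0) := by
  have : ∀ i j, mon i j (0:ℝ) = 0 := by intro i j; simp [mon]
  simp only [JJ, Jac, pert_dX, pert_dY, dX_add, derivative_add, mon_dX, mon_dY]
  simp [this]

lemma pert_mem {a b : ℕ} (ha : 1 ≤ a) (hb : 1 ≤ b) {f : ℝ[X][Y]} (hf : f ∈ Pol ℝ (2*a+1) (2*b+1)) (s α β : ℝ) :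
    pert a b f s α β ∈ Pol ℝ (2*a+1) (2*b+1) := by
  have hm : ∀ i j (c : ℝ), i < 2*a+1 → j < 2*b+1 → mon i j c ∈ Pol ℝ (2*a+1) (2*b+1) := fun i j c hi hj => Pol_monomial hi hj c
  refine Submodule.add_mem _ (Submodule.add_mem _ (Submodule.add_mem _ (Submodule.add_mem _ hf ?_) ?_) ?_) ?_ <;>
    apply hm <;> omega

lemma pert_coeff {a b : ℕ} (hb : 1 ≤ b) (f : ℝ[X][Y]) (s α β : ℝ) :
    (pert a b f s α β).coeff (2*b) = f.coeff (2*b) + C s := by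
  ext i
  simp only [pert, coeff_add, mon_coeff, coeff_C]
  rw [if_neg (show ¬ (0 = 2*b ∧ 2*a = i) by omega), if_neg (show ¬ (0 = 2*b ∧ 1 = i) by omega), if_neg (show ¬ (1 = 2*b ∧ 0 = i) by omega)]
  by_cases h : i = 0
  · simp [h]
  · rw [if_neg (by omega), if_neg h]; ring

end Petro

set_option autoImplicit false
set_option linter.all false

namespace Petro
open Polynomial Filter Topology Set
open scoped Polynomial.Bivariate

open Classical in
lemma count_lemma {A I : Type*} (S : Finset A) (Z : Finset I) (inB : I → A → Prop)
    (hdis : ∀ p ∈ Z, ∀ p' ∈ Z, ∀ q, inB p q → inB p' q → p = p') (sg : A → ℝ)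
    (hS : ∑ q ∈ S, sg q = 1) (hB : ∀ p ∈ Z, ∑ q ∈ S.filter (inB p), sg q = 1) (pos : A → Prop)
    (hin : ∀ q ∈ S, (∃ p ∈ Z, inB p q) → (if pos q then (1:ℝ) else 0) = (1 - sg q) / 2)
    (hout : ∀ q ∈ S, ¬ (∃ p ∈ Z, inB p q) → (if pos q then (1:ℝ) else 0) = (1 + sg q) / 2) :
    2 * (S.filter pos).card + 2 * Z.card = S.card + 1 := by
  have h1 : ∑ q ∈ S, ∑ p ∈ Z, (if inB p q then sg q else 0) = Z.card := by
    rw [Finset.sum_comm]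
    simp only [← Finset.sum_filter]
    rw [Finset.sum_congr rfl hB]; simp
  have h2 : ∀ q ∈ S, (if pos q then (1:ℝ) else 0) = (1 + sg q) / 2 - ∑ p ∈ Z, (if inB p q then sg q else 0) := by
    intro q hq
    by_cases h : ∃ p ∈ Z, inB p q
    · rw [hin q hq h]
      obtain ⟨p, hp, hpq⟩ := h
      rw [Finset.sum_eq_single p, if_pos hpq]
      · ring
      · intro p' hp' hne
        rw [if_neg]
        intro h'
        exact hne (hdis p' hp' p hp q h' hpq)
      · exact fun h => absurd hp h
    · rw [hout q hq h, Finset.sum_eq_zero]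
      · ring
      · intro p hp
        rw [if_neg]
        exact fun h' => h ⟨p, hp, h'⟩
  have h3 : ((S.filter pos).card : ℝ) = ∑ q ∈ S, (if pos q then (1:ℝ) else 0) := by simp
  rw [Finset.sum_congr rfl h2, Finset.sum_sub_distrib, h1, ← Finset.sum_div, Finset.sum_add_distrib, hS] at h3
  simp at h3
  have : (2 * (S.filter pos).card + 2 * Z.card : ℝ) = S.card + 1 := by rw [h3]; ring
  exact_mod_cast this

lemma pick {A : Set ℂ} (hA : A.Finite) {σ : ℝ} (hσ : 0 < σ) : ∃ s : ℝ, 0 < s ∧ s < σ ∧ (s : ℂ) ∉ A := by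
  have h : (Complex.ofReal ⁻¹' A).Finite := hA.preimage (Complex.ofReal_injective.injOn)
  obtain ⟨s, hs, hs'⟩ := (Ioo_infinite hσ).exists_notMem_finite h
  exact ⟨s, hs.1, hs.2, hs'⟩

/-- stability of the box conditions -/
lemma stable (f : ℝ[X][Y]) (x1 x2 y1 y2 : ℝ)
    (htop : ∀ x ∈ Icc x1 x2, 0 < (derivative f).evalEval x y2)
    (hbot : ∀ x ∈ Icc x1 x2, (derivative f).evalEval x y1 < 0)
    (hr : ∀ y ∈ Icc y1 y2, (derivative f).evalEval x2 y = 0 → 0 < (dX f).evalEval x2 y)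
    (hl : ∀ y ∈ Icc y1 y2, (derivative f).evalEval x1 y = 0 → (dX f).evalEval x1 y < 0)
    (hx : x1 < x2) (hy : y1 < y2)
    (hcr : ∀ x ∈ Icc x1 x2, ∀ y ∈ Icc y1 y2, (dX f).evalEval x y = 0 → (derivative f).evalEval x y = 0 → f.evalEval x y = 0)
    (κ : ℝ) (hκ : 0 < κ) :
    ∃ τ > 0, ∀ P Q : ℝ[X][Y], (∀ x ∈ Icc x1 x2, ∀ y ∈ Icc y1 y2, |P.evalEval x y - (dX f).evalEval x y| < τ ∧
        |Q.evalEval x y - (derivative f).evalEval x y| < τ) →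
      (∀ x ∈ Icc x1 x2, 0 < Q.evalEval x y2) ∧ (∀ x ∈ Icc x1 x2, Q.evalEval x y1 < 0) ∧
      (∀ y ∈ Icc y1 y2, Q.evalEval x2 y = 0 → 0 < P.evalEval x2 y) ∧
      (∀ y ∈ Icc y1 y2, Q.evalEval x1 y = 0 → P.evalEval x1 y < 0) ∧
      (∀ x ∈ Icc x1 x2, ∀ y ∈ Icc y1 y2, P.evalEval x y = 0 → Q.evalEval x y = 0 → f.evalEval x y < κ) := by
  have hPc := ev_cont (dX f)
  have hQc := ev_cont (derivative f)
  obtain ⟨ε1, hε1, h1⟩ := exists_pos_le (isCompact_Icc (a := x1) (b := x2)) (g := fun x => (derivative f).evalEval x y2)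
    (hQc.comp (Continuous.prodMk_left y2)).continuousOn htop
  obtain ⟨ε2, hε2, h2⟩ := exists_pos_le (isCompact_Icc (a := x1) (b := x2)) (g := fun x => -(derivative f).evalEval x y1)
    (hQc.comp (Continuous.prodMk_left y1)).neg.continuousOn (fun x hx => by linarith [hbot x hx])
  obtain ⟨ε3, hε3, h3⟩ := exists_pos_le (isCompact_Icc (a := y1) (b := y2)) (g := fun y => max |(derivative f).evalEval x2 y| ((dX f).evalEval x2 y))
    (((hQc.comp (Continuous.prodMk_right x2)).abs).max (hPc.comp (Continuous.prodMk_right x2))).continuousOn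
    (fun y hy => by
      rw [lt_max_iff]
      by_cases h : (derivative f).evalEval x2 y = 0
      · exact Or.inr (hr y hy h)
      · exact Or.inl (abs_pos.2 h))
  obtain ⟨ε4, hε4, h4⟩ := exists_pos_le (isCompact_Icc (a := y1) (b := y2)) (g := fun y => max |(derivative f).evalEval x1 y| (-(dX f).evalEval x1 y))
    (((hQc.comp (Continuous.prodMk_right x1)).abs).max (hPc.comp (Continuous.prodMk_right x1)).neg).continuousOn
    (fun y hy => by
      rw [lt_max_iff]
      by_cases h : (derivative f).evalEval x1 y = 0
      · exact Or.inr (by linarith [hl y hy h])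
      · exact Or.inl (abs_pos.2 h))
  have hcomp : IsCompact ((Icc x1 x2 ×ˢ Icc y1 y2) ∩ {p | κ ≤ f.evalEval p.1 p.2}) :=
    (isCompact_Icc.prod isCompact_Icc).inter_right (isClosed_le continuous_const (ev_cont f))
  obtain ⟨ε5, hε5, h5⟩ := exists_pos_le hcomp (g := fun p => max |(dX f).evalEval p.1 p.2| |(derivative f).evalEval p.1 p.2|)
    ((hPc.abs).max hQc.abs).continuousOn (fun p hp => by
      by_contra hneg
      rw [not_lt, max_le_iff] at hneg
      have e1 := abs_nonpos_iff.1 hneg.1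
      have e2 := abs_nonpos_iff.1 hneg.2
      have := hcr p.1 hp.1.1 p.2 hp.1.2 e1 e2
      have := hp.2
      simp only [mem_setOf_eq] at this
      linarith)
  refine ⟨min (min (min ε1 ε2) (min ε3 ε4)) ε5, lt_min (lt_min (lt_min hε1 hε2) (lt_min hε3 hε4)) hε5, fun P Q hPQ => ?_⟩
  simp only [lt_min_iff] at hPQ
  have mx1 : x1 ∈ Icc x1 x2 := ⟨le_rfl, hx.le⟩
  have mx2 : x2 ∈ Icc x1 x2 := ⟨hx.le, le_rfl⟩
  have my1 : y1 ∈ Icc y1 y2 := ⟨le_rfl, hy.le⟩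
  have my2 : y2 ∈ Icc y1 y2 := ⟨hy.le, le_rfl⟩
  refine ⟨fun x hx => ?_, fun x hx => ?_, fun y hy h => ?_, fun y hy h => ?_, fun x hx y hy e1 e2 => ?_⟩
  · have e := (hPQ x hx y2 my2).2.1.1.1
    have := h1 x hx
    rw [abs_lt] at e; linarith
  · have e := (hPQ x hx y1 my1).2.1.1.2
    have := h2 x hx
    rw [abs_lt] at e; linarith
  · have e := (hPQ x2 mx2 y hy).2.1.2.1
    have e' := (hPQ x2 mx2 y hy).1.1.2.1
    rw [h, zero_sub, abs_neg] at e
    rw [abs_lt] at e'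
    rcases le_max_iff.1 (h3 y hy) with h' | h' <;> linarith
  · have e := (hPQ x1 mx1 y hy).2.1.2.2
    have e' := (hPQ x1 mx1 y hy).1.1.2.2
    rw [h, zero_sub, abs_neg] at e
    rw [abs_lt] at e'
    rcases le_max_iff.1 (h4 y hy) with h' | h' <;> linarith
  · by_contra hn
    have e := (hPQ x hx y hy).2.2
    have e' := (hPQ x hx y hy).1.2
    rw [e2, zero_sub, abs_neg] at e
    rw [e1, zero_sub, abs_neg] at e'
    rcases le_max_iff.1 (h5 (x, y) ⟨⟨hx, hy⟩, not_lt.1 hn⟩) with h' | h' <;> simp only at h' <;> linarith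

/-- generic choice of the perturbation -/
lemma generic_pert {a b : ℕ} (ha : 1 ≤ a) (hb : 1 ≤ b) {f : ℝ[X][Y]} (hf : f ∈ Pol ℝ (2*a+1) (2*b+1))
    (hl : 0 < (f.coeff (2*b)).coeff (2*a)) {σ : ℝ} (hσ : 0 < σ) :
    ∃ s α β, 0 < s ∧ s < σ ∧ 0 < α ∧ α < σ ∧ 0 < β ∧ β < σ ∧ Good a b (cx (pert a b f s α β)) ∧
      0 < ((pert a b f s α β).coeff (2*b)).coeff (2*a) ∧
      ∀ q ∈ ZZ (cx (pert a b f s α β)), (JJ (cx (pert a b f s α β))).evalEval q.1 q.2 ≠ 0 := by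
  have hcx : ∀ (g : ℝ[X][Y]) j, (cx g).coeff j = (g.coeff j).map Complex.ofRealHom := by
    intro g j; ext i; rw [cx_coeff]; simp
  have hswap : ∀ g : ℝ[X][Y], Bivariate.swap (cx g) = cx (Bivariate.swap g) := by
    intro g; apply biv_ext; intro i j; rw [swap_coeff, cx_coeff, cx_coeff, swap_coeff]
  have hdne : ∀ (g : ℝ[X][Y]) (a b : ℕ), 1 ≤ a → (g.coeff (2*b)).coeff (2*a) ≠ 0 → derivative ((cx g).coeff (2*b)) ≠ 0 := by
    intro g a b ha h h'
    have h2 := congrArg (fun p => p.coeff (2*a-1)) h'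
    simp only [coeff_derivative, coeff_zero] at h2
    rw [show 2*a-1+1 = 2*a by omega, cx_coeff, mul_eq_zero] at h2
    rcases h2 with h2 | h2
    · exact h (by exact_mod_cast h2)
    · have : ((2*a-1 : ℕ) : ℂ) + 1 ≠ 0 := Nat.cast_add_one_ne_zero _
      exact this h2
  have hlsw : ((Bivariate.swap f).coeff (2*a)).coeff (2*b) ≠ 0 := by rw [swap_coeff]; exact hl.ne'
  obtain ⟨A1, hA1, h1⟩ := generic_s _ (hdne f a b ha hl.ne')
  obtain ⟨A2, hA2, h2⟩ := generic_s _ (hdne (Bivariate.swap f) b a hb hlsw)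
  obtain ⟨s, hs0, hs1, hsA⟩ := pick (hA1.union hA2) hσ
  have hlead : ∀ α β, ((pert a b f s α β).coeff (2*b)).coeff (2*a) = (f.coeff (2*b)).coeff (2*a) := by
    intro α β
    rw [pert_coeff hb, coeff_add, coeff_C, if_neg (by omega), add_zero]
  have hgood : ∀ α β, Good a b (cx (pert a b f s α β)) := by
    intro α β
    refine ⟨ha, hb, cx_mem (pert_mem ha hb hf _ _ _), ?_, ?_, ?_⟩
    · rw [cx_coeff, hlead]; exact_mod_cast hl.ne'
    · rw [hcx, pert_coeff hb, Polynomial.map_add, map_C, ← hcx]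
      exact h1 s (fun h => hsA (Or.inl h))
    · rw [hswap, pert_swap, hcx, pert_coeff ha, Polynomial.map_add, map_C, ← hcx]
      exact h2 s (fun h => hsA (Or.inr h))
  have hJ0 : cx (JJ (pert a b f s 0 0)) ≠ 0 := by
    intro h
    exact JJ_ne_zero ha hb (pert_mem ha hb hf s 0 0) (by rw [hlead]; exact hl.ne') (cx_inj h)
  obtain ⟨A, hA, hAB⟩ := generic_ab (cx (dX (pert a b f s 0 0))) (cx (derivative (pert a b f s 0 0))) _ hJ0
  obtain ⟨α, hα0, hα1, hαA⟩ := pick hA hσ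
  obtain ⟨B, hB, hBs⟩ := hAB α hαA
  obtain ⟨β, hβ0, hβ1, hβB⟩ := pick hB hσ
  refine ⟨s, α, β, hs0, hs1, hα0, hα1, hβ0, hβ1, hgood α β, by rw [hlead]; exact hl, ?_⟩
  rintro q ⟨hq1, hq2⟩ hq3
  have hadd : ∀ p q : ℝ[X][Y], cx (p + q) = cx p + cx q := by intro p q; simp [cx]
  have hmon : ∀ (c : ℝ) (x y : ℂ), (cx (mon 0 0 c)).evalEval x y = c := by
    intro c x y; simp [cx, mon, evalEval]
  have hz : mon 0 0 (0:ℝ) = 0 := by simp [mon]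
  rw [cx_JJ, pert_JJ] at hq3
  refine hBs β hβB q hq3 ?_ ?_
  · rw [cx_dX, pert_dX, hadd, evalEval_add, hmon] at hq1
    rw [pert_dX, hz, add_zero]; exact hq1
  · rw [cx_dY, pert_dY, hadd, evalEval_add, hmon] at hq2
    rw [pert_dY, hz, add_zero]; exact hq2

end Petro

set_option autoImplicit false
set_option linter.all false

namespace Petro
open Polynomial Filter Topology Set
open scoped Polynomial.Bivariate

lemma lead_growth {a b : ℕ} (hb : 1 ≤ b) {f : ℝ[X][Y]} (hf : f ∈ Pol ℝ (2*a+1) (2*b+1)) {κ R : ℝ} (hκ : 0 < κ)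
    (hg : ∀ x y, R ≤ |y| → κ * (1 + x^2)^a * (1 + y^2)^b ≤ f.evalEval x y) (x : ℝ) :
    κ * (1 + x^2)^a ≤ (f.coeff (2*b)).eval x := by
  have h := lead_ge (f.map (evalRingHom x)) (2*b) (by omega) (natDegree_map_le.trans (Pol_natDegree hf)) (κ * (1 + x^2)^a)
  rw [coeff_map] at h
  apply h
  filter_upwards [eventually_ge_atTop R, eventually_ge_atTop 0] with y hy hy0
  rw [map_evalRingHom_eval]
  refine le_trans ?_ (hg x y (by rwa [abs_of_nonneg hy0]))
  refine mul_le_mul_of_nonneg_left ?_ (by positivity)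
  rw [pow_mul]
  exact pow_le_pow_left₀ (sq_nonneg _) (by linarith) b

lemma local_stab (a b : ℕ) (f : ℝ[X][Y]) (x1 x2 y1 y2 : ℝ)
    (htop : ∀ x ∈ Icc x1 x2, 0 < (derivative f).evalEval x y2)
    (hbot : ∀ x ∈ Icc x1 x2, (derivative f).evalEval x y1 < 0)
    (hr : ∀ y ∈ Icc y1 y2, (derivative f).evalEval x2 y = 0 → 0 < (dX f).evalEval x2 y)
    (hl : ∀ y ∈ Icc y1 y2, (derivative f).evalEval x1 y = 0 → (dX f).evalEval x1 y < 0)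
    (hx : x1 < x2) (hy : y1 < y2)
    (hcr : ∀ x ∈ Icc x1 x2, ∀ y ∈ Icc y1 y2, (dX f).evalEval x y = 0 → (derivative f).evalEval x y = 0 → f.evalEval x y = 0)
    (κ : ℝ) (hκ : 0 < κ) :
    ∃ σ > 0, ∀ s α β : ℝ, 0 < s → s < σ → 0 < α → α < σ → 0 < β → β < σ →
      (∀ x ∈ Icc x1 x2, 0 < (derivative (pert a b f s α β)).evalEval x y2) ∧
      (∀ x ∈ Icc x1 x2, (derivative (pert a b f s α β)).evalEval x y1 < 0) ∧
      (∀ y ∈ Icc y1 y2, (derivative (pert a b f s α β)).evalEval x2 y = 0 → 0 < (dX (pert a b f s α β)).evalEval x2 y) ∧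
      (∀ y ∈ Icc y1 y2, (derivative (pert a b f s α β)).evalEval x1 y = 0 → (dX (pert a b f s α β)).evalEval x1 y < 0) ∧
      (∀ x ∈ Icc x1 x2, ∀ y ∈ Icc y1 y2, (dX (pert a b f s α β)).evalEval x y = 0 →
        (derivative (pert a b f s α β)).evalEval x y = 0 → (pert a b f s α β).evalEval x y < κ) := by
  obtain ⟨τ, hτ, H⟩ := stable f x1 x2 y1 y2 htop hbot hr hl hx hy hcr (κ/2) (by positivity)
  set W : ℝ × ℝ → ℝ := fun p => (2*a:ℕ) * |p.1|^(2*a-1) + (2*b:ℕ) * |p.2|^(2*b-1) + |p.1|^(2*a) + |p.2|^(2*b) + |p.1| + |p.2| + 1 with hW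
  have hWc : Continuous W := by fun_prop
  obtain ⟨M, hM⟩ := ((isCompact_Icc (a := x1) (b := x2)).prod (isCompact_Icc (a := y1) (b := y2))).exists_bound_of_continuousOn hWc.continuousOn
  have hM' : ∀ x ∈ Icc x1 x2, ∀ y ∈ Icc y1 y2, W (x, y) ≤ |M| + 1 := by
    intro x hx y hy
    have := hM (x, y) ⟨hx, hy⟩
    rw [Real.norm_eq_abs] at this
    linarith [le_abs_self (W (x,y)), le_abs_self M]
  have hMp : 0 < |M| + 1 := by positivity
  refine ⟨min τ (κ/2) / (|M| + 1), by positivity, fun s α β hs0 hs hα0 hα hβ0 hβ => ?_⟩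
  set σ := min τ (κ/2) / (|M| + 1) with hσ
  have hσ0 : 0 < σ := by positivity
  have hσM : ∀ x ∈ Icc x1 x2, ∀ y ∈ Icc y1 y2, σ * W (x, y) ≤ min τ (κ/2) := by
    intro x hx y hy
    calc σ * W (x,y) ≤ σ * (|M| + 1) := mul_le_mul_of_nonneg_left (hM' x hx y hy) hσ0.le
      _ = _ := by rw [hσ]; field_simp
  have key : ∀ x ∈ Icc x1 x2, ∀ y ∈ Icc y1 y2,
      |(dX (pert a b f s α β)).evalEval x y - (dX f).evalEval x y| < τ ∧
      |(derivative (pert a b f s α β)).evalEval x y - (derivative f).evalEval x y| < τ ∧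
      |(pert a b f s α β).evalEval x y - f.evalEval x y| ≤ κ/2 := by
    intro x hx y hy
    have hb := hσM x hx y hy
    have h1 : σ * W (x, y) ≤ τ := hb.trans (min_le_left _ _)
    have h2 : σ * W (x, y) ≤ κ/2 := hb.trans (min_le_right _ _)
    simp only [hW] at h1 h2
    have pA : 0 ≤ (2*a:ℕ) * |x|^(2*a-1) := by positivity
    have pB : 0 ≤ (2*b:ℕ) * |y|^(2*b-1) := by positivity
    have pC : 0 ≤ |x|^(2*a) := by positivity
    have pD : 0 ≤ |y|^(2*b) := by positivity
    have pE : 0 ≤ |x| := by positivity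
    have pF : 0 ≤ |y| := by positivity
    refine ⟨?_, ?_, ?_⟩
    · have : (dX (pert a b f s α β)).evalEval x y - (dX f).evalEval x y = s * ((2*a:ℕ) * x^(2*a-1)) + α := by
        rw [pert_dX]; simp only [evalEval_add, mon_eval]; ring
      rw [this]
      refine lt_of_le_of_lt (abs_add_le _ _) ?_
      rw [abs_mul, abs_mul, abs_pow, abs_of_pos hs0, abs_of_pos hα0, Nat.abs_cast]
      nlinarith [mul_nonneg hσ0.le pB, mul_nonneg hσ0.le pC, mul_nonneg hσ0.le pD, mul_nonneg hσ0.le pE, mul_nonneg hσ0.le pF,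
        mul_le_mul_of_nonneg_right hs.le pA]
    · have : (derivative (pert a b f s α β)).evalEval x y - (derivative f).evalEval x y = s * ((2*b:ℕ) * y^(2*b-1)) + β := by
        rw [pert_dY]; simp only [evalEval_add, mon_eval]; ring
      rw [this]
      refine lt_of_le_of_lt (abs_add_le _ _) ?_
      rw [abs_mul, abs_mul, abs_pow, abs_of_pos hs0, abs_of_pos hβ0, Nat.abs_cast]
      nlinarith [mul_nonneg hσ0.le pA, mul_nonneg hσ0.le pC, mul_nonneg hσ0.le pD, mul_nonneg hσ0.le pE, mul_nonneg hσ0.le pF,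
        mul_le_mul_of_nonneg_right hs.le pB]
    · have : (pert a b f s α β).evalEval x y - f.evalEval x y = s * x^(2*a) + s * y^(2*b) + α * x + β * y := by
        rw [pert_eval]; ring
      rw [this]
      refine (abs_add_le _ _).trans ?_
      have e1 := abs_add_le (s * x^(2*a) + s * y^(2*b)) (α * x)
      have e2 := abs_add_le (s * x^(2*a)) (s * y^(2*b))
      rw [abs_mul, abs_mul, abs_pow, abs_pow, abs_of_pos hs0] at e2
      rw [abs_mul α, abs_of_pos hα0] at e1
      rw [abs_mul β, abs_of_pos hβ0]
      nlinarith [mul_nonneg hσ0.le pA, mul_nonneg hσ0.le pB, mul_le_mul_of_nonneg_right hs.le pC, mul_le_mul_of_nonneg_right hs.le pD,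
        mul_le_mul_of_nonneg_right hα.le pE, mul_le_mul_of_nonneg_right hβ.le pF]
  obtain ⟨c1, c2, c3, c4, c5⟩ := H (dX (pert a b f s α β)) (derivative (pert a b f s α β)) (fun x hx y hy => ⟨(key x hx y hy).1, (key x hx y hy).2.1⟩)
  refine ⟨c1, c2, c3, c4, fun x hx y hy e1 e2 => ?_⟩
  have := (key x hx y hy).2.2
  rw [abs_le] at this
  linarith [c5 x hx y hy e1 e2]

lemma finset_pos {I : Type*} (Z : Finset I) (σ : I → ℝ) (h : ∀ p ∈ Z, 0 < σ p) (κ : ℝ) (hκ : 0 < κ) :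
    ∃ s, 0 < s ∧ s ≤ κ ∧ ∀ p ∈ Z, s ≤ σ p := by
  classical
  induction Z using Finset.induction_on with
  | empty => exact ⟨κ, hκ, le_rfl, by simp⟩
  | insert p Z hp ih =>
    obtain ⟨s, h1, h2, h3⟩ := ih (fun q hq => h q (Finset.mem_insert_of_mem hq))
    refine ⟨min s (σ p), lt_min h1 (h p (Finset.mem_insert_self _ _)), (min_le_left _ _).trans h2, fun q hq => ?_⟩
    rcases Finset.mem_insert.1 hq with rfl | hq
    · exact min_le_right _ _
    · exact (min_le_left _ _).trans (h3 q hq)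

lemma far_bound (a b : ℕ) (ha : 1 ≤ a) (hb : 1 ≤ b) {κ s α β x y v : ℝ} (hκ : 0 < κ) (hs : 0 < s) (hα : 0 < α) (hβ : 0 < β)
    (hα' : α ≤ κ/4) (hβ' : β ≤ κ/4) (h : κ * (1 + x^2)^a * (1 + y^2)^b ≤ v) :
    κ / 2 ≤ v + s * x^(2*a) + s * y^(2*b) + α * x + β * y := by
  have h1 : (1 + x^2) ≤ (1 + x^2)^a := le_self_pow₀ (by nlinarith [sq_nonneg x]) (by omega)
  have h2 : (1 + y^2) ≤ (1 + y^2)^b := le_self_pow₀ (by nlinarith [sq_nonneg y]) (by omega)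
  have h3 : (1 + x^2) * (1+y^2) ≤ (1 + x^2)^a * (1 + y^2)^b := mul_le_mul h1 h2 (by positivity) (by positivity)
  have h4 : κ * ((1 + x^2) * (1+y^2)) ≤ v := by
    refine le_trans (mul_le_mul_of_nonneg_left h3 hκ.le) (by rw [← mul_assoc]; exact h)
  have p1 : 0 ≤ s * x^(2*a) := mul_nonneg hs.le (by rw [pow_mul]; positivity)
  have p2 : 0 ≤ s * y^(2*b) := mul_nonneg hs.le (by rw [pow_mul]; positivity)
  have e1 : -(κ/4 * |x|) ≤ α * x := by
    have : |α * x| ≤ κ/4 * |x| := by rw [abs_mul, abs_of_pos hα]; exact mul_le_mul_of_nonneg_right hα' (abs_nonneg _)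
    linarith [neg_abs_le (α * x)]
  have e2 : -(κ/4 * |y|) ≤ β * y := by
    have : |β * y| ≤ κ/4 * |y| := by rw [abs_mul, abs_of_pos hβ]; exact mul_le_mul_of_nonneg_right hβ' (abs_nonneg _)
    linarith [neg_abs_le (β * y)]
  have q1 : |x| ≤ (1 + x^2)/2 := by nlinarith [sq_abs x, sq_nonneg (|x| - 1)]
  have q2 : |y| ≤ (1 + y^2)/2 := by nlinarith [sq_abs y, sq_nonneg (|y| - 1)]
  nlinarith [mul_nonneg hκ.le (mul_nonneg (sq_nonneg x) (sq_nonneg y)), mul_nonneg hκ.le (sq_nonneg x), mul_nonneg hκ.le (sq_nonneg y),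
    mul_le_mul_of_nonneg_left q1 hκ.le, mul_le_mul_of_nonneg_left q2 hκ.le]

end Petro

set_option autoImplicit false
set_option linter.all false

namespace Petro
open Polynomial Filter Topology Set
open scoped Polynomial.Bivariate

open Classical in
theorem main_affine {a b : ℕ} (ha : 1 ≤ a) (hb : 1 ≤ b) {f : ℝ[X][Y]} (hf : f ∈ Pol ℝ (2*a+1) (2*b+1))
    (hpos : ∀ x y, 0 ≤ f.evalEval x y) (Z : Finset (ℝ × ℝ)) (hZ : ∀ q : ℝ × ℝ, q ∈ Z ↔ f.evalEval q.1 q.2 = 0)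
    (hgrow : ∀ U : Set (ℝ × ℝ), IsOpen U → (∀ q ∈ Z, q ∈ U) →
      ∃ κ > 0, ∀ q : ℝ × ℝ, q ∉ U → κ * (1 + q.1^2)^a * (1 + q.2^2)^b ≤ f.evalEval q.1 q.2) :
    Z.card + a + b ≤ 3 * (a * b) + 1 := by
  -- separation
  obtain ⟨ε, hε0, -, hε⟩ := finset_pos Z.offDiag (fun p => dist p.1 p.2) (fun p hp => by
    rw [Finset.mem_offDiag] at hp; exact dist_pos.2 hp.2.2) 1 one_pos
  have hfin : {q : ℝ × ℝ | f.evalEval q.1 q.2 = 0}.Finite := by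
    refine Z.finite_toSet.subset (fun q hq => ?_)
    exact Finset.mem_coe.2 ((hZ q).2 hq)
  -- boxes
  have hbox : ∀ p : ℝ × ℝ, ∃ δ η, p ∈ Z → 0 < δ ∧ δ < ε/2 ∧ 0 < η ∧ η < ε/2 ∧
      (∀ x ∈ Icc (p.1 - δ) (p.1 + δ), 0 < (derivative f).evalEval x (p.2 + η)) ∧
      (∀ x ∈ Icc (p.1 - δ) (p.1 + δ), (derivative f).evalEval x (p.2 - η) < 0) ∧
      (∀ y ∈ Icc (p.2 - η) (p.2 + η), (derivative f).evalEval (p.1 + δ) y = 0 → 0 < (dX f).evalEval (p.1 + δ) y) ∧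
      (∀ y ∈ Icc (p.2 - η) (p.2 + η), (derivative f).evalEval (p.1 - δ) y = 0 → (dX f).evalEval (p.1 - δ) y < 0) ∧
      (∀ x ∈ Icc (p.1 - δ) (p.1 + δ), ∀ y ∈ Icc (p.2 - η) (p.2 + η), (dX f).evalEval x y = 0 → (derivative f).evalEval x y = 0 →
        f.evalEval x y = 0) := by
    intro p
    by_cases hp : p ∈ Z
    · obtain ⟨δ, η, h⟩ := local_box f hpos hfin p.1 p.2 ((hZ p).1 hp) (ε/2) (by positivity)
      exact ⟨δ, η, fun _ => h⟩
    · exact ⟨0, 0, fun h => absurd h hp⟩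
  choose δ η hδη using hbox
  set inB : ℝ × ℝ → ℝ × ℝ → Prop := fun p q => q ∈ Icc (p.1 - δ p) (p.1 + δ p) ×ˢ Icc (p.2 - η p) (p.2 + η p) with hinB
  have hdis : ∀ p ∈ Z, ∀ p' ∈ Z, ∀ q, inB p q → inB p' q → p = p' := by
    intro p hp p' hp' q h h'
    by_contra hne
    have h1 := hε (p, p') (Finset.mem_offDiag.2 ⟨hp, hp', hne⟩)
    have hd : ∀ p ∈ Z, inB p q → dist p q < ε/2 := by
      intro p hp h
      obtain ⟨d1, d2, d3, d4, -⟩ := hδη p hp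
      obtain ⟨⟨i1, i2⟩, ⟨i3, i4⟩⟩ := h
      rw [Prod.dist_eq, max_lt_iff, Real.dist_eq, Real.dist_eq, abs_lt, abs_lt]
      exact ⟨⟨by linarith, by linarith⟩, ⟨by linarith, by linarith⟩⟩
    have h2 := dist_triangle_right p p' q
    simp only at h1
    linarith [hd p hp h, hd p' hp' h']
  set U : Set (ℝ × ℝ) := ⋃ p ∈ Z, Ioo (p.1 - δ p) (p.1 + δ p) ×ˢ Ioo (p.2 - η p) (p.2 + η p) with hU
  have hUo : IsOpen U := isOpen_biUnion fun p _ => isOpen_Ioo.prod isOpen_Ioo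
  obtain ⟨κ, hκ, hgr⟩ := hgrow U hUo (fun p hp => by
    obtain ⟨d1, d2, d3, d4, -⟩ := hδη p hp
    exact mem_biUnion (x := p) hp ⟨⟨by linarith, by linarith⟩, ⟨by linarith, by linarith⟩⟩)
  have hUb : Bornology.IsBounded U := by
    rw [hU]
    exact (Bornology.isBounded_biUnion (s := (Z : Set (ℝ × ℝ))) Z.finite_toSet).2 (fun p _ => (Metric.isBounded_Ioo _ _).prod (Metric.isBounded_Ioo _ _))
  obtain ⟨R, hR⟩ := hUb.subset_closedBall 0
  have hUR : ∀ q ∈ U, |q.1| ≤ R ∧ |q.2| ≤ R := by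
    intro q hq
    have := hR hq
    rw [mem_closedBall_zero_iff, Prod.norm_def, max_le_iff] at this
    exact this
  have hcY := lead_growth hb hf (R := R+1) hκ (fun x y hy => hgr (x,y) (fun h => by have := (hUR _ h).2; simp only at this; linarith))
  have hcX := lead_growth ha (Pol_swap.2 hf) (R := R+1) hκ (fun y x hx => by
    rw [evalEval_swap]
    have := hgr (x,y) (fun h => by have := (hUR _ h).1; simp only at this; linarith)
    refine le_trans (le_of_eq ?_) this
    simp only; ring)
  have hl : 0 < (f.coeff (2*b)).coeff (2*a) := by
    refine lt_of_lt_of_le hκ (lead_ge _ _ (by omega) (Pol_coeff_natDegree hf _) κ (Eventually.of_forall fun x => ?_))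
    refine le_trans (mul_le_mul_of_nonneg_left ?_ hκ.le) (hcY x)
    rw [pow_mul]
    exact pow_le_pow_left₀ (sq_nonneg _) (by linarith) a
  -- perturbation size
  have hst : ∀ p : ℝ × ℝ, ∃ σ : ℝ, p ∈ Z → 0 < σ ∧ ∀ s α β : ℝ, 0 < s → s < σ → 0 < α → α < σ → 0 < β → β < σ →
      (∀ x ∈ Icc (p.1 - δ p) (p.1 + δ p), 0 < (derivative (pert a b f s α β)).evalEval x (p.2 + η p)) ∧
      (∀ x ∈ Icc (p.1 - δ p) (p.1 + δ p), (derivative (pert a b f s α β)).evalEval x (p.2 - η p) < 0) ∧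
      (∀ y ∈ Icc (p.2 - η p) (p.2 + η p), (derivative (pert a b f s α β)).evalEval (p.1 + δ p) y = 0 → 0 < (dX (pert a b f s α β)).evalEval (p.1 + δ p) y) ∧
      (∀ y ∈ Icc (p.2 - η p) (p.2 + η p), (derivative (pert a b f s α β)).evalEval (p.1 - δ p) y = 0 → (dX (pert a b f s α β)).evalEval (p.1 - δ p) y < 0) ∧
      (∀ x ∈ Icc (p.1 - δ p) (p.1 + δ p), ∀ y ∈ Icc (p.2 - η p) (p.2 + η p), (dX (pert a b f s α β)).evalEval x y = 0 →
        (derivative (pert a b f s α β)).evalEval x y = 0 → (pert a b f s α β).evalEval x y < κ/4) := by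
    intro p
    by_cases hp : p ∈ Z
    · obtain ⟨d1, d2, d3, d4, d5, d6, d7, d8, d9⟩ := hδη p hp
      obtain ⟨σ, hσ, h⟩ := local_stab a b f _ _ _ _ d5 d6 d7 d8 (by linarith) (by linarith) d9 (κ/4) (by positivity)
      exact ⟨σ, fun _ => ⟨hσ, h⟩⟩
    · exact ⟨0, fun h => absurd h hp⟩
  choose σ' hσ' using hst
  obtain ⟨σ, hσ0, hσκ, hσZ⟩ := finset_pos Z σ' (fun p hp => (hσ' p hp).1) (κ/4) (by positivity)
  obtain ⟨s, α, β, hs0, hs, hα0, hα, hβ0, hβ, hGood, hlead, hJc⟩ := generic_pert ha hb hf hl hσ0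
  have hloc := fun p hp => (hσ' p hp).2 s α β hs0 (hs.trans_le (hσZ p hp)) hα0 (hα.trans_le (hσZ p hp)) hβ0 (hβ.trans_le (hσZ p hp))
  have hfar : ∀ q : ℝ × ℝ, q ∉ U → κ/2 ≤ (pert a b f s α β).evalEval q.1 q.2 := by
    intro q hq
    rw [pert_eval]
    exact far_bound a b ha hb hκ hs0 hα0 hβ0 (by linarith) (by linarith) (hgr q hq)
  have hgY : ∃ Y0 > 0, ∀ x y, Y0 ≤ |y| → 0 < y * (derivative (pert a b f s α β)).evalEval x y := by
    refine growth_Y hb (pert_mem ha hb hf s α β) hκ (fun x => ?_)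
    rw [pert_coeff hb, eval_add, eval_C]
    linarith [hcY x]
  have hgX : ∃ X0 > 0, ∀ y x, X0 ≤ |x| → 0 < x * (dX (pert a b f s α β)).evalEval x y := by
    have := growth_Y ha (Pol_swap.2 (pert_mem ha hb hf s α β)) hκ (fun y => by
      rw [pert_swap, pert_coeff ha, eval_add, eval_C]
      linarith [hcX y])
    simpa only [← swap_dX, evalEval_swap] using this
  set g := pert a b f s α β with hg
  clear_value g
  obtain ⟨Y0, hY0, hYg⟩ := hgY
  obtain ⟨X0, hX0, hXg⟩ := hgX
  -- critical points
  have hZZ := hGood.ZZ_finite hJc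
  have hemb : Function.Injective (fun q : ℝ × ℝ => ((q.1 : ℂ), (q.2 : ℂ))) := by
    intro p q h
    simp only [Prod.mk.injEq, Complex.ofReal_inj] at h
    exact Prod.ext h.1 h.2
  have hmem : ∀ q : ℝ × ℝ, q ∈ ZZ g ↔ ((q.1 : ℂ), (q.2 : ℂ)) ∈ ZZ (cx g) := by
    intro q
    simp only [ZZ, mem_setOf_eq, cx_dX, cx_dY, cx_eval, Complex.ofReal_eq_zero]
  have hSfin : (ZZ g).Finite := by
    refine (hZZ.preimage hemb.injOn).subset (fun q hq => ?_)
    exact (hmem q).1 hq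
  set S := hSfin.toFinset with hSdef
  have hS : ∀ q, q ∈ S ↔ q ∈ ZZ g := fun q => by simp [hSdef]
  have hJr : ∀ q ∈ S, (JJ g).evalEval q.1 q.2 ≠ 0 := by
    intro q hq h0
    apply hJc _ ((hmem q).1 ((hS q).1 hq))
    rw [cx_JJ]
    simp only [cx_eval, h0, Complex.ofReal_zero]
  set sg : ℝ × ℝ → ℝ := fun q => if 0 < (JJ g).evalEval q.1 q.2 then (1:ℝ) else -1 with hsg
  have hSsum : ∑ q ∈ S, sg q = 1 := by
    refine box_degree (dX g) (derivative g) (x1 := -X0) (x2 := X0) (y1 := -Y0) (y2 := Y0) (by linarith) (by linarith) ?_ ?_ ?_ ?_ S ?_ hJr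
    · intro x _
      have := hYg x Y0 (le_abs_self _)
      exact (mul_pos_iff_of_pos_left hY0).1 this
    · intro x _
      have := hYg x (-Y0) (by rw [abs_neg]; exact le_abs_self _)
      nlinarith
    · intro y _ _
      have := hXg y X0 (le_abs_self _)
      exact (mul_pos_iff_of_pos_left hX0).1 this
    · intro y _ _
      have := hXg y (-X0) (by rw [abs_neg]; exact le_abs_self _)
      nlinarith
    · intro q
      rw [hS]
      constructor
      · rintro ⟨h1, h2⟩
        refine ⟨⟨abs_le.1 ?_, abs_le.1 ?_⟩, h1, h2⟩
        · by_contra h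
          have := hXg q.2 q.1 (not_le.1 h).le
          rw [h1] at this; simp at this
        · by_contra h
          have := hYg q.1 q.2 (not_le.1 h).le
          rw [h2] at this; simp at this
      · rintro ⟨-, h⟩; exact h
  have hBsum : ∀ p ∈ Z, ∑ q ∈ S.filter (inB p), sg q = 1 := by
    intro p hp
    obtain ⟨d1, d2, d3, d4, -⟩ := hδη p hp
    obtain ⟨c1, c2, c3, c4, -⟩ := hloc p hp
    refine box_degree (dX g) (derivative g) (by linarith) (by linarith) c1 c2 c3 c4 (S.filter (inB p)) ?_ ?_
    · intro q
      rw [Finset.mem_filter, hS, and_comm]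
      exact Iff.rfl
    · intro q hq
      exact hJr q (Finset.mem_filter.1 hq).1
  -- level
  obtain ⟨t, ⟨ht1, ht2⟩, ht⟩ : ∃ t ∈ Ioo (κ/4) (κ/2), t ∉ (fun q : ℂ × ℂ => ((cx g).evalEval q.1 q.2).re) '' ZZ (cx g) :=
    (Ioo_infinite (by linarith)).exists_notMem_finite (hZZ.image _)
  have hcount := sign_count hGood hJc hlead t (fun q hq h => ht ⟨q, hq, by simp only [h, Complex.ofReal_re]⟩) S hS
  have hposiff : ∀ u v : ℝ, u < 0 → v ≠ 0 → (if 0 < u / v then (1:ℝ) else 0) = (1 - (if 0 < v then (1:ℝ) else -1)) / 2 := by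
    intro u v hu hv
    rcases lt_or_gt_of_ne hv with h | h
    · rw [if_pos (div_pos_of_neg_of_neg hu h), if_neg (not_lt.2 h.le)]; norm_num
    · rw [if_neg (not_lt.2 (div_nonpos_of_nonpos_of_nonneg hu.le h.le)), if_pos h]; norm_num
  have hposiff' : ∀ u v : ℝ, 0 < u → v ≠ 0 → (if 0 < u / v then (1:ℝ) else 0) = (1 + (if 0 < v then (1:ℝ) else -1)) / 2 := by
    intro u v hu hv
    rcases lt_or_gt_of_ne hv with h | h
    · rw [if_neg (not_lt.2 (div_nonpos_of_nonneg_of_nonpos hu.le h.le)), if_neg (not_lt.2 h.le)]; norm_num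
    · rw [if_pos (div_pos hu h), if_pos h]; norm_num
  have hcl := count_lemma S Z inB hdis sg hSsum (fun p hp => by rw [← hBsum p hp]; congr!) (fun q => 0 < (g.evalEval q.1 q.2 - t) / (JJ g).evalEval q.1 q.2)
    (by
      rintro q hq ⟨p, hp, hpq⟩
      obtain ⟨-, -, -, -, c5⟩ := hloc p hp
      have hq' := (hS q).1 hq
      have := c5 q.1 hpq.1 q.2 hpq.2 hq'.1 hq'.2
      exact hposiff _ _ (by linarith) (hJr q hq))
    (by
      intro q hq hn
      have : q ∉ U := by
        intro h
        rw [hU, mem_iUnion₂] at h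
        obtain ⟨p, hp, h⟩ := h
        exact hn ⟨p, hp, ⟨Ioo_subset_Icc_self h.1, Ioo_subset_Icc_self h.2⟩⟩
      exact hposiff' _ _ (by linarith [hfar q this]) (hJr q hq))
  have hc2 : ∀ P : ℝ × ℝ → Prop, ∀ i1 i2 : DecidablePred P, (@Finset.filter _ P i1 S).card = (@Finset.filter _ P i2 S).card := by
    intro P i1 i2; congr!
  rw [hc2 _ _ (fun q => Classical.propDecidable _)] at hcl hcount
  omega

end Petro

set_option autoImplicit false
set_option linter.all false

namespace Petro
open Polynomial Filter Topology Set
open scoped Polynomial.Bivariate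

noncomputable def EE (F : MvPolynomial (Fin 4) ℝ) (u v : ℝ × ℝ) : ℝ := MvPolynomial.eval ![u.1, u.2, v.1, v.2] F

lemma EE_smul {F : MvPolynomial (Fin 4) ℝ} {m n : ℕ} (hF : Bihomogeneous F m n) (k l : ℝ) (u v : ℝ × ℝ) :
    EE F (k * u.1, k * u.2) (l * v.1, l * v.2) = k ^ m * l ^ n * EE F u v := by
  simp only [EE, MvPolynomial.eval_eq', Finset.mul_sum, Fin.prod_univ_four]
  refine Finset.sum_congr rfl fun d hd => ?_
  obtain ⟨h1, h2⟩ := hF d hd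
  rw [← h1, ← h2]
  simp [mul_pow, pow_add]
  ring

lemma EE_cont (F : MvPolynomial (Fin 4) ℝ) : Continuous (fun w : (ℝ × ℝ) × (ℝ × ℝ) => EE F w.1 w.2) := by
  simp only [EE, MvPolynomial.eval_eq', Fin.prod_univ_four]
  simp
  fun_prop

abbrev PP := Projectivization ℝ (Fin 2 → ℝ)

noncomputable def mkP (u : ℝ × ℝ) (hu : u ≠ 0) : PP :=
  Projectivization.mk ℝ ![u.1, u.2] (fun h => hu (by
    have h0 := congrFun h 0
    have h1 := congrFun h 1
    exact Prod.ext h0 h1))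

lemma mkP_rep (u : ℝ × ℝ) (hu : u ≠ 0) : ∃ k : ℝ, k ≠ 0 ∧ u = (k * (mkP u hu).rep 0, k * (mkP u hu).rep 1) := by
  obtain ⟨k, hk⟩ := Projectivization.exists_smul_eq_mk_rep ℝ ![u.1, u.2] (fun h => hu (by
    have h0 := congrFun h 0
    have h1 := congrFun h 1
    exact Prod.ext h0 h1))
  refine ⟨(k⁻¹ : ℝˣ), k⁻¹.ne_zero, ?_⟩
  simp only [mkP]
  rw [← hk]
  ext <;> simp [Units.smul_def]

lemma mkP_eq (p : PP) (u : ℝ × ℝ) (k : ℝ) (hu : u ≠ 0) (h0 : p.rep 0 = k * u.1) (h1 : p.rep 1 = k * u.2) : p = mkP u hu := by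
  rw [← p.mk_rep, mkP, Projectivization.mk_eq_mk_iff']
  refine ⟨k, ?_⟩
  ext i; fin_cases i <;> simp [h0, h1]

lemma mkP_inj {u v : ℝ × ℝ} (hu : u ≠ 0) (hv : v ≠ 0) (h : mkP u hu = mkP v hv) : u.1 * v.2 = u.2 * v.1 := by
  obtain ⟨k, hk, e⟩ := mkP_rep u hu
  obtain ⟨l, hl, e'⟩ := mkP_rep v hv
  rw [h] at e
  have e1 := congrArg Prod.fst e
  have e2 := congrArg Prod.snd e
  have e3 := congrArg Prod.fst e'
  have e4 := congrArg Prod.snd e'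
  simp only at e1 e2 e3 e4
  rw [e1, e2, e3, e4]; ring

lemma mem_RZ2_mkP {F : MvPolynomial (Fin 4) ℝ} {m n : ℕ} (hF : Bihomogeneous F m n) {u v : ℝ × ℝ} (hu : u ≠ 0) (hv : v ≠ 0) :
    (mkP u hu, mkP v hv) ∈ RZ2 F ↔ EE F u v = 0 := by
  obtain ⟨k, hk, e⟩ := mkP_rep u hu
  obtain ⟨l, hl, e'⟩ := mkP_rep v hv
  conv_rhs => rw [e, e']
  rw [EE_smul hF k l ((mkP u hu).rep 0, (mkP u hu).rep 1) ((mkP v hv).rep 0, (mkP v hv).rep 1)]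
  simp only [mul_eq_zero, pow_eq_zero_iff', hk, hl, false_and, false_or]
  exact Iff.rfl

lemma rep_ne (p : PP) : ((p.rep 0, p.rep 1) : ℝ × ℝ) ≠ 0 := by
  intro h
  apply p.rep_nonzero
  rw [Prod.mk_eq_zero] at h
  ext i; fin_cases i
  · exact h.1
  · exact h.2

/-- rotated lift -/
def lft (c s x : ℝ) : ℝ × ℝ := (x * c - s, x * s + c)

lemma lft_ne {c s : ℝ} (h : c^2 + s^2 = 1) (x : ℝ) : lft c s x ≠ 0 := by
  intro h0
  simp only [lft, Prod.mk_eq_zero] at h0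
  obtain ⟨h1, h2⟩ := h0
  have e1 : s = x * c := by linarith
  have e2 : c = - (x * s) := by linarith
  have : (1 + x^2) * c = 0 := by rw [e1] at e2; linear_combination e2
  have hc : c = 0 := (mul_eq_zero.1 this).resolve_left (by positivity)
  rw [hc, mul_zero] at e1
  rw [hc, e1] at h; norm_num at h

lemma lft_sq {c s : ℝ} (h : c^2 + s^2 = 1) (x : ℝ) : (lft c s x).1^2 + (lft c s x).2^2 = 1 + x^2 := by
  simp only [lft]; linear_combination (1 + x^2) * h

lemma lft_of {c s : ℝ} (h : c^2 + s^2 = 1) (u : ℝ × ℝ) (hD : c * u.2 - s * u.1 ≠ 0) :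
    u = ((c * u.2 - s * u.1) * (lft c s ((c * u.1 + s * u.2) / (c * u.2 - s * u.1))).1,
      (c * u.2 - s * u.1) * (lft c s ((c * u.1 + s * u.2) / (c * u.2 - s * u.1))).2) := by
  set D := c * u.2 - s * u.1 with hDd
  ext
  · simp only [lft]
    rw [mul_sub, ← mul_assoc, mul_div_cancel₀ _ hD, hDd]; linear_combination (-u.1) * h
  · simp only [lft]
    rw [mul_add, ← mul_assoc, mul_div_cancel₀ _ hD, hDd]; linear_combination (-u.2) * h

lemma exists_dir (S : Set PP) (hS : S.Finite) : ∃ c s : ℝ, c^2 + s^2 = 1 ∧ ∀ p ∈ S, c * p.rep 1 - s * p.rep 0 ≠ 0 := by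
  have hne : ∀ m : ℝ, ((1, m) : ℝ × ℝ) ≠ 0 := fun m h => by simp [Prod.mk_eq_zero] at h
  have hinj : Function.Injective (fun m : ℝ => mkP (1, m) (hne m)) := by
    intro m m' h
    have := mkP_inj _ _ h
    simp at this; exact this.symm
  obtain ⟨m, hm⟩ := (hS.preimage hinj.injOn).infinite_compl.nonempty
  have hr : 0 < Real.sqrt (1 + m^2) := Real.sqrt_pos.2 (by positivity)
  have hr2 : Real.sqrt (1 + m^2) ^ 2 = 1 + m^2 := Real.sq_sqrt (by positivity)
  refine ⟨1 / Real.sqrt (1 + m^2), m / Real.sqrt (1 + m^2), ?_, fun p hp h => hm ?_⟩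
  · rw [div_pow, div_pow, hr2]; field_simp
  · have h' : p.rep 1 = m * p.rep 0 := by field_simp at h; linarith
    show mkP (1, m) (hne m) ∈ S
    rw [← mkP_eq p (1, m) (p.rep 0) (hne m) (by simp) (by rw [h']; simp only; ring)]
    exact hp

/-- affine polynomial -/
noncomputable def aff (F : MvPolynomial (Fin 4) ℝ) (c s c' s' : ℝ) : ℝ[X][Y] :=
  MvPolynomial.aeval ![C (X * C c - C s), C (X * C s + C c), Y * C (C c') - C (C s'), Y * C (C s') + C (C c')] F

lemma aff_eval (F : MvPolynomial (Fin 4) ℝ) (c s c' s' x y : ℝ) :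
    (aff F c s c' s').evalEval x y = EE F (lft c s x) (lft c' s' y) := by
  have : (evalEvalRingHom x y).comp (MvPolynomial.aeval ![C (X * C c - C s), C (X * C s + C c), Y * C (C c') - C (C s'), Y * C (C s') + C (C c')]
      : MvPolynomial (Fin 4) ℝ →ₐ[ℝ] ℝ[X][Y]).toRingHom = MvPolynomial.eval ![(lft c s x).1, (lft c s x).2, (lft c' s' y).1, (lft c' s' y).2] := by
    apply MvPolynomial.ringHom_ext
    · intro r; simp [evalEval_C, algebraMap_def]
    · intro i; fin_cases i <;> simp [lft, evalEval_C] <;> ring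
  exact congrArg (fun φ => φ F) this

lemma Pol_pow {p : ℝ[X][Y]} {k l : ℕ} (hp : p ∈ Pol ℝ (k+1) (l+1)) (n : ℕ) : p ^ n ∈ Pol ℝ (n*k+1) (n*l+1) := by
  induction n with
  | zero =>
    have := Pol_Xpow (K := ℝ) (k := 1) (l := 1) (j := 0) one_pos one_pos
    simpa using this
  | succ n ih =>
    rw [pow_succ]
    exact Pol_mul ih hp (by rw [add_mul]; omega) (by rw [add_mul]; omega)

lemma aff_mem {F : MvPolynomial (Fin 4) ℝ} {m n : ℕ} (hF : Bihomogeneous F m n) (c s c' s' : ℝ) :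
    aff F c s c' s' ∈ Pol ℝ (m+1) (n+1) := by
  rw [aff, MvPolynomial.aeval_def, MvPolynomial.eval₂_eq']
  refine Submodule.sum_mem _ fun d hd => ?_
  obtain ⟨h1, h2⟩ := hF d hd
  rw [← Algebra.smul_def]
  refine Submodule.smul_mem _ _ ?_
  rw [Fin.prod_univ_four]
  have hX : ∀ p q : ℝ, C (X * C p + C q) ∈ Pol ℝ (1+1) (0+1) := by
    intro p q
    refine Pol_C ?_ one_pos
    refine lt_of_le_of_lt (b := (1 : WithBot ℕ)) ?_ (by norm_num)
    compute_degree
  have hYm : ∀ p q : ℝ, Y * C (C p) + C (C q) ∈ Pol ℝ (0+1) (1+1) := by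
    intro p q
    refine Submodule.add_mem _ ?_ (Pol_C (lt_of_le_of_lt degree_C_le (by norm_num)) (by norm_num))
    have hYY : (Y : ℝ[X][Y]) ∈ Pol ℝ 1 2 := by
      have := Pol_Xpow (K := ℝ) (j := 1) (k := 1) (l := 2) (by norm_num) (by norm_num)
      simpa using this
    exact Pol_mul hYY (Pol_C (k := 1) (l := 1) (lt_of_le_of_lt degree_C_le (by norm_num)) (by norm_num)) (by norm_num) (by norm_num)
  have k0 := Pol_pow (hX c (-s)) (d 0)
  have k1 := Pol_pow (hX s c) (d 1)
  have k2 := Pol_pow (hYm c' (-s')) (d 2)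
  have k3 := Pol_pow (hYm s' c') (d 3)
  have e0 : C (X * C c + C (-s)) = C (X * C c - C s) := by simp [sub_eq_add_neg]
  have e2 : Y * C (C c') + C (C (-s')) = Y * C (C c') - C (C s') := by simp [sub_eq_add_neg]
  rw [e0] at k0
  rw [e2] at k2
  have k01 := Pol_mul k0 k1 (k' := m+1) (l' := 1) (by omega) (by omega)
  have k012 := Pol_mul k01 k2 (k' := m+1) (l' := d 2 + 1) (by omega) (by omega)
  exact Pol_mul k012 k3 (k' := m+1) (l' := n+1) (by omega) (by omega)

end Petro

set_option autoImplicit false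
set_option linter.all false

namespace Petro
open Polynomial Filter Topology Set
open scoped Polynomial.Bivariate

lemma sign_dich (f : ℝ[X][Y]) (hz : {q : ℝ × ℝ | f.evalEval q.1 q.2 = 0}.Finite) :
    (∀ x y, 0 ≤ f.evalEval x y) ∨ (∀ x y, f.evalEval x y ≤ 0) := by
  by_contra hcon
  push Not at hcon
  obtain ⟨⟨x, y, h1⟩, ⟨x', y', h2⟩⟩ := hcon
  have hr : 1 < Module.rank ℝ (ℝ × ℝ) := by
    rw [← Module.finrank_eq_rank]; simp
  have hc := (hz.countable.isPathConnected_compl_of_one_lt_rank hr).isConnected.isPreconnected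
  obtain ⟨q, hq, hq0⟩ := hc.intermediate_value (a := (x, y)) (b := (x', y')) (f := fun q : ℝ × ℝ => f.evalEval q.1 q.2)
    (fun h => h1.ne h) (fun h => h2.ne' h) (ev_cont f).continuousOn ⟨h1.le, h2.le⟩
  exact hq hq0

lemma circ_compact : IsCompact {u : ℝ × ℝ | u.1^2 + u.2^2 = 1} := by
  refine IsCompact.of_isClosed_subset (isCompact_Icc.prod isCompact_Icc : IsCompact (Icc (-1:ℝ) 1 ×ˢ Icc (-1:ℝ) 1))
    (isClosed_eq (by fun_prop) (by fun_prop)) ?_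
  intro u hu
  simp only [mem_setOf_eq] at hu
  refine ⟨abs_le.1 (abs_le_one_iff_mul_self_le_one.2 ?_), abs_le.1 (abs_le_one_iff_mul_self_le_one.2 ?_)⟩ <;> nlinarith [sq_nonneg u.1, sq_nonneg u.2]

lemma circ_ne {u : ℝ × ℝ} (hu : u.1^2 + u.2^2 = 1) : u ≠ 0 := by
  rintro rfl; norm_num at hu

lemma growth {F : MvPolynomial (Fin 4) ℝ} {a b : ℕ} (hF : Bihomogeneous F (2*a) (2*b)) {c s c' s' : ℝ} (h : c^2 + s^2 = 1)
    (h' : c'^2 + s'^2 = 1) (hinf : ∀ u v : ℝ × ℝ, u ≠ 0 → v ≠ 0 → EE F u v = 0 → c * u.2 - s * u.1 ≠ 0 ∧ c' * v.2 - s' * v.1 ≠ 0)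
    (hpos : ∀ x y, 0 ≤ (aff F c s c' s').evalEval x y)
    (U : Set (ℝ × ℝ)) (hU : IsOpen U) (hZU : ∀ q : ℝ × ℝ, (aff F c s c' s').evalEval q.1 q.2 = 0 → q ∈ U) :
    ∃ κ > 0, ∀ q : ℝ × ℝ, q ∉ U → κ * (1 + q.1^2)^a * (1 + q.2^2)^b ≤ (aff F c s c' s').evalEval q.1 q.2 := by
  set D : ℝ → ℝ → ℝ × ℝ → ℝ := fun c s u => c * u.2 - s * u.1 with hD
  set N : ℝ → ℝ → ℝ × ℝ → ℝ := fun c s u => c * u.1 + s * u.2 with hN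
  set O : Set ((ℝ × ℝ) × (ℝ × ℝ)) := {w | D c s w.1 ≠ 0 ∧ D c' s' w.2 ≠ 0} with hO
  have hOo : IsOpen O := by
    refine (isOpen_ne_fun (g := fun _ => (0:ℝ)) ?_ continuous_const).inter (isOpen_ne_fun (g := fun _ => (0:ℝ)) ?_ continuous_const)
    · simp only [hD]; fun_prop
    · simp only [hD]; fun_prop
  set φ : (ℝ × ℝ) × (ℝ × ℝ) → ℝ × ℝ := fun w => (N c s w.1 / D c s w.1, N c' s' w.2 / D c' s' w.2) with hφ
  have hφc : ContinuousOn φ O := by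
    refine ContinuousOn.prodMk (ContinuousOn.div ?_ ?_ fun w hw => hw.1) (ContinuousOn.div ?_ ?_ fun w hw => hw.2) <;>
    · simp only [hD, hN]; fun_prop
  have hVo : IsOpen (O ∩ φ ⁻¹' U) := hφc.isOpen_inter_preimage hOo hU
  have hK : IsCompact (({u : ℝ × ℝ | u.1^2 + u.2^2 = 1} ×ˢ {u : ℝ × ℝ | u.1^2 + u.2^2 = 1}) \ (O ∩ φ ⁻¹' U)) :=
    (circ_compact.prod circ_compact).diff hVo
  obtain ⟨κ, hκ, hk⟩ := exists_pos_le hK (g := fun w => |EE F w.1 w.2|) (EE_cont F).abs.continuousOn (by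
    rintro w ⟨⟨hw1, hw2⟩, hw⟩
    rw [abs_pos]
    intro h0
    obtain ⟨d1, d2⟩ := hinf w.1 w.2 (circ_ne hw1) (circ_ne hw2) h0
    refine hw ⟨⟨d1, d2⟩, hZU _ ?_⟩
    rw [aff_eval]
    have e1 := lft_of h w.1 d1
    have e2 := lft_of h' w.2 d2
    rw [e1, e2, EE_smul hF, mul_eq_zero] at h0
    exact h0.resolve_left (mul_ne_zero (pow_ne_zero _ d1) (pow_ne_zero _ d2)))
  refine ⟨κ, hκ, fun q hq => ?_⟩
  have unit : ∀ c s : ℝ, c^2 + s^2 = 1 → ∀ x : ℝ, ∃ (u : ℝ × ℝ) (r : ℝ), r^2 = 1 + x^2 ∧ u.1^2 + u.2^2 = 1 ∧ N c s u / D c s u = x ∧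
      lft c s x = (r * u.1, r * u.2) := by
    intro c s h x
    have hr : 0 < Real.sqrt (1 + x^2) := Real.sqrt_pos.2 (by positivity)
    have hr2 : Real.sqrt (1 + x^2) ^ 2 = 1 + x^2 := Real.sq_sqrt (by positivity)
    set r := Real.sqrt (1 + x^2)
    refine ⟨((lft c s x).1 / r, (lft c s x).2 / r), r, hr2, ?_, ?_, ?_⟩
    · simp only [div_pow, hr2]; rw [← add_div, lft_sq h, div_self (by positivity)]
    · have eD : D c s ((lft c s x).1 / r, (lft c s x).2 / r) = 1 / r := by
        simp only [hD, lft]; field_simp; linear_combination h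
      have eN : N c s ((lft c s x).1 / r, (lft c s x).2 / r) = x / r := by
        simp only [hN, lft]; field_simp; linear_combination x * h
      rw [eD, eN]; field_simp
    · ext <;> simp only <;> field_simp
  obtain ⟨u, r, hr, hu, hux, hul⟩ := unit c s h q.1
  obtain ⟨v, r', hr', hv, hvx, hvl⟩ := unit c' s' h' q.2
  have hb := hk (u, v) ⟨⟨hu, hv⟩, fun hn => hq (by
    have := hn.2
    simp only [hφ, mem_preimage, hux, hvx] at this
    exact this)⟩
  have e : (aff F c s c' s').evalEval q.1 q.2 = (1 + q.1^2)^a * (1 + q.2^2)^b * EE F u v := by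
    rw [aff_eval, hul, hvl, EE_smul hF, pow_mul, pow_mul, hr, hr']
  rw [← abs_of_nonneg (hpos q.1 q.2), e, abs_mul, abs_of_pos (by positivity : 0 < (1 + q.1^2)^a * (1 + q.2^2)^b), mul_assoc, mul_comm κ]
  exact mul_le_mul_of_nonneg_left hb (by positivity)

lemma RZ2_neg (F : MvPolynomial (Fin 4) ℝ) : RZ2 (-F) = RZ2 F := by
  ext p; simp [RZ2]

lemma core {a b : ℕ} (ha : 1 ≤ a) (hb : 1 ≤ b) {F : MvPolynomial (Fin 4) ℝ} (hF : Bihomogeneous F (2*a) (2*b)) (hfin : (RZ2 F).Finite)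
    {c s c' s' : ℝ} (h : c^2 + s^2 = 1)
    (h' : c'^2 + s'^2 = 1) (hinf : ∀ p ∈ RZ2 F, c * p.1.rep 1 - s * p.1.rep 0 ≠ 0 ∧ c' * p.2.rep 1 - s' * p.2.rep 0 ≠ 0)
    (hz : {q : ℝ × ℝ | (aff F c s c' s').evalEval q.1 q.2 = 0}.Finite)
    (hpos : ∀ x y, 0 ≤ (aff F c s c' s').evalEval x y) :
    (RZ2 F).ncard + a + b ≤ 3 * (a * b) + 1 := by
  have hinf' : ∀ u v : ℝ × ℝ, u ≠ 0 → v ≠ 0 → EE F u v = 0 → c * u.2 - s * u.1 ≠ 0 ∧ c' * v.2 - s' * v.1 ≠ 0 := by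
    intro u v hu hv h0
    have h1 := hinf _ ((mem_RZ2_mkP hF hu hv).2 h0)
    obtain ⟨k, hk, e⟩ := mkP_rep u hu
    obtain ⟨l, hl, e'⟩ := mkP_rep v hv
    have e1 := congrArg Prod.fst e
    have e2 := congrArg Prod.snd e
    have e3 := congrArg Prod.fst e'
    have e4 := congrArg Prod.snd e'
    simp only at e1 e2 e3 e4 h1
    constructor
    · rw [e1, e2]; intro h0; apply mul_ne_zero hk h1.1; linear_combination h0
    · rw [e3, e4]; intro h0; apply mul_ne_zero hl h1.2; linear_combination h0
  have hZ : ∀ q : ℝ × ℝ, q ∈ hz.toFinset ↔ (aff F c s c' s').evalEval q.1 q.2 = 0 := fun q => by simp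
  have hm := main_affine ha hb (aff_mem hF c s c' s') hpos hz.toFinset hZ (fun U hU hZU =>
    growth hF h h' hinf' hpos U hU (fun q hq => hZU q ((hZ q).2 hq)))
  have hsub : RZ2 F ⊆ (fun q : ℝ × ℝ => (mkP (lft c s q.1) (lft_ne h _), mkP (lft c' s' q.2) (lft_ne h' _))) ''
      {q : ℝ × ℝ | (aff F c s c' s').evalEval q.1 q.2 = 0} := by
    rintro ⟨p, p'⟩ hp
    obtain ⟨d1, d2⟩ := hinf _ hp
    simp only at d1 d2
    have e1 := lft_of h (p.rep 0, p.rep 1) d1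
    have e2 := lft_of h' (p'.rep 0, p'.rep 1) d2
    have f1 := mkP_eq p _ _ (lft_ne h _) (congrArg Prod.fst e1) (congrArg Prod.snd e1)
    have f2 := mkP_eq p' _ _ (lft_ne h' _) (congrArg Prod.fst e2) (congrArg Prod.snd e2)
    refine ⟨(_, _), ?_, Prod.ext f1.symm f2.symm⟩
    rw [mem_setOf_eq, aff_eval]
    rw [f1, f2, mem_RZ2_mkP hF] at hp
    exact hp
  have hcard := (Set.ncard_le_ncard hsub (hz.image _)).trans (Set.ncard_image_le hz)
  rw [Set.ncard_eq_toFinset_card _ hz] at hcard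
  omega

lemma zeros_fin {F : MvPolynomial (Fin 4) ℝ} {m n : ℕ} (hF : Bihomogeneous F m n) (hfin : (RZ2 F).Finite)
    {c s c' s' : ℝ} (h : c^2 + s^2 = 1) (h' : c'^2 + s'^2 = 1) :
    {q : ℝ × ℝ | (aff F c s c' s').evalEval q.1 q.2 = 0}.Finite := by
  have hinj : Function.Injective (fun q : ℝ × ℝ => (mkP (lft c s q.1) (lft_ne h _), mkP (lft c' s' q.2) (lft_ne h' _))) := by
    intro q q' hq
    simp only [Prod.mk.injEq] at hq
    have h1 := mkP_inj _ _ hq.1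
    have h2 := mkP_inj _ _ hq.2
    simp only [lft] at h1 h2
    ext
    · linear_combination (-(q.1 - q'.1)) * h + h1
    · linear_combination (-(q.2 - q'.2)) * h' + h2
  refine (hfin.preimage hinj.injOn).subset (fun q hq => ?_)
  rw [mem_setOf_eq, aff_eval] at hq
  exact (mem_RZ2_mkP hF _ _).2 hq

theorem final {a b : ℕ} (ha : 1 ≤ a) (hb : 1 ≤ b) {F : MvPolynomial (Fin 4) ℝ} (hF : Bihomogeneous F (2*a) (2*b)) (hfin : (RZ2 F).Finite) :
    (RZ2 F).ncard + a + b ≤ 3 * (a * b) + 1 := by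
  obtain ⟨c, s, h, h1⟩ := exists_dir _ (hfin.image Prod.fst)
  obtain ⟨c', s', h', h2⟩ := exists_dir _ (hfin.image Prod.snd)
  have hinf : ∀ p ∈ RZ2 F, c * p.1.rep 1 - s * p.1.rep 0 ≠ 0 ∧ c' * p.2.rep 1 - s' * p.2.rep 0 ≠ 0 :=
    fun p hp => ⟨h1 _ ⟨p, hp, rfl⟩, h2 _ ⟨p, hp, rfl⟩⟩
  have hz := zeros_fin hF hfin h h'
  rcases sign_dich _ hz with hp | hp
  · exact core ha hb hF hfin h h' hinf hz hp
  · have hneg : aff (-F) c s c' s' = - aff F c s c' s' := by simp [aff]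
    have hF' : Bihomogeneous (-F) (2*a) (2*b) := by
      intro d hd; rw [MvPolynomial.support_neg] at hd; exact hF d hd
    have hfin' : (RZ2 (-F)).Finite := by rw [RZ2_neg]; exact hfin
    rw [← RZ2_neg]
    refine core ha hb hF' hfin' h h' (by rw [RZ2_neg]; exact hinf) (zeros_fin hF' hfin' h h') (fun x y => ?_)
    rw [hneg, evalEval_neg]
    linarith [hp x y]

end Petro

theorem stmt_16 (a b : ℕ) (ha : 1 ≤ a) (hb : 1 ≤ b)
    (F : MvPolynomial (Fin 4) ℝ) (hF : F ≠ 0)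
    (hbi : Bihomogeneous F (2 * a) (2 * b))
    (hsf : Squarefree (MvPolynomial.map (algebraMap ℝ ℂ) F))
    (hfin : (RZ2 F).Finite) :
    ((RZ2 F).ncard : ℤ) ≤ 3 * (a : ℤ) * (b : ℤ) - (a : ℤ) - (b : ℤ) + 1 := by
  have h := Petro.final ha hb hbi hfin
  zify at h
  linarith
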